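/- Let (r₁¹, r₂¹, r¹) and (r₁², r₂², r²) be triples with 1 < r₁ʲ, r₂ʲ ≤ ∞, 1/2 < rʲ < ∞ and 1/r₁ʲ + 1/r₂ʲ = 1/rʲ for j = 1, 2, and let 1 < p, q ≤ ∞ and 1/2 < s < ∞ with 1/p + 1/q = 1/s. Then there is a constant C, depending only on φ and the exponents, such that for all N, M ∈ ℕ, every finite set Λ ⊆ ℤ, and all doubly indexed families (f_{k,l})_{1≤k≤N, 1≤l≤M}, (g_{k,l})_{1≤k≤N, 1≤l≤M} of Schwartz functions ℝ → ℂ: ‖ (Σ_{k=1}^N (Σ_{l=1}^M |Π_Λ(f_{k,l}, g_{k,l})|^{r²})^{r¹/r²})^{1/r¹} ‖_{L^s(ℝ)} ≤ C · ‖ (Σ_k (Σ_l |f_{k,l}|^{r₁²})^{r₁¹/r₁²})^{1/r₁¹} ‖_{L^p(ℝ)} · ‖ (Σ_k (Σ_l |g_{k,l}|^{r₂²})^{r₂¹/r₂²})^{1/r₂¹} ‖_{L^q(ℝ)}, where any inner or outer ℓ-expression with exponent ∞ is interpreted as a maximum. (This is the depth-two case of the paper's multiple vector-valued theorem for paraproducts.)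 -/

import Mathlib

open MeasureTheory ENNReal NNReal

/-- Convolution on `ℝ`: `(f ∗ g)(x) = ∫ f(t) g(x − t) dt`. -/
noncomputable def conv (f g : ℝ → ℂ) : ℝ → ℂ := fun x => ∫ t, f t * g (x - t)

/-- The Fourier transform `f̂(ξ) = ∫ f(x) e^{−2πixξ} dx`. -/
noncomputable def ft1 (f : ℝ → ℂ) (ξ : ℝ) : ℂ :=
  ∫ x, f x * Complex.exp (((-2) * Real.pi * x * ξ : ℝ) * Complex.I)

/-- The `L¹`-normalized dyadic dilation `u_k(x) = 2^k u(2^k x)`. -/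
noncomputable def dil (u : ℝ → ℂ) (k : ℤ) : ℝ → ℂ :=
  fun x => (2 : ℂ) ^ k * u ((2 : ℝ) ^ k * x)

/-- The function `ψ` with `ψ̂(ξ) = φ̂(ξ/2) − φ̂(ξ)`, i.e. `ψ(x) = 2φ(2x) − φ(x)`. -/
noncomputable def psiOf (φ : ℝ → ℂ) : ℝ → ℂ := fun x => 2 * φ (2 * x) - φ x

/-- The truncated classical paraproduct
`Π_Λ(f,g) = Σ_{k∈Λ} ((f ∗ φ_k)·(g ∗ ψ_k)) ∗ ψ_k`. -/
noncomputable def para (φ : ℝ → ℂ) (Λ : Finset ℤ) (f g : ℝ → ℂ) : ℝ → ℂ :=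
  fun x => ∑ k ∈ Λ,
    conv (fun y => conv f (dil φ k) y * conv g (dil (psiOf φ) k) y) (dil (psiOf φ) k) x

/-- Finite `ℓ^t` expression `(Σ_{k<N} a_k^t)^{1/t}`, interpreted as a maximum when `t = ∞`. -/
noncomputable def ellN (t : ℝ≥0∞) (N : ℕ) (a : ℕ → ℝ≥0∞) : ℝ≥0∞ :=
  if t = ∞ then ⨆ k ∈ Finset.range N, a k
  else (∑ k ∈ Finset.range N, a k ^ t.toReal) ^ (1 / t.toReal)

/-- The Lebesgue (quasi)norm with exponent `t ∈ (0, ∞]` of an `ℝ≥0∞`-valued function,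
interpreted as the essential supremum when `t = ∞`. -/
noncomputable def LqNorm {X : Type*} [MeasurableSpace X] (μ : Measure X) (t : ℝ≥0∞)
    (φ : X → ℝ≥0∞) : ℝ≥0∞ :=
  if t = ∞ then essSup φ μ else (∫⁻ x, φ x ^ t.toReal ∂μ) ^ (1 / t.toReal)

set_option autoImplicit false

namespace Paraproduct

open Filter Topology

lemma LqNorm_mono {X : Type*} [MeasurableSpace X] {μ : Measure X} {t : ℝ≥0∞}
    {F G : X → ℝ≥0∞} (h : ∀ x, F x ≤ G x) : LqNorm μ t F ≤ LqNorm μ t G := by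
  unfold LqNorm
  split_ifs
  · exact essSup_mono_ae (Eventually.of_forall h)
  · exact ENNReal.rpow_le_rpow
      (lintegral_mono fun x => ENNReal.rpow_le_rpow (h x) ENNReal.toReal_nonneg) (by positivity)

lemma toReal_pos_of {t : ℝ≥0∞} (h0 : t ≠ 0) (h : t ≠ ∞) : 0 < t.toReal :=
  ENNReal.toReal_pos h0 h

lemma LqNorm_const_mul {X : Type*} [MeasurableSpace X] {μ : Measure X} {t : ℝ≥0∞} (ht : t ≠ 0)
    {c : ℝ≥0∞} (hc : c ≠ ∞) (F : X → ℝ≥0∞) :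
    LqNorm μ t (fun x => c * F x) = c * LqNorm μ t F := by
  unfold LqNorm
  split_ifs with h
  · exact ENNReal.essSup_const_mul
  · have hp := toReal_pos_of ht h
    have h1 : ∀ x, (c * F x) ^ t.toReal = c ^ t.toReal * F x ^ t.toReal := fun x =>
      ENNReal.mul_rpow_of_nonneg _ _ hp.le
    simp_rw [h1]
    rw [lintegral_const_mul' _ _ (ENNReal.rpow_ne_top_of_nonneg hp.le hc),
      ENNReal.mul_rpow_of_nonneg _ _ (by positivity), ← ENNReal.rpow_mul, mul_one_div_cancel hp.ne',
      ENNReal.rpow_one]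

/-- Hölder's inequality for `LqNorm` with one factor measured in the essential supremum norm. -/
lemma LqNorm_mul_le_essSup {X : Type*} [MeasurableSpace X] {μ : Measure X} {t : ℝ}
    (ht : 0 < t) {F G : X → ℝ≥0∞} (hG : AEMeasurable G μ) :
    (∫⁻ x, (F x * G x) ^ t ∂μ) ^ (1 / t) ≤ essSup F μ * (∫⁻ x, G x ^ t ∂μ) ^ (1 / t) := by
  have h1 : ∫⁻ x, (F x * G x) ^ t ∂μ ≤ essSup F μ ^ t * ∫⁻ x, G x ^ t ∂μ := by
    rw [← lintegral_const_mul'' _ (hG.pow_const t)]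
    refine lintegral_mono_ae ?_
    filter_upwards [ENNReal.ae_le_essSup F] with x hx
    rw [ENNReal.mul_rpow_of_nonneg _ _ ht.le]
    gcongr
  calc _ ≤ (essSup F μ ^ t * ∫⁻ x, G x ^ t ∂μ) ^ (1 / t) :=
        ENNReal.rpow_le_rpow h1 (by positivity)
    _ = _ := by
        rw [ENNReal.mul_rpow_of_nonneg _ _ (by positivity), ← ENNReal.rpow_mul,
          mul_one_div_cancel ht.ne', ENNReal.rpow_one]

/-- Hölder's inequality for the full range of exponents with finite target exponent. -/
lemma LqNorm_holder {X : Type*} [MeasurableSpace X] {μ : Measure X} {p q s : ℝ≥0∞}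
    (hp : p ≠ 0) (hq : q ≠ 0) (hs0 : s ≠ 0) (hs : s ≠ ∞) (h : s⁻¹ = p⁻¹ + q⁻¹) {F G : X → ℝ≥0∞}
    (hF : AEMeasurable F μ) (hG : AEMeasurable G μ) :
    LqNorm μ s (fun x => F x * G x) ≤ LqNorm μ p F * LqNorm μ q G := by
  have hsp := toReal_pos_of hs0 hs
  by_cases hp' : p = ∞
  · have hqs : q = s := by
      rw [hp'] at h
      simpa using h.symm
    subst hqs
    unfold LqNorm
    rw [if_neg hs, if_pos hp', if_neg hs]
    exact LqNorm_mul_le_essSup hsp hG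
  by_cases hq' : q = ∞
  · have hps : p = s := by
      rw [hq'] at h
      simpa using h.symm
    subst hps
    unfold LqNorm
    rw [if_neg hs, if_pos hq', if_neg hs, mul_comm]
    simp_rw [mul_comm (F _)]
    exact LqNorm_mul_le_essSup hsp hF
  have hpp := toReal_pos_of hp hp'
  have hqp := toReal_pos_of hq hq'
  have hr : 1 / s.toReal = 1 / p.toReal + 1 / q.toReal := by
    have := congrArg ENNReal.toReal h
    rw [ENNReal.toReal_add (by simpa using hp) (by simpa using hq)] at this
    simpa [ENNReal.toReal_inv, one_div] using this
  unfold LqNorm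
  rw [if_neg hs, if_neg hp', if_neg hq']
  refine ENNReal.lintegral_Lp_mul_le_Lq_mul_Lr hsp ?_ hr μ hF hG
  have : 1 / p.toReal < 1 / s.toReal := by
    rw [hr]
    have : 0 < 1 / q.toReal := by positivity
    linarith
  exact (one_div_lt_one_div hpp hsp).1 this

lemma ellN_eq_LqNorm (t : ℝ≥0∞) (N : ℕ) (a : ℕ → ℝ≥0∞) :
    ellN t N a = LqNorm (Measure.count : Measure (Fin N)) t (fun i => a i) := by
  unfold ellN LqNorm
  split_ifs with h
  · rw [essSup_count]
    apply le_antisymm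
    · refine iSup₂_le fun k hk => ?_
      exact le_iSup (fun i : Fin N => a i) ⟨k, Finset.mem_range.1 hk⟩
    · refine iSup_le fun i => ?_
      exact le_iSup₂_of_le (i : ℕ) (Finset.mem_range.2 i.2) le_rfl
  · rw [lintegral_count, tsum_fintype, Finset.sum_range]

lemma ellN_mono {t : ℝ≥0∞} {N : ℕ} {a b : ℕ → ℝ≥0∞} (h : ∀ k, a k ≤ b k) :
    ellN t N a ≤ ellN t N b := by
  rw [ellN_eq_LqNorm, ellN_eq_LqNorm]
  exact LqNorm_mono fun i => h i

lemma ellN_const_mul {t : ℝ≥0∞} (ht : t ≠ 0) {N : ℕ} {c : ℝ≥0∞} (hc : c ≠ ∞) (a : ℕ → ℝ≥0∞) :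
    ellN t N (fun k => c * a k) = c * ellN t N a := by
  rw [ellN_eq_LqNorm, ellN_eq_LqNorm]
  exact LqNorm_const_mul ht hc _

lemma ellN_holder {p q s : ℝ≥0∞} (hp : p ≠ 0) (hq : q ≠ 0) (hs0 : s ≠ 0) (hs : s ≠ ∞)
    (h : s⁻¹ = p⁻¹ + q⁻¹) (N : ℕ) (a b : ℕ → ℝ≥0∞) :
    ellN s N (fun k => a k * b k) ≤ ellN p N a * ellN q N b := by
  rw [ellN_eq_LqNorm, ellN_eq_LqNorm, ellN_eq_LqNorm]
  exact LqNorm_holder hp hq hs0 hs h (by fun_prop) (by fun_prop)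

lemma le_ellN {t : ℝ≥0∞} (ht : t ≠ 0) {N k : ℕ} (hk : k < N) (a : ℕ → ℝ≥0∞) :
    a k ≤ ellN t N a := by
  unfold ellN
  split_ifs with h
  · exact le_iSup₂_of_le k (Finset.mem_range.2 hk) le_rfl
  · have hp := toReal_pos_of ht h
    calc a k = (a k ^ t.toReal) ^ (1 / t.toReal) := by
          rw [← ENNReal.rpow_mul, mul_one_div_cancel hp.ne', ENNReal.rpow_one]
      _ ≤ _ := by
          refine ENNReal.rpow_le_rpow ?_ (by positivity)
          exact Finset.single_le_sum (f := fun k => a k ^ t.toReal) (fun _ _ => zero_le)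
            (Finset.mem_range.2 hk)

lemma measurable_ellN {X : Type*} [MeasurableSpace X] (t : ℝ≥0∞) (N : ℕ) {a : ℕ → X → ℝ≥0∞}
    (h : ∀ k, Measurable (a k)) : Measurable fun x => ellN t N (fun k => a k x) := by
  unfold ellN
  split_ifs
  · exact Measurable.biSup _ (Finset.range N).countable_toSet fun k _ => h k
  · fun_prop

/-- Minkowski's integral inequality for finite `ℓ^t` norms. -/
lemma ellN_lintegral_le {X : Type*} [MeasurableSpace X] {μ : Measure X} {t : ℝ≥0∞} (ht : 1 < t)
    (N : ℕ) {a : ℕ → X → ℝ≥0∞} (h : ∀ k, Measurable (a k)) :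
    ellN t N (fun k => ∫⁻ x, a k x ∂μ) ≤ ∫⁻ x, ellN t N (fun k => a k x) ∂μ := by
  have ht0 : t ≠ 0 := (zero_lt_one.trans ht).ne'
  by_cases htop : t = ∞
  · have : ∀ k < N, ∫⁻ x, a k x ∂μ ≤ ∫⁻ x, ellN t N (fun k => a k x) ∂μ := fun k hk =>
      lintegral_mono fun x => le_ellN ht0 hk (fun k => a k x)
    rw [ellN, if_pos htop]
    exact iSup₂_le fun k hk => this k (Finset.mem_range.1 hk)
  set r := t.toReal with hr
  have hr1 : 1 < r := by
    have := (ENNReal.toReal_lt_toReal (by simp) htop).2 ht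
    simpa using this
  have hr0 : 0 < r := by linarith
  set A : ℕ → ℝ≥0∞ := fun k => ∫⁻ x, a k x ∂μ
  set R := ∫⁻ x, ellN t N (fun k => a k x) ∂μ with hR
  have hle : ∀ k < N, A k ≤ R := fun k hk =>
    lintegral_mono fun x => le_ellN ht0 hk (fun k => a k x)
  by_cases hRtop : R = ∞
  · rw [hRtop]; exact le_top
  set S := ∑ k ∈ Finset.range N, A k ^ r with hS
  have hAtop : ∀ k < N, A k ≠ ∞ := fun k hk => ne_top_of_le_ne_top hRtop (hle k hk)
  have hStop : S ≠ ∞ := by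
    refine ENNReal.sum_ne_top.2 fun k hk => ENNReal.rpow_ne_top_of_nonneg hr0.le
      (hAtop k (Finset.mem_range.1 hk))
  have hgoal : ellN t N (fun k => A k) = S ^ (1 / r) := by
    rw [ellN, if_neg htop]
  rw [show ellN t N (fun k => ∫⁻ x, a k x ∂μ) = S ^ (1 / r) from hgoal]
  by_cases hS0 : S = 0
  · rw [hS0, ENNReal.zero_rpow_of_pos (by positivity)]; exact zero_le
  have hconj : (r / (r - 1)).HolderConjugate r :=
    (Real.HolderConjugate.conjExponent hr1).symm
  have key : S ≤ S ^ (1 - 1 / r) * R := by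
    calc S = ∑ k ∈ Finset.range N, A k ^ (r - 1) * ∫⁻ x, a k x ∂μ := by
          refine Finset.sum_congr rfl fun k hk => ?_
          have : A k ^ r = A k ^ ((r - 1) + 1) := by ring_nf
          rw [this, ENNReal.rpow_add_of_nonneg _ _ (by linarith) (by norm_num), ENNReal.rpow_one]
      _ = ∫⁻ x, ∑ k ∈ Finset.range N, A k ^ (r - 1) * a k x ∂μ := by
          rw [lintegral_finsetSum _ fun k _ => (h k).const_mul _]
          exact Finset.sum_congr rfl fun k _ => (lintegral_const_mul _ (h k)).symm
      _ ≤ ∫⁻ x, S ^ (1 - 1 / r) * ellN t N (fun k => a k x) ∂μ := by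
          refine lintegral_mono fun x => ?_
          refine (ENNReal.inner_le_Lp_mul_Lq _ _ _ hconj).trans ?_
          rw [ellN, if_neg htop]
          refine mul_le_mul_left (le_of_eq ?_) _
          have h1 : 1 / (r / (r - 1)) = 1 - 1 / r := by
            field_simp
          rw [h1, hS]
          congr 1
          refine Finset.sum_congr rfl fun k _ => ?_
          rw [← ENNReal.rpow_mul]
          congr 1
          have : r - 1 ≠ 0 := by linarith
          field_simp
      _ = S ^ (1 - 1 / r) * R := by
          rw [lintegral_const_mul _ (measurable_ellN _ _ h)]
  have hcpos : S ^ (1 - 1 / r) ≠ 0 := by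
    simp [ENNReal.rpow_eq_zero_iff, hS0, hStop]
  have hcfin : S ^ (1 - 1 / r) ≠ ∞ := by
    refine ENNReal.rpow_ne_top_of_nonneg ?_ hStop
    rw [sub_nonneg, div_le_one hr0]; exact hr1.le
  have h2 : S ^ (1 - 1 / r) * S ^ (1 / r) = S := by
    rw [← ENNReal.rpow_add _ _ hS0 hStop]; simp
  rw [← ENNReal.mul_le_mul_iff_right hcpos hcfin, h2]
  exact key

lemma LqNorm_ellN {X : Type*} [MeasurableSpace X] {μ : Measure X} {r : ℝ≥0∞} (hr0 : r ≠ 0)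
    (hr : r ≠ ∞) (N : ℕ) {F : ℕ → X → ℝ≥0∞} (hF : ∀ k, Measurable (F k)) :
    LqNorm μ r (fun x => ellN r N fun k => F k x) = ellN r N fun k => LqNorm μ r (F k) := by
  have hp := toReal_pos_of hr0 hr
  simp only [LqNorm, ellN, if_neg hr, ← ENNReal.rpow_mul, one_div_mul_cancel hp.ne',
    ENNReal.rpow_one]
  rw [lintegral_finsetSum _ fun k _ => (hF k).pow_const _]

lemma ellN_LqNorm_le {X : Type*} [MeasurableSpace X] {μ : Measure X} {r : ℝ≥0∞} (hr0 : r ≠ 0)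
    (N : ℕ) {F : ℕ → X → ℝ≥0∞} (hF : ∀ k, Measurable (F k)) :
    (ellN r N fun k => LqNorm μ r (F k)) ≤ LqNorm μ r (fun x => ellN r N fun k => F k x) := by
  by_cases hr : r = ∞
  · rw [ellN, if_pos hr]
    exact iSup₂_le fun k hk => LqNorm_mono fun x =>
      le_ellN hr0 (Finset.mem_range.1 hk) (fun k => F k x)
  · exact (LqNorm_ellN hr0 hr N hF).ge

lemma ellN_fin {r : ℝ≥0∞} (hr0 : r ≠ 0) (N : ℕ) :
    ∃ K : ℝ≥0, K ≠ 0 ∧ ∀ b : ℕ → ℝ≥0∞, ellN r N b ≤ K * ∑ k ∈ Finset.range N, b k := by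
  have h1 : ellN r N (fun _ => 1) ≠ ∞ := by
    unfold ellN
    split_ifs with h
    · refine ne_top_of_le_ne_top ENNReal.one_ne_top (iSup₂_le fun _ _ => le_rfl)
    · refine ENNReal.rpow_ne_top_of_nonneg (by positivity) ?_
      simp
  refine ⟨(ellN r N (fun _ => 1)).toNNReal + 1, by positivity, fun b => ?_⟩
  set σ := ∑ k ∈ Finset.range N, b k with hσ
  by_cases hst : σ = ∞
  · rw [hst, ENNReal.mul_top (by simp)]; exact le_top
  have : ellN r N b ≤ σ * ellN r N (fun _ => 1) := by
    rw [← ellN_const_mul hr0 hst]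
    rw [ellN_eq_LqNorm, ellN_eq_LqNorm]
    refine LqNorm_mono fun i => ?_
    rw [mul_one]
    exact Finset.single_le_sum (f := b) (fun _ _ => zero_le) (Finset.mem_range.2 i.2)
  refine this.trans ?_
  rw [mul_comm]
  gcongr
  rw [ENNReal.coe_add, ENNReal.coe_toNNReal h1]
  exact le_self_add

/-- A monotone homogeneous lattice norm depending on finitely many coordinates. -/
structure LatNorm {ι : Type} (N : (ι → ℝ≥0∞) → ℝ≥0∞) : Prop where
  mono : ∀ {a b : ι → ℝ≥0∞}, (∀ i, a i ≤ b i) → N a ≤ N b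
  smul : ∀ {c : ℝ≥0∞}, c ≠ ∞ → ∀ a : ι → ℝ≥0∞, N (fun i => c * a i) = c * N a
  meas : ∀ {a : ι → ℝ → ℝ≥0∞}, (∀ i, Measurable (a i)) → Measurable fun x => N fun i => a i x
  fin : ∃ S : Finset ι, ∃ K : ℝ≥0, ∀ a, N a ≤ K * ∑ i ∈ S, a i

/-- A lattice norm satisfying Minkowski's integral inequality. -/
structure MinkNorm {ι : Type} (N : (ι → ℝ≥0∞) → ℝ≥0∞) : Prop extends LatNorm N where
  mink : ∀ {a : ι → ℝ → ℝ≥0∞}, (∀ i, Measurable (a i)) →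
    N (fun i => ∫⁻ x, a i x) ≤ ∫⁻ x, N fun i => a i x

/-- A lattice quasinorm whose `t`-th power is subadditive. -/
structure QNorm {ι : Type} (t : ℝ) (N : (ι → ℝ≥0∞) → ℝ≥0∞) : Prop extends LatNorm N where
  subadd : ∀ a b : ι → ℝ≥0∞, N (fun i => a i + b i) ^ t ≤ N a ^ t + N b ^ t

/-- The mixed norm `ℓ^r(N)`. -/
noncomputable def ellComp {ι : Type} (r : ℝ≥0∞) (n : ℕ) (N : (ι → ℝ≥0∞) → ℝ≥0∞) :
    (ℕ × ι → ℝ≥0∞) → ℝ≥0∞ :=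
  fun a => ellN r n fun k => N fun i => a (k, i)

section
variable {ι : Type} {N N₁ N₂ : (ι → ℝ≥0∞) → ℝ≥0∞}

lemma LatNorm.zero (h : LatNorm N) : N (fun _ => 0) = 0 := by
  have := h.smul ENNReal.zero_ne_top (fun _ => 0)
  simpa using this

lemma LatNorm.ne_top (h : LatNorm N) {a : ι → ℝ≥0∞} (ha : ∀ i, a i ≠ ∞) : N a ≠ ∞ := by
  obtain ⟨S, K, hK⟩ := h.fin
  exact ne_top_of_le_ne_top
    (ENNReal.mul_ne_top ENNReal.coe_ne_top (ENNReal.sum_ne_top.2 fun i _ => ha i)) (hK a)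

lemma LatNorm.ell (h : LatNorm N) {r : ℝ≥0∞} (hr : r ≠ 0) (n : ℕ) :
    LatNorm (ellComp r n N) where
  mono hab := ellN_mono fun k => h.mono fun i => hab (k, i)
  smul {c} hc a := by
    unfold ellComp
    rw [← ellN_const_mul hr hc]
    simp_rw [h.smul hc]
  meas ha := measurable_ellN _ _ fun k => h.meas fun i => ha (k, i)
  fin := by
    obtain ⟨S, K, hK⟩ := h.fin
    obtain ⟨L, -, hL⟩ := ellN_fin hr n
    refine ⟨Finset.range n ×ˢ S, L * K, fun a => (hL _).trans ?_⟩
    rw [ENNReal.coe_mul, mul_assoc, Finset.sum_product]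
    refine mul_le_mul_right ?_ _
    rw [Finset.mul_sum]
    exact Finset.sum_le_sum fun k _ => hK _

lemma MinkNorm.ell (h : MinkNorm N) {r : ℝ≥0∞} (hr : 1 < r) (n : ℕ) :
    MinkNorm (ellComp r n N) where
  toLatNorm := h.toLatNorm.ell (zero_lt_one.trans hr).ne' n
  mink {a} ha := by
    refine (ellN_mono fun k => h.mink fun i => ha (k, i)).trans ?_
    exact ellN_lintegral_le hr n fun k => h.meas fun i => ha (k, i)

lemma QNorm.ell {t : ℝ} (ht : 0 < t) (h : QNorm t N) {r : ℝ≥0∞} (hr' : r ≠ ∞)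
    (hr : t ≤ r.toReal) (n : ℕ) : QNorm t (ellComp r n N) where
  toLatNorm := h.toLatNorm.ell (by rintro rfl; simp at hr; linarith) n
  subadd a b := by
    have hp : 0 < r.toReal := ht.trans_le hr
    have key : ∀ c : ℕ × ι → ℝ≥0∞, ellComp r n N c ^ t =
        (∑ k ∈ Finset.range n, ((N fun i => c (k, i)) ^ t) ^ (r.toReal / t)) ^
          (1 / (r.toReal / t)) := by
      intro c
      have e1 : ∀ z : ℝ≥0∞, (z ^ t) ^ (r.toReal / t) = z ^ r.toReal := fun z => by
        rw [← ENNReal.rpow_mul, mul_div_cancel₀ _ ht.ne']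
      have e2 : 1 / (r.toReal / t) = 1 / r.toReal * t := by field_simp
      simp_rw [e1, e2]
      unfold ellComp ellN
      rw [if_neg hr', ← ENNReal.rpow_mul]
    rw [key, key, key]
    refine le_trans ?_ (ENNReal.Lp_add_le (Finset.range n) (fun k => (N fun i => a (k, i)) ^ t)
      (fun k => (N fun i => b (k, i)) ^ t) ((one_le_div ht).2 hr))
    refine ENNReal.rpow_le_rpow (Finset.sum_le_sum fun k _ =>
      ENNReal.rpow_le_rpow (h.subadd _ _) (by positivity)) (by positivity)

lemma ellComp_holder {NY : (ι → ℝ≥0∞) → ℝ≥0∞} (h : ∀ a b, NY (fun i => a i * b i) ≤ N₁ a * N₂ b)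
    {p q s : ℝ≥0∞} (hp : p ≠ 0) (hq : q ≠ 0) (hs0 : s ≠ 0) (hs : s ≠ ∞) (hh : s⁻¹ = p⁻¹ + q⁻¹)
    (n : ℕ) (a b : ℕ × ι → ℝ≥0∞) :
    ellComp s n NY (fun i => a i * b i) ≤ ellComp p n N₁ a * ellComp q n N₂ b :=
  (ellN_mono fun _ => h _ _).trans (ellN_holder hp hq hs0 hs hh n _ _)

lemma QNorm.subadd' {t τ : ℝ} (h : QNorm t N) (hτ : 0 < τ) (hτt : τ ≤ t) (a b : ι → ℝ≥0∞) :
    N (fun i => a i + b i) ^ τ ≤ N a ^ τ + N b ^ τ := by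
  have ht : 0 < t := hτ.trans_le hτt
  have e : ∀ z : ℝ≥0∞, z ^ τ = (z ^ t) ^ (τ / t) := fun z => by
    rw [← ENNReal.rpow_mul]; congr 1; field_simp
  rw [e, e (N a), e (N b)]
  refine (ENNReal.rpow_le_rpow (h.subadd a b) (by positivity)).trans ?_
  exact ENNReal.rpow_add_le_add_rpow _ _ (by positivity) ((div_le_one ht).2 hτt)

lemma QNorm.sum_le {t τ : ℝ} (h : QNorm t N) (hτ : 0 < τ) (hτt : τ ≤ t) {κ : Type*}
    (S : Finset κ) (a : κ → ι → ℝ≥0∞) :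
    N (fun i => ∑ k ∈ S, a k i) ^ τ ≤ ∑ k ∈ S, N (a k) ^ τ := by
  classical
  induction S using Finset.induction_on with
  | empty => simp [h.toLatNorm.zero, hτ]
  | insert k S hk ih =>
    simp only [Finset.sum_insert hk]
    refine (h.subadd' hτ hτt _ _).trans ?_
    gcongr

end

lemma unit_MinkNorm : MinkNorm (fun a : Unit → ℝ≥0∞ => a ()) where
  mono h := h ()
  smul _ _ := rfl
  meas h := h ()
  fin := ⟨{()}, 1, fun a => by simp⟩
  mink _ := le_rfl

lemma unit_QNorm {t : ℝ} (ht : 0 < t) (ht1 : t ≤ 1) :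
    QNorm t (fun a : Unit → ℝ≥0∞ => a ()) where
  toLatNorm := unit_MinkNorm.toLatNorm
  subadd _ _ := ENNReal.rpow_add_le_add_rpow _ _ ht.le ht1

/-- The side length of the dyadic interval with index `j`. -/
noncomputable def sz (j : ℤ × ℤ) : ℝ := (2 : ℝ) ^ j.1

/-- The dyadic interval `[m 2^n, (m+1) 2^n)` with index `(n, m)`. -/
def dyI (j : ℤ × ℤ) : Set ℝ := Set.Ico (j.2 * sz j) ((j.2 + 1) * sz j)

/-- The index of the dyadic interval of generation `n` containing `x`. -/
noncomputable def dyAt (n : ℤ) (x : ℝ) : ℤ × ℤ := (n, ⌊x / (2 : ℝ) ^ n⌋)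

/-- The centre of a dyadic interval. -/
noncomputable def ctr (j : ℤ × ℤ) : ℝ := (j.2 + 1 / 2) * sz j

lemma sz_pos (j : ℤ × ℤ) : 0 < sz j := by unfold sz; positivity

lemma sz_ofReal_ne_zero (j : ℤ × ℤ) : ENNReal.ofReal (sz j) ≠ 0 := by
  simpa using sz_pos j

lemma mem_dyI {j : ℤ × ℤ} {x : ℝ} : x ∈ dyI j ↔ dyAt j.1 x = j := by
  have h := sz_pos j
  have e : dyAt j.1 x = j ↔ ⌊x / sz j⌋ = j.2 := by
    unfold dyAt sz
    constructor
    · intro h; exact congrArg Prod.snd h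
    · intro h; exact Prod.ext rfl h
  rw [e, Int.floor_eq_iff, le_div_iff₀ h, div_lt_iff₀ h]
  rfl

lemma mem_dyI_dyAt (n : ℤ) (x : ℝ) : x ∈ dyI (dyAt n x) := mem_dyI.2 rfl

lemma measurableSet_dyI (j : ℤ × ℤ) : MeasurableSet (dyI j) := measurableSet_Ico

lemma volume_dyI (j : ℤ × ℤ) : volume (dyI j) = ENNReal.ofReal (sz j) := by
  unfold dyI
  rw [Real.volume_Ico]
  congr 1; ring

lemma dyAt_mono {n m : ℤ} (hnm : n ≤ m) {x y : ℝ} (h : dyAt n x = dyAt n y) :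
    dyAt m x = dyAt m y := by
  obtain ⟨k, rfl⟩ := Int.le.dest hnm
  have hh : ⌊x / (2 : ℝ) ^ n⌋ = ⌊y / (2 : ℝ) ^ n⌋ := congrArg Prod.snd h
  have e : ∀ z : ℝ, ⌊z / (2 : ℝ) ^ (n + (k : ℤ))⌋ = ⌊z / (2 : ℝ) ^ n⌋ / ((2 ^ k : ℕ) : ℤ) := by
    intro z
    rw [← Int.floor_div_natCast]
    congr 1
    rw [zpow_add₀ (by norm_num), div_div]
    push_cast
    rfl
  unfold dyAt
  rw [e, e, hh]

lemma dyI_subset {j : ℤ × ℤ} {m : ℤ} (h : j.1 ≤ m) {x : ℝ} (hx : x ∈ dyI j) :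
    dyI j ⊆ dyI (dyAt m x) := by
  intro y hy
  rw [mem_dyI] at hx hy ⊢
  exact dyAt_mono h (hy.trans hx.symm)

lemma abs_sub_ctr_le {j : ℤ × ℤ} {x : ℝ} (hx : x ∈ dyI j) : |x - ctr j| ≤ sz j / 2 := by
  unfold dyI at hx; unfold ctr
  rw [abs_le]
  constructor <;> linarith [hx.1, hx.2]

/-- The maximal elements of a family of dyadic intervals. -/
def stopMax (S : Set (ℤ × ℤ)) : Set (ℤ × ℤ) :=
  {j | j ∈ S ∧ ∀ x ∈ dyI j, ∀ n, j.1 < n → dyAt n x ∉ S}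

lemma stopMax_subset (S : Set (ℤ × ℤ)) : stopMax S ⊆ S := fun _ h => h.1

lemma stopMax_unique {S : Set (ℤ × ℤ)} {j j' : ℤ × ℤ} (hj : j ∈ stopMax S) (hj' : j' ∈ stopMax S)
    {x : ℝ} (hx : x ∈ dyI j) (hx' : x ∈ dyI j') : j = j' := by
  have h1 := mem_dyI.1 hx
  have h2 := mem_dyI.1 hx'
  rcases lt_trichotomy j.1 j'.1 with h | h | h
  · exact absurd (h2 ▸ hj'.1) (hj.2 x hx _ h)
  · rw [← h1, ← h2, h]
  · exact absurd (h1 ▸ hj.1) (hj'.2 x hx' _ h)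

lemma exists_stopMax {S : Set (ℤ × ℤ)} (hS : ∀ x, BddAbove {n | dyAt n x ∈ S}) {x : ℝ} {n : ℤ}
    (hn : dyAt n x ∈ S) : ∃ j ∈ stopMax S, x ∈ dyI j ∧ n ≤ j.1 := by
  set A := {n | dyAt n x ∈ S}
  have hA : A.Nonempty := ⟨n, hn⟩
  have hm := Int.csSup_mem hA (hS x)
  refine ⟨dyAt (sSup A) x, ⟨hm, fun y hy m hm' => ?_⟩, mem_dyI_dyAt _ _, le_csSup (hS x) hn⟩
  have : dyAt m y = dyAt m x := dyAt_mono hm'.le (mem_dyI.1 hy)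
  rw [this]
  intro h
  exact absurd (le_csSup (hS x) h) (not_le.2 hm')

/-- The union of a family of dyadic intervals, through its maximal elements. -/
def stopSet (S : Set (ℤ × ℤ)) : Set ℝ := ⋃ j ∈ stopMax S, dyI j

lemma stopMax_disjoint (S : Set (ℤ × ℤ)) : (stopMax S).PairwiseDisjoint dyI := by
  intro j hj j' hj' hne
  rw [Function.onFun, Set.disjoint_left]
  exact fun x hx hx' => hne (stopMax_unique hj hj' hx hx')

lemma measurableSet_stopSet (S : Set (ℤ × ℤ)) : MeasurableSet (stopSet S) :=
  MeasurableSet.biUnion (Set.to_countable _) fun j _ => measurableSet_dyI j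

lemma lintegral_stopSet (S : Set (ℤ × ℤ)) (F : ℝ → ℝ≥0∞) :
    ∫⁻ x in stopSet S, F x = ∑' j : stopMax S, ∫⁻ x in dyI j, F x :=
  lintegral_biUnion (Set.to_countable _) (fun j _ => measurableSet_dyI j) (stopMax_disjoint S) F

lemma mem_stopSet {S : Set (ℤ × ℤ)} (hS : ∀ x, BddAbove {n | dyAt n x ∈ S}) {x : ℝ} :
    x ∈ stopSet S ↔ ∃ n, dyAt n x ∈ S := by
  constructor
  · intro h
    obtain ⟨j, hj, hx⟩ := Set.mem_iUnion₂.1 h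
    exact ⟨j.1, (mem_dyI.1 hx).symm ▸ hj.1⟩
  · rintro ⟨n, hn⟩
    obtain ⟨j, hj, hx, -⟩ := exists_stopMax hS hn
    exact Set.mem_iUnion₂.2 ⟨j, hj, hx⟩

/-- The average of `F` over a dyadic interval. -/
noncomputable def av (F : ℝ → ℝ≥0∞) (j : ℤ × ℤ) : ℝ≥0∞ :=
  (∫⁻ x in dyI j, F x) / ENNReal.ofReal (sz j)

lemma av_mul (F : ℝ → ℝ≥0∞) (j : ℤ × ℤ) : av F j * ENNReal.ofReal (sz j) = ∫⁻ x in dyI j, F x :=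
  ENNReal.div_mul_cancel (sz_ofReal_ne_zero j) ENNReal.ofReal_ne_top

lemma lt_av {F : ℝ → ℝ≥0∞} {j : ℤ × ℤ} {α : ℝ≥0∞} :
    α < av F j ↔ α * ENNReal.ofReal (sz j) < ∫⁻ x in dyI j, F x := by
  unfold av
  rw [ENNReal.lt_div_iff_mul_lt (Or.inl (sz_ofReal_ne_zero j)) (Or.inl ENNReal.ofReal_ne_top)]

/-- The dyadic maximal function. -/
noncomputable def Md (F : ℝ → ℝ≥0∞) (x : ℝ) : ℝ≥0∞ := ⨆ n : ℤ, av F (dyAt n x)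

lemma measurable_dyAt (n : ℤ) : Measurable (dyAt n) := by
  unfold dyAt
  fun_prop

lemma measurable_Md (F : ℝ → ℝ≥0∞) : Measurable (Md F) :=
  Measurable.iSup fun n => (measurable_of_countable (av F)).comp (measurable_dyAt n)

/-- Dyadic intervals over which the average of `F` exceeds `α`. -/
def big (F : ℝ → ℝ≥0∞) (α : ℝ≥0∞) : Set (ℤ × ℤ) := {j | α < av F j}

lemma exists_bound_big {F : ℝ → ℝ≥0∞} (hF : ∫⁻ x, F x ≠ ∞) {α : ℝ≥0∞} (hα : α ≠ 0) :
    ∃ n₀ : ℤ, ∀ j ∈ big F α, j.1 ≤ n₀ := by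
  have hle : ∀ j ∈ big F α, α * ENNReal.ofReal (sz j) ≤ ∫⁻ x, F x := fun j hj =>
    (lt_av.1 hj).le.trans (setLIntegral_le_lintegral _ _)
  by_cases hα' : α = ∞
  · refine ⟨0, fun j hj => ?_⟩
    have := hle j hj
    rw [hα', ENNReal.top_mul (sz_ofReal_ne_zero j)] at this
    exact absurd (top_le_iff.1 this) hF
  set R := (∫⁻ x, F x) / α with hR
  have hRt : R ≠ ∞ := ENNReal.div_ne_top hF hα
  obtain ⟨n₀, hn₀⟩ := pow_unbounded_of_one_lt R.toReal (_root_.one_lt_two (α := ℝ))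
  refine ⟨n₀, fun j hj => ?_⟩
  have h1 : ENNReal.ofReal (sz j) ≤ R := by
    rw [hR, ENNReal.le_div_iff_mul_le (Or.inl hα) (Or.inl hα'), mul_comm]
    exact hle j hj
  have h2 : sz j ≤ R.toReal := (ENNReal.ofReal_le_iff_le_toReal hRt).1 h1
  have h3 : (2 : ℝ) ^ j.1 < (2 : ℝ) ^ (n₀ : ℤ) := by
    rw [zpow_natCast]; exact h2.trans_lt hn₀
  exact ((zpow_lt_zpow_iff_right₀ (_root_.one_lt_two (α := ℝ))).1 h3).le

lemma bddAbove_big {F : ℝ → ℝ≥0∞} (hF : ∫⁻ x, F x ≠ ∞) {α : ℝ≥0∞} (hα : α ≠ 0) (x : ℝ) :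
    BddAbove {n | dyAt n x ∈ big F α} := by
  obtain ⟨n₀, h⟩ := exists_bound_big hF hα
  exact ⟨n₀, fun n hn => h _ hn⟩

lemma lt_Md_iff {F : ℝ → ℝ≥0∞} (hF : ∫⁻ x, F x ≠ ∞) {α : ℝ≥0∞} (hα : α ≠ 0) {x : ℝ} :
    α < Md F x ↔ x ∈ stopSet (big F α) := by
  rw [mem_stopSet (bddAbove_big hF hα)]
  unfold Md
  rw [lt_iSup_iff]
  rfl

lemma sum_sz_le (F : ℝ → ℝ≥0∞) (α : ℝ≥0∞) :
    α * ∑' j : stopMax (big F α), ENNReal.ofReal (sz j) ≤ ∫⁻ x in stopSet (big F α), F x := by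
  rw [lintegral_stopSet, ← ENNReal.tsum_mul_left]
  exact ENNReal.tsum_le_tsum fun j => (lt_av.1 (stopMax_subset _ j.2)).le

lemma volume_stopSet (S : Set (ℤ × ℤ)) :
    volume (stopSet S) = ∑' j : stopMax S, ENNReal.ofReal (sz j) := by
  have := lintegral_stopSet S (fun _ => 1)
  simpa [volume_dyI] using this

lemma weak_Md {F : ℝ → ℝ≥0∞} (hF : ∫⁻ x, F x ≠ ∞) {α : ℝ≥0∞} (hα : α ≠ 0) :
    α * volume {x | α < Md F x} ≤ ∫⁻ x, F x := by
  have : {x | α < Md F x} = stopSet (big F α) := Set.ext fun x => lt_Md_iff hF hα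
  rw [this, volume_stopSet]
  exact (sum_sz_le F α).trans (setLIntegral_le_lintegral _ _)

/-- The parent of a dyadic interval. -/
noncomputable def parent (j : ℤ × ℤ) : ℤ × ℤ := dyAt (j.1 + 1) (ctr j)

lemma ctr_mem (j : ℤ × ℤ) : ctr j ∈ dyI j := by
  have := sz_pos j
  unfold ctr dyI
  constructor <;> nlinarith

lemma dyI_subset_parent (j : ℤ × ℤ) : dyI j ⊆ dyI (parent j) :=
  dyI_subset (by linarith) (ctr_mem j)

lemma sz_parent (j : ℤ × ℤ) : sz (parent j) = 2 * sz j := by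
  unfold sz parent dyAt
  rw [zpow_add₀ (by norm_num)]; ring

lemma av_parent_le {F : ℝ → ℝ≥0∞} {α : ℝ≥0∞} {S : Set (ℤ × ℤ)} (hS : big F α ⊆ S) {j : ℤ × ℤ}
    (hj : j ∈ stopMax S) : av F (parent j) ≤ α := by
  have := hj.2 (ctr j) (ctr_mem j) (j.1 + 1) (by linarith)
  exact not_lt.1 fun h => this (hS h)

lemma av_stopMax_le {F : ℝ → ℝ≥0∞} {α : ℝ≥0∞} {S : Set (ℤ × ℤ)} (hS : big F α ⊆ S) {j : ℤ × ℤ}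
    (hj : j ∈ stopMax S) :
    ∫⁻ x in dyI j, F x ≤ 2 * α * ENNReal.ofReal (sz j) := by
  calc ∫⁻ x in dyI j, F x ≤ ∫⁻ x in dyI (parent j), F x :=
        lintegral_mono_set (dyI_subset_parent j)
    _ = av F (parent j) * ENNReal.ofReal (sz (parent j)) := (av_mul _ _).symm
    _ ≤ α * ENNReal.ofReal (2 * sz j) := by
        rw [sz_parent]; gcongr; exact av_parent_le hS hj
    _ = _ := by
        rw [ENNReal.ofReal_mul (by norm_num)]; simp; ring

/-- The threefold dilate of a dyadic interval. -/
def tri (j : ℤ × ℤ) : Set ℝ := Set.Ico ((j.2 - 1) * sz j) ((j.2 + 2) * sz j)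

lemma measurableSet_tri (j : ℤ × ℤ) : MeasurableSet (tri j) := measurableSet_Ico

/-- The normalized integral over the threefold dilate. -/
noncomputable def av3 (F : ℝ → ℝ≥0∞) (j : ℤ × ℤ) : ℝ≥0∞ :=
  (∫⁻ x in tri j, F x) / ENNReal.ofReal (sz j)

/-- The maximal function over threefold dilates of dyadic intervals. -/
noncomputable def M3 (F : ℝ → ℝ≥0∞) (x : ℝ) : ℝ≥0∞ :=
  ⨆ j : ℤ × ℤ, (tri j).indicator (fun _ => av3 F j) x

lemma measurable_M3 (F : ℝ → ℝ≥0∞) : Measurable (M3 F) :=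
  Measurable.iSup fun j => measurable_const.indicator (measurableSet_tri j)

lemma dyI_subset_tri (j : ℤ × ℤ) : dyI j ⊆ tri j := by
  have := sz_pos j
  refine Set.Ico_subset_Ico ?_ ?_ <;> nlinarith

lemma av3_mul (F : ℝ → ℝ≥0∞) (j : ℤ × ℤ) :
    av3 F j * ENNReal.ofReal (sz j) = ∫⁻ x in tri j, F x :=
  ENNReal.div_mul_cancel (sz_ofReal_ne_zero j) ENNReal.ofReal_ne_top

lemma av3_le_M3 (F : ℝ → ℝ≥0∞) {j : ℤ × ℤ} {x : ℝ} (hx : x ∈ tri j) : av3 F j ≤ M3 F x := by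
  refine le_iSup_of_le j ?_
  rw [Set.indicator_of_mem hx]

lemma setLIntegral_tri_le (F : ℝ → ℝ≥0∞) {j : ℤ × ℤ} {x : ℝ} (hx : x ∈ tri j) :
    ∫⁻ y in tri j, F y ≤ ENNReal.ofReal (sz j) * M3 F x := by
  rw [← av3_mul, mul_comm]
  gcongr
  exact av3_le_M3 F hx

lemma Md_le_M3 (F : ℝ → ℝ≥0∞) (x : ℝ) : Md F x ≤ M3 F x := by
  refine iSup_le fun n => le_trans ?_ (av3_le_M3 F (dyI_subset_tri _ (mem_dyI_dyAt n x)))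
  unfold av av3
  gcongr
  exact dyI_subset_tri _

lemma volume_tri (j : ℤ × ℤ) : volume (tri j) = 3 * ENNReal.ofReal (sz j) := by
  unfold tri
  rw [Real.volume_Ico, show ((j.2 + 2) * sz j - (j.2 - 1) * sz j : ℝ) = 3 * sz j by ring,
    ENNReal.ofReal_mul (by norm_num)]
  simp

lemma M3_le_of_ae_le {F : ℝ → ℝ≥0∞} {K : ℝ≥0∞} (h : ∀ᵐ x, F x ≤ K) (x : ℝ) : M3 F x ≤ 3 * K := by
  refine iSup_le fun j => Set.indicator_apply_le' (fun _ => ?_) fun _ => zero_le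
  refine ENNReal.div_le_of_le_mul ?_
  calc ∫⁻ x in tri j, F x ≤ ∫⁻ x in tri j, K := lintegral_mono_ae (ae_restrict_of_ae h)
    _ = _ := by rw [setLIntegral_const, volume_tri]; ring

lemma tri_subset (j : ℤ × ℤ) : tri j ⊆ dyI (j.1, j.2 - 1) ∪ (dyI j ∪ dyI (j.1, j.2 + 1)) := by
  have := sz_pos j
  intro x hx
  unfold tri at hx
  simp only [dyI, sz, Set.mem_union, Set.mem_Ico] at *
  push_cast
  rcases lt_or_ge x (j.2 * 2 ^ j.1) with h | h
  · left; constructor <;> linarith [hx.1]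
  · right
    rcases lt_or_ge x ((j.2 + 1) * 2 ^ j.1) with h' | h'
    · left; constructor <;> linarith [hx.1]
    · right; constructor <;> linarith [hx.2]

lemma lt_M3_subset {F : ℝ → ℝ≥0∞} {α : ℝ≥0∞} {S : Set (ℤ × ℤ)}
    (hS : ∀ x, BddAbove {n | dyAt n x ∈ S}) (hFS : big F α ⊆ S) :
    {x | 3 * α < M3 F x} ⊆
      ⋃ j ∈ stopMax S, Metric.ball (ctr j) (4 * sz j) := by
  intro x hx
  obtain ⟨i, hi⟩ := lt_iSup_iff.1 (show 3 * α < M3 F x from hx)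
  have hxi : x ∈ tri i := by
    by_contra h
    rw [Set.indicator_of_notMem h] at hi
    simp at hi
  rw [Set.indicator_of_mem hxi] at hi
  have hex : ∃ m : ℤ, (m = i.2 - 1 ∨ m = i.2 ∨ m = i.2 + 1) ∧ α < av F (i.1, m) := by
    by_contra! hcon
    have h1 := hcon (i.2 - 1) (by simp)
    have h2 := hcon i.2 (by simp)
    have h3 := hcon (i.2 + 1) (by simp)
    refine absurd hi (not_lt.2 ?_)
    refine ENNReal.div_le_of_le_mul ?_
    have key : ∀ m : ℤ, av F (i.1, m) ≤ α → ∫⁻ x in dyI (i.1, m), F x ≤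
        α * ENNReal.ofReal (sz i) := fun m hm => by
      rw [← av_mul]; exact mul_le_mul_left hm _
    calc ∫⁻ x in tri i, F x ≤
          ∫⁻ x in dyI (i.1, i.2 - 1) ∪ (dyI i ∪ dyI (i.1, i.2 + 1)), F x :=
          lintegral_mono_set (tri_subset i)
      _ ≤ _ := (lintegral_union_le _ _ _).trans (add_le_add le_rfl (lintegral_union_le _ _ _))
      _ ≤ α * ENNReal.ofReal (sz i) + (α * ENNReal.ofReal (sz i) + α * ENNReal.ofReal (sz i)) :=
          add_le_add (key _ h1) (add_le_add (key _ h2) (key _ h3))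
      _ = _ := by ring
  obtain ⟨m, hm, hav⟩ := hex
  have hmem : dyAt i.1 (ctr (i.1, m)) = (i.1, m) := mem_dyI.1 (ctr_mem (i.1, m))
  obtain ⟨j, hj, hcj, hle⟩ := exists_stopMax hS
    (x := ctr (i.1, m)) (n := i.1) (by rw [hmem]; exact hFS hav)
  refine Set.mem_iUnion₂.2 ⟨j, hj, ?_⟩
  rw [Metric.mem_ball, Real.dist_eq]
  have hsz : sz i ≤ sz j := zpow_le_zpow_right₀ one_le_two hle
  have h1 := abs_sub_ctr_le hcj
  have h2 : |x - ctr (i.1, m)| ≤ 5 / 2 * sz i := by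
    have := sz_pos i
    unfold tri at hxi
    have hc : ctr (i.1, m) = ((m : ℝ) + 1 / 2) * sz i := rfl
    have hm1 : (m : ℝ) = i.2 - 1 ∨ (m : ℝ) = i.2 ∨ (m : ℝ) = i.2 + 1 := by
      rcases hm with h | h | h
      · left; rw [h]; push_cast; rfl
      · right; left; rw [h]
      · right; right; rw [h]; push_cast; rfl
    rw [hc, abs_le]
    rcases hm1 with h | h | h <;> rw [h] <;> constructor <;> nlinarith [hxi.1, hxi.2]
  have h3 := abs_sub_le x (ctr (i.1, m)) (ctr j)
  have := sz_pos j
  linarith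

lemma weak_M3 {F : ℝ → ℝ≥0∞} (hF : ∫⁻ x, F x ≠ ∞) {α : ℝ≥0∞} (hα : α ≠ 0) :
    α * volume {x | 3 * α < M3 F x} ≤ 8 * ∫⁻ x, F x := by
  calc α * volume {x | 3 * α < M3 F x}
      ≤ α * ∑' j : stopMax (big F α), volume (Metric.ball (ctr j) (4 * sz j)) := by
        gcongr
        refine (measure_mono (lt_M3_subset (bddAbove_big hF hα) subset_rfl)).trans ?_
        exact measure_biUnion_le _ (Set.to_countable _) _
    _ = 8 * (α * ∑' j : stopMax (big F α), ENNReal.ofReal (sz j)) := by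
        have : ∀ j : stopMax (big F α), volume (Metric.ball (ctr j) (4 * sz j)) =
            8 * ENNReal.ofReal (sz j) := fun j => by
          rw [Real.volume_ball, ← mul_assoc, ENNReal.ofReal_mul (by norm_num)]
          norm_num
        simp_rw [this]
        rw [ENNReal.tsum_mul_left]; ring
    _ ≤ 8 * ∫⁻ x, F x := by
        gcongr
        exact (sum_sz_le F α).trans (setLIntegral_le_lintegral _ _)

lemma ae_le_Md {F : ℝ → ℝ≥0∞} (hFm : Measurable F) (hF : ∫⁻ x, F x ≠ ∞) :
    ∀ᵐ x, F x ≤ Md F x := by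
  filter_upwards [(IsUnifLocDoublingMeasure.vitaliFamily (volume : Measure ℝ)
    1).ae_tendsto_lintegral_div' hFm hF] with x hx
  have hlim : Tendsto (fun n : ℕ => sz (dyAt (-(n : ℤ)) x) / 2) atTop (𝓝[>] 0) := by
    refine tendsto_nhdsWithin_iff.2 ⟨?_, Eventually.of_forall fun n => ?_⟩
    · have : Tendsto (fun n : ℕ => ((1 / 2 : ℝ) ^ n) / 2) atTop (𝓝 (0 / 2)) :=
        (_root_.tendsto_pow_atTop_nhds_zero_of_lt_one (by norm_num) (by norm_num)).div_const 2
      simpa [sz, dyAt] using this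
    · have := sz_pos (dyAt (-(n : ℤ)) x)
      exact Set.mem_Ioi.2 (by positivity)
  have h1 := IsUnifLocDoublingMeasure.tendsto_closedBall_filterAt (volume : Measure ℝ) (K := 1)
    (x := x) (fun n : ℕ => ctr (dyAt (-(n : ℤ)) x)) _ hlim (Eventually.of_forall fun n => by
      rw [one_mul, Metric.mem_closedBall, Real.dist_eq]
      exact abs_sub_ctr_le (mem_dyI_dyAt _ _))
  refine le_of_tendsto (hx.comp h1) (Eventually.of_forall fun n => ?_)
  refine le_trans (le_of_eq ?_) (le_iSup (fun n => av F (dyAt n x)) (-(n : ℤ)))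
  set j := dyAt (-(n : ℤ)) x
  have e : Metric.closedBall (ctr j) (sz j / 2) = Set.Icc (j.2 * sz j) ((j.2 + 1) * sz j) := by
    rw [Real.closedBall_eq_Icc]
    unfold ctr
    congr 1 <;> ring
  simp only [Function.comp]
  rw [e, setLIntegral_congr (Ico_ae_eq_Icc (μ := volume)).symm, Real.volume_Icc]
  unfold av dyI
  congr 2
  ring

lemma lintegral_rpow_layer {X : Type*} [MeasurableSpace X] (μ : Measure X) {F : X → ℝ≥0∞}
    (hFm : Measurable F) (hF : ∀ x, F x ≠ ∞) {p : ℝ} (hp : 0 < p) :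
    ∫⁻ x, F x ^ p ∂μ = ENNReal.ofReal p *
      ∫⁻ t in Set.Ioi (0 : ℝ), μ {x | ENNReal.ofReal t < F x} * ENNReal.ofReal (t ^ (p - 1)) := by
  have := lintegral_rpow_eq_lintegral_meas_lt_mul μ (f := fun x => (F x).toReal)
    (Eventually.of_forall fun x => ENNReal.toReal_nonneg) hFm.ennreal_toReal.aemeasurable hp
  have e : ∀ x, ENNReal.ofReal ((F x).toReal ^ p) = F x ^ p := fun x => by
    rw [← ENNReal.ofReal_rpow_of_nonneg ENNReal.toReal_nonneg hp.le, ENNReal.ofReal_toReal (hF x)]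
  simp_rw [e] at this
  rw [this]
  congr 1
  refine setLIntegral_congr_fun measurableSet_Ioi fun t ht => ?_
  have : {x | t < (F x).toReal} = {x | ENNReal.ofReal t < F x} := by
    ext x
    simp only [Set.mem_ofPred_eq]
    rw [ENNReal.ofReal_lt_iff_lt_toReal (le_of_lt ht) (hF x)]
  simp only [this]

lemma lintegral_M3_rpow {p : ℝ} (hp : 1 < p) : ∃ C : ℝ≥0, ∀ F : ℝ → ℝ≥0∞, Measurable F →
    ∫⁻ x, F x ≠ ∞ → ∀ K : ℝ≥0, (∀ x, F x ≤ K) →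
      ∫⁻ x, M3 F x ^ p ≤ C * ∫⁻ x, F x ^ p := by
  have hp0 : 0 < p := by linarith
  have hp1 : 0 < p - 1 := by linarith
  refine ⟨Real.toNNReal (p * 48 / (p - 1) * 6 ^ (p - 1)), fun F hFm hF K hK => ?_⟩
  have hM : ∀ x, M3 F x ≠ ∞ := fun x =>
    ne_top_of_le_ne_top (by simp [ENNReal.mul_eq_top])
      (M3_le_of_ae_le (Eventually.of_forall hK) x)
  set μ : Measure ℝ := volume.withDensity F
  have hweak : ∀ t : ℝ, 0 < t → volume {x | ENNReal.ofReal t < M3 F x} ≤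
      48 * (ENNReal.ofReal t)⁻¹ * μ {x | ENNReal.ofReal t < 6 * F x} := by
    intro t ht
    set α := ENNReal.ofReal (t / 6) with hα
    have hα0 : α ≠ 0 := by simp [hα, ht]
    have hαt : α ≠ ∞ := ENNReal.ofReal_ne_top
    have h6 : 6 * α = ENNReal.ofReal t := by
      rw [hα, show (6 : ℝ≥0∞) = ENNReal.ofReal 6 by simp, ← ENNReal.ofReal_mul (by norm_num)]
      congr 1; ring
    set E := {x | ENNReal.ofReal t < 6 * F x} with hE
    have hEm : MeasurableSet E := measurableSet_lt measurable_const (hFm.const_mul _)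
    set G := E.indicator F with hG
    have hGF : ∀ x, F x ≤ G x + α := by
      intro x
      by_cases hx : x ∈ E
      · rw [hG, Set.indicator_of_mem hx]; exact le_self_add
      · rw [hG, Set.indicator_of_notMem hx, zero_add]
        have : 6 * F x ≤ 6 * α := by rw [h6]; exact not_lt.1 hx
        exact (ENNReal.mul_le_mul_iff_right (by norm_num) (by simp)).1 this
    have hGi : ∫⁻ x, G x = μ E := by
      rw [hG, lintegral_indicator hEm, withDensity_apply _ hEm]
    have hGt : ∫⁻ x, G x ≠ ∞ := ne_top_of_le_ne_top hF
      (lintegral_mono fun x => Set.indicator_le_self _ _ _)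
    have hsub : {x | ENNReal.ofReal t < M3 F x} ⊆ {x | 3 * α < M3 G x} := by
      intro x hx
      have h1 : M3 F x ≤ M3 G x + 3 * α := by
        refine iSup_le fun j => Set.indicator_apply_le' (fun hxj => ?_) fun _ => zero_le
        refine ENNReal.div_le_of_le_mul ?_
        calc ∫⁻ x in tri j, F x ≤ ∫⁻ x in tri j, (G x + α) := lintegral_mono fun x => hGF x
          _ = (∫⁻ x in tri j, G x) + α * (3 * ENNReal.ofReal (sz j)) := by
            rw [lintegral_add_right _ measurable_const, setLIntegral_const, volume_tri]
          _ ≤ ENNReal.ofReal (sz j) * M3 G x + α * (3 * ENNReal.ofReal (sz j)) := by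
            gcongr; exact setLIntegral_tri_le G hxj
          _ = _ := by ring
      have h2 : 3 * α + 3 * α < M3 G x + 3 * α := by
        calc 3 * α + 3 * α = ENNReal.ofReal t := by rw [← h6]; ring
          _ < _ := lt_of_lt_of_le hx h1
      exact lt_of_add_lt_add_right h2
    have h3 := weak_M3 hGt hα0
    rw [hGi] at h3
    have h4 : volume {x | 3 * α < M3 G x} ≤ 8 * μ E / α := by
      rw [ENNReal.le_div_iff_mul_le (Or.inl hα0) (Or.inl hαt), mul_comm]; exact h3
    refine (measure_mono hsub).trans (h4.trans (le_of_eq ?_))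
    have : α⁻¹ = 6 * (ENNReal.ofReal t)⁻¹ := by
      rw [← h6, ENNReal.mul_inv (by simp) (by simp), ← mul_assoc,
        ENNReal.mul_inv_cancel (by simp) (by simp), one_mul]
    rw [ENNReal.div_eq_inv_mul, this]; ring
  rw [lintegral_rpow_layer volume (measurable_M3 F) hM hp0]
  have hlay := lintegral_rpow_layer μ (hFm.const_mul 6) (fun x =>
    ENNReal.mul_ne_top (by simp) (ne_top_of_le_ne_top ENNReal.coe_ne_top (hK x))) hp1
  have hL : ∫⁻ x, (6 * F x) ^ (p - 1) ∂μ = ENNReal.ofReal (6 ^ (p - 1)) * ∫⁻ x, F x ^ p := by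
    rw [lintegral_withDensity_eq_lintegral_mul _ hFm (by fun_prop),
      ← lintegral_const_mul _ (by fun_prop)]
    refine lintegral_congr fun x => ?_
    simp only [Pi.mul_apply]
    rw [ENNReal.mul_rpow_of_nonneg _ _ hp1.le, ← ENNReal.ofReal_rpow_of_nonneg (by norm_num) hp1.le]
    have : F x ^ p = F x * F x ^ (p - 1) := by
      nth_rewrite 2 [← ENNReal.rpow_one (F x)]
      rw [← ENNReal.rpow_add_of_nonneg _ _ (by norm_num) hp1.le]
      congr 1; ring
    rw [this]
    simp
    ring
  rw [hL] at hlay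
  calc ENNReal.ofReal p * ∫⁻ t in Set.Ioi (0 : ℝ), volume {x | ENNReal.ofReal t < M3 F x} *
        ENNReal.ofReal (t ^ (p - 1))
      ≤ ENNReal.ofReal p * ∫⁻ t in Set.Ioi (0 : ℝ), 48 *
          (μ {x | ENNReal.ofReal t < 6 * F x} * ENNReal.ofReal (t ^ (p - 1 - 1))) := by
        refine mul_le_mul_right (setLIntegral_mono' measurableSet_Ioi fun t ht => ?_) _
        have ht' : (0 : ℝ) < t := ht
        have : ENNReal.ofReal (t ^ (p - 1)) = ENNReal.ofReal t * ENNReal.ofReal (t ^ (p - 1 - 1)) := by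
          rw [← ENNReal.ofReal_mul ht'.le]
          congr 1
          rw [Real.rpow_sub_one ht'.ne' (p - 1)]
          field_simp
        rw [this]
        refine (mul_le_mul_left (hweak t ht') _).trans (le_of_eq ?_)
        have hc : (ENNReal.ofReal t)⁻¹ * ENNReal.ofReal t = 1 :=
          ENNReal.inv_mul_cancel (by simp [ht']) ENNReal.ofReal_ne_top
        calc _ = 48 * ((ENNReal.ofReal t)⁻¹ * ENNReal.ofReal t) * (μ {x | ENNReal.ofReal t < 6 * F x}
            * ENNReal.ofReal (t ^ (p - 1 - 1))) := by ring
          _ = _ := by rw [hc, mul_one]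
    _ = ENNReal.ofReal (p * 48 / (p - 1)) * (ENNReal.ofReal (p - 1) *
          ∫⁻ t in Set.Ioi (0 : ℝ), (μ {x | ENNReal.ofReal t < 6 * F x} *
            ENNReal.ofReal (t ^ (p - 1 - 1)))) := by
        rw [lintegral_const_mul' _ _ (by simp), ← mul_assoc, ← mul_assoc,
          ← ENNReal.ofReal_mul (by positivity), div_mul_cancel₀ _ hp1.ne',
          ENNReal.ofReal_mul hp0.le]
        simp
    _ = _ := by
        rw [← hlay, ← mul_assoc, ← ENNReal.ofReal_mul (by positivity)]
        rfl

/-- Fefferman–Stein type inequality: a function which on every dyadic interval is within `D` of a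
constant, with `D` controlled on average by `H`, is controlled in `L^σ` by `H`. -/
lemma lintegral_rpow_le_of_oscillation {σ : ℝ} (hσ : 1 < σ) : ∃ C : ℝ≥0, ∀ V H : ℝ → ℝ≥0∞,
    Measurable V → Measurable H → ∫⁻ x, V x ≠ ∞ → (∀ x, H x ≠ ∞) →
    ∀ K : ℝ≥0, (∀ x, V x ≤ K) →
    (∀ j : ℤ × ℤ, ∃ (c : ℝ≥0∞) (D : ℝ → ℝ≥0∞), Measurable D ∧
      (∀ x ∈ dyI j, V x ≤ D x + c ∧ c ≤ D x + V x) ∧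
      ∀ x₀ ∈ dyI j, ∫⁻ x in dyI j, D x ≤ ENNReal.ofReal (sz j) * H x₀) →
    ∫⁻ x, V x ^ σ ≤ C * ∫⁻ x, H x ^ σ := by
  have hσ0 : 0 < σ := by linarith
  obtain ⟨CM, hCM⟩ := lintegral_M3_rpow hσ
  set γ : ℝ := 2 ^ (-σ - 3) with hγ
  have hγ0 : 0 < γ := by positivity
  have hγ1 : γ ≤ 1 / 2 := by
    calc γ ≤ (2 : ℝ) ^ (-1 : ℝ) := Real.rpow_le_rpow_of_exponent_le one_le_two (by linarith)
      _ = 1 / 2 := by norm_num [Real.rpow_neg_one]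
  refine ⟨2 * Real.toNNReal ((2 / γ) ^ σ), fun V H hVm hHm hV hHt K hK hosc => ?_⟩
  have hMt : ∀ x, Md V x ≠ ∞ := fun x =>
    ne_top_of_le_ne_top (by simp [ENNReal.mul_eq_top])
      ((Md_le_M3 V x).trans (M3_le_of_ae_le (Eventually.of_forall hK) x))
  have good : ∀ l : ℝ, 0 < l → volume {x | ENNReal.ofReal (2 * l) < Md V x} ≤
      ENNReal.ofReal (4 * γ) * volume {x | ENNReal.ofReal l < Md V x} +
        volume {x | ENNReal.ofReal (γ * l) < H x} := by
    intro l hl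
    set α := ENNReal.ofReal l with hα
    have hα0 : α ≠ 0 := by simp [hα, hl]
    have h2α : ENNReal.ofReal (2 * l) = 2 * α := by rw [ENNReal.ofReal_mul (by norm_num)]; simp [hα]
    have hγα : ENNReal.ofReal (γ * l) = ENNReal.ofReal γ * α := ENNReal.ofReal_mul hγ0.le
    set E := {x | ENNReal.ofReal (2 * l) < Md V x} with hE
    set B := {x | ENNReal.ofReal (γ * l) < H x} with hB
    have hloc : ∀ j ∈ stopMax (big V α), volume ((dyI j ∩ E) \ B) ≤
        ENNReal.ofReal (4 * γ) * ENNReal.ofReal (sz j) := by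
      intro j hj
      rcases Set.eq_empty_or_nonempty ((dyI j ∩ E) \ B) with h | ⟨x₀, ⟨hx₀j, -⟩, hx₀B⟩
      · rw [h]; simp
      have hHx₀ : H x₀ ≤ ENNReal.ofReal γ * α := by rw [← hγα]; exact not_lt.1 hx₀B
      obtain ⟨c, D, hDm, hDV, hDH⟩ := hosc (parent j)
      have hDi : ∫⁻ x in dyI (parent j), D x ≤ ENNReal.ofReal (sz (parent j)) *
          (ENNReal.ofReal γ * α) :=
        (hDH x₀ (dyI_subset_parent j hx₀j)).trans (mul_le_mul_right hHx₀ _)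
      have hsp := sz_ofReal_ne_zero (parent j)
      have hc : c ≤ ENNReal.ofReal γ * α + α := by
        have h1 : ENNReal.ofReal (sz (parent j)) * c ≤
            ENNReal.ofReal (sz (parent j)) * (ENNReal.ofReal γ * α + α) := by
          calc ENNReal.ofReal (sz (parent j)) * c = ∫⁻ x in dyI (parent j), c := by
                rw [setLIntegral_const, volume_dyI, mul_comm]
            _ ≤ ∫⁻ x in dyI (parent j), (D x + V x) :=
                setLIntegral_mono' (measurableSet_dyI _) fun x hx => (hDV x hx).2
            _ = (∫⁻ x in dyI (parent j), D x) + ∫⁻ x in dyI (parent j), V x :=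
                lintegral_add_left hDm _
            _ ≤ ENNReal.ofReal (sz (parent j)) * (ENNReal.ofReal γ * α) +
                  α * ENNReal.ofReal (sz (parent j)) := by
                refine add_le_add hDi ?_
                rw [← av_mul]
                exact mul_le_mul_left (av_parent_le subset_rfl hj) _
            _ = _ := by ring
        exact (ENNReal.mul_le_mul_iff_right hsp ENNReal.ofReal_ne_top).1 h1
      set D' := (dyI j).indicator D with hD'
      have hD'i : ∫⁻ x, D' x ≤ ENNReal.ofReal (2 * sz j) * (ENNReal.ofReal γ * α) := by
        rw [hD', lintegral_indicator (measurableSet_dyI j), ← sz_parent]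
        exact (lintegral_mono_set (dyI_subset_parent j)).trans hDi
      have hsub : (dyI j ∩ E) \ B ⊆ {x | ENNReal.ofReal (l / 2) < Md D' x} := by
        rintro x ⟨⟨hxj, hxE⟩, -⟩
        obtain ⟨n, hn⟩ := lt_iSup_iff.1 (show ENNReal.ofReal (2 * l) < Md V x from hxE)
        rw [h2α] at hn
        have hnj : n ≤ j.1 := by
          by_contra h
          refine hj.2 x hxj n (not_le.1 h) (lt_of_le_of_lt ?_ hn)
          rw [two_mul]; exact le_self_add
        have hRj : dyI (dyAt n x) ⊆ dyI j := by
          have := dyI_subset (j := dyAt n x) (m := j.1) hnj (mem_dyI_dyAt n x)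
          rwa [mem_dyI.1 hxj] at this
        refine lt_of_lt_of_le ?_ (le_iSup (fun n => av D' (dyAt n x)) n)
        by_contra hcon
        have hcon' := not_lt.1 hcon
        refine absurd hn (not_lt.2 ?_)
        refine ENNReal.div_le_of_le_mul ?_
        calc ∫⁻ y in dyI (dyAt n x), V y ≤ ∫⁻ y in dyI (dyAt n x), (D' y + c) := by
              refine setLIntegral_mono' (measurableSet_dyI _) fun y hy => ?_
              rw [hD', Set.indicator_of_mem (hRj hy)]
              exact (hDV y (dyI_subset_parent j (hRj hy))).1
          _ = av D' (dyAt n x) * ENNReal.ofReal (sz (dyAt n x)) +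
                c * ENNReal.ofReal (sz (dyAt n x)) := by
              rw [lintegral_add_right _ measurable_const, setLIntegral_const, volume_dyI, av_mul]
          _ ≤ ENNReal.ofReal (l / 2) * ENNReal.ofReal (sz (dyAt n x)) +
                (ENNReal.ofReal γ * α + α) * ENNReal.ofReal (sz (dyAt n x)) := by gcongr
          _ = (ENNReal.ofReal (l / 2) + (ENNReal.ofReal γ * α + α)) *
                ENNReal.ofReal (sz (dyAt n x)) := by ring
          _ ≤ 2 * α * ENNReal.ofReal (sz (dyAt n x)) := by
              refine mul_le_mul_left ?_ _
              rw [← h2α, ← hγα, hα, ← ENNReal.ofReal_add (by positivity) hl.le,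
                ← ENNReal.ofReal_add (by positivity) (by positivity)]
              apply ENNReal.ofReal_le_ofReal
              nlinarith
      refine (measure_mono hsub).trans ?_
      have hD't : ∫⁻ x, D' x ≠ ∞ := ne_top_of_le_ne_top
        (ENNReal.mul_ne_top ENNReal.ofReal_ne_top
          (ENNReal.mul_ne_top ENNReal.ofReal_ne_top ENNReal.ofReal_ne_top)) hD'i
      have hl2 : ENNReal.ofReal (l / 2) ≠ 0 := by simp [hl]
      have hw := (weak_Md hD't hl2).trans hD'i
      have e : ENNReal.ofReal (2 * sz j) * (ENNReal.ofReal γ * α) =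
          ENNReal.ofReal (l / 2) * (ENNReal.ofReal (4 * γ) * ENNReal.ofReal (sz j)) := by
        have := sz_pos j
        rw [hα, ← ENNReal.ofReal_mul hγ0.le, ← ENNReal.ofReal_mul (by positivity),
          ← ENNReal.ofReal_mul (by positivity), ← ENNReal.ofReal_mul (by positivity)]
        congr 1; ring
      rw [e] at hw
      exact (ENNReal.mul_le_mul_iff_right hl2 ENNReal.ofReal_ne_top).1 hw
    have hcov : E ⊆ (⋃ j ∈ stopMax (big V α), (dyI j ∩ E) \ B) ∪ B := by
      intro x hx
      by_cases hxB : x ∈ B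
      · exact Or.inr hxB
      · left
        have hx' : α < Md V x := lt_of_le_of_lt
          (by rw [h2α, two_mul]; exact le_self_add) (show ENNReal.ofReal (2 * l) < Md V x from hx)
        obtain ⟨j, hj, hxj⟩ := Set.mem_iUnion₂.1 ((lt_Md_iff hV hα0).1 hx')
        exact Set.mem_iUnion₂.2 ⟨j, hj, ⟨hxj, hx⟩, hxB⟩
    have hset : {x | ENNReal.ofReal l < Md V x} = stopSet (big V α) :=
      Set.ext fun x => lt_Md_iff hV hα0
    refine (measure_mono hcov).trans ((measure_union_le _ _).trans ?_)
    gcongr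
    refine (measure_biUnion_le _ (Set.to_countable _) _).trans ?_
    rw [hset, volume_stopSet, ← ENNReal.tsum_mul_left]
    exact ENNReal.tsum_le_tsum fun j => hloc j j.2
  set I := ∫⁻ x, Md V x ^ σ with hI
  have hIt : I ≠ ∞ := by
    have h1 : I ≤ CM * ∫⁻ x, V x ^ σ :=
      (lintegral_mono fun x => ENNReal.rpow_le_rpow (Md_le_M3 V x) hσ0.le).trans
        (hCM V hVm hV K hK)
    have h2 : ∫⁻ x, V x ^ σ ≤ (K : ℝ≥0∞) ^ (σ - 1) * ∫⁻ x, V x := by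
      rw [← lintegral_const_mul _ hVm]
      refine lintegral_mono fun x => ?_
      calc V x ^ σ = V x ^ (σ - 1) * V x := by
            nth_rewrite 3 [← ENNReal.rpow_one (V x)]
            rw [← ENNReal.rpow_add_of_nonneg _ _ (by linarith) (by norm_num)]
            congr 1; ring
        _ ≤ _ := by gcongr; exact hK x
    refine ne_top_of_le_ne_top (ENNReal.mul_ne_top ENNReal.coe_ne_top
      (ne_top_of_le_ne_top (ENNReal.mul_ne_top ?_ hV) h2)) h1
    exact ENNReal.rpow_ne_top_of_nonneg (by linarith) ENNReal.coe_ne_top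
  have main : I ≤ ENNReal.ofReal (2 ^ σ) * (ENNReal.ofReal (4 * γ) * I +
      ENNReal.ofReal ((1 / γ) ^ σ) * ∫⁻ x, H x ^ σ) := by
    have hlI := lintegral_rpow_layer volume (measurable_Md V) hMt hσ0
    have scale : ∀ (F : ℝ → ℝ≥0∞) (a : ℝ), Measurable F → (∀ x, F x ≠ ∞) → 0 < a →
        ENNReal.ofReal (a ^ σ) * ∫⁻ x, F x ^ σ = ENNReal.ofReal σ * ∫⁻ t in Set.Ioi (0 : ℝ),
          volume {x | ENNReal.ofReal (t / a) < F x} * ENNReal.ofReal (t ^ (σ - 1)) := by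
      intro F a hFm hFt ha
      have := lintegral_rpow_layer volume (hFm.const_mul (ENNReal.ofReal a))
        (fun x => ENNReal.mul_ne_top ENNReal.ofReal_ne_top (hFt x)) hσ0
      simp_rw [ENNReal.mul_rpow_of_nonneg _ _ hσ0.le] at this
      rw [lintegral_const_mul _ (by fun_prop), ENNReal.ofReal_rpow_of_nonneg ha.le hσ0.le] at this
      rw [this]
      congr 1
      refine setLIntegral_congr_fun measurableSet_Ioi fun t ht => ?_
      have : {x | ENNReal.ofReal t < ENNReal.ofReal a * F x} =
          {x | ENNReal.ofReal (t / a) < F x} := by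
        ext x
        simp only [Set.mem_ofPred_eq]
        rw [ENNReal.ofReal_div_of_pos ha, ENNReal.div_lt_iff (Or.inl (by simp [ha]))
          (Or.inl ENNReal.ofReal_ne_top), mul_comm]
      simp only [this]
    have h1 := scale (Md V) (1 / 2) (measurable_Md V) hMt (by norm_num)
    have h2 := scale H (1 / γ) hHm hHt (by positivity)
    have h3 : ENNReal.ofReal ((1 / 2) ^ σ) * I ≤ ENNReal.ofReal (4 * γ) * I +
        ENNReal.ofReal ((1 / γ) ^ σ) * ∫⁻ x, H x ^ σ := by
      rw [h1, h2, hI, hlI, ← mul_assoc, mul_comm (ENNReal.ofReal (4 * γ)), mul_assoc, ← mul_add]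
      refine mul_le_mul_right ?_ _
      rw [← lintegral_const_mul' _ _ ENNReal.ofReal_ne_top, ← lintegral_add_left' ]
      · refine setLIntegral_mono' measurableSet_Ioi fun t ht => ?_
        have := good t ht
        rw [← mul_assoc, ← add_mul, show t / (1 / 2) = 2 * t by ring,
          show t / (1 / γ) = γ * t by field_simp]
        exact mul_le_mul_left this _
      · have : Measurable fun t : ℝ => volume {x | ENNReal.ofReal t < Md V x} := by
          refine Antitone.measurable fun s t hst => measure_mono fun x hx => ?_
          exact lt_of_le_of_lt (ENNReal.ofReal_le_ofReal hst) hx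
        exact (by fun_prop : Measurable _).aemeasurable
    have e : ENNReal.ofReal (2 ^ σ) * ENNReal.ofReal ((1 / 2) ^ σ) = 1 := by
      rw [← ENNReal.ofReal_mul (by positivity), ← Real.mul_rpow (by norm_num) (by norm_num)]
      norm_num
    calc I = ENNReal.ofReal (2 ^ σ) * (ENNReal.ofReal ((1 / 2) ^ σ) * I) := by
          rw [← mul_assoc, e, one_mul]
      _ ≤ _ := by gcongr
  have hhalf : ENNReal.ofReal (2 ^ σ) * ENNReal.ofReal (4 * γ) = 1 / 2 := by
    rw [← ENNReal.ofReal_mul (by positivity)]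
    have : (2 : ℝ) ^ σ * (4 * γ) = 1 / 2 := by
      rw [hγ, show (4 : ℝ) = 2 ^ (2 : ℝ) by norm_num, ← Real.rpow_add (by norm_num),
        ← Real.rpow_add (by norm_num), show σ + (2 + (-σ - 3)) = (-1 : ℝ) by ring,
        Real.rpow_neg_one]
      norm_num
    rw [this, ENNReal.ofReal_div_of_pos (by norm_num)]; simp
  rw [mul_add, ← mul_assoc, hhalf, ← mul_assoc, ← ENNReal.ofReal_mul (by positivity),
    ← Real.mul_rpow (by norm_num) (by positivity), mul_one_div] at main
  have hVI : ∫⁻ x, V x ^ σ ≤ I := lintegral_mono_ae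
    ((ae_le_Md hVm hV).mono fun x hx => ENNReal.rpow_le_rpow hx hσ0.le)
  refine hVI.trans ?_
  set J := ENNReal.ofReal ((2 / γ) ^ σ) * ∫⁻ x, H x ^ σ with hJ
  have hIhalf : I = 1 / 2 * I + 1 / 2 * I := by
    rw [← add_mul, ENNReal.add_halves, one_mul]
  have h4 : 1 / 2 * I ≤ J := by
    have hne : 1 / 2 * I ≠ ∞ := ENNReal.mul_ne_top (by simp) hIt
    nth_rewrite 1 [hIhalf] at main
    exact (ENNReal.add_le_add_iff_left hne).1 main
  calc I = 2 * (1 / 2 * I) := by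
        rw [← mul_assoc, one_div, ENNReal.mul_inv_cancel (by simp) (by simp), one_mul]
    _ ≤ 2 * J := by gcongr
    _ = _ := by
      rw [hJ, ENNReal.coe_mul, mul_assoc]; rfl

lemma lintegral_comp_mul_left {a : ℝ} (ha : 0 < a) {F : ℝ → ℝ≥0∞} (hF : Measurable F) :
    ∫⁻ x, F (a * x) = ENNReal.ofReal a⁻¹ * ∫⁻ x, F x := by
  rw [← lintegral_map hF (measurable_const_mul a), Real.map_volume_mul_left ha.ne',
    lintegral_smul_measure, abs_of_pos (by positivity), smul_eq_mul]

/-- The `L¹`-normalized polynomially decaying weight. -/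
noncomputable def wt (N : ℕ) (a x : ℝ) : ℝ≥0∞ := ENNReal.ofReal (a / (1 + a * |x|) ^ N)

@[fun_prop]
lemma measurable_wt (N : ℕ) (a : ℝ) : Measurable (wt N a) := by
  unfold wt; fun_prop

lemma wt_abs (N : ℕ) (a x : ℝ) : wt N a (-x) = wt N a x := by
  unfold wt; rw [abs_neg]

lemma wt_ne_top (N : ℕ) (a x : ℝ) : wt N a x ≠ ∞ := ENNReal.ofReal_ne_top

lemma wt_le {N : ℕ} {a : ℝ} (ha : 0 < a) (x : ℝ) : wt N a x ≤ ENNReal.ofReal a :=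
  ENNReal.ofReal_le_ofReal (div_le_self ha.le (one_le_pow₀ (by
    have : 0 ≤ a * |x| := by positivity
    linarith)))

lemma wt_anti {N M : ℕ} (h : N ≤ M) {a : ℝ} (ha : 0 < a) (x : ℝ) : wt M a x ≤ wt N a x := by
  have : 1 ≤ 1 + a * |x| := by
    have : 0 ≤ a * |x| := by positivity
    linarith
  refine ENNReal.ofReal_le_ofReal ?_
  gcongr

lemma one_add_mul_abs_le {a : ℝ} (ha : 0 < a) (x u y : ℝ) :
    1 + a * |x - y| ≤ (1 + a * |x - u|) * (1 + a * |u - y|) := by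
  have h := abs_sub_le x u y
  have h1 : 0 ≤ a * |x - u| := by positivity
  have h2 : 0 ≤ a * |u - y| := by positivity
  nlinarith [mul_le_mul_of_nonneg_left h ha.le, mul_nonneg h1 h2]

lemma wt_shift {N : ℕ} {a : ℝ} (ha : 0 < a) (x u y : ℝ) :
    wt N a (u - y) ≤ ENNReal.ofReal ((1 + a * |x - u|) ^ N) * wt N a (x - y) := by
  unfold wt
  rw [← ENNReal.ofReal_mul (by positivity)]
  refine ENNReal.ofReal_le_ofReal ?_
  have h := one_add_mul_abs_le ha x u y
  rw [mul_div_assoc', div_le_div_iff₀ (by positivity) (by positivity)]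
  calc a * (1 + a * |x - y|) ^ N ≤ a * ((1 + a * |x - u|) * (1 + a * |u - y|)) ^ N := by gcongr
    _ = _ := by rw [mul_pow]; ring

/-- Convolution with a decaying weight. -/
noncomputable def Pk (a : ℝ) (F : ℝ → ℝ≥0∞) (x : ℝ) : ℝ≥0∞ := ∫⁻ y, F y * wt 4 a (x - y)

@[fun_prop]
lemma measurable_Pk (a : ℝ) {F : ℝ → ℝ≥0∞} (hF : Measurable F) : Measurable (Pk a F) := by
  unfold Pk
  refine Measurable.lintegral_prod_right' (f := fun z : ℝ × ℝ => F z.2 * wt 4 a (z.1 - z.2)) ?_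
  fun_prop

lemma Pk_shift {a : ℝ} (ha : 0 < a) (F : ℝ → ℝ≥0∞) (x u : ℝ) :
    Pk a F u ≤ ENNReal.ofReal ((1 + a * |x - u|) ^ 4) * Pk a F x := by
  unfold Pk
  rw [← lintegral_const_mul' _ _ ENNReal.ofReal_ne_top]
  refine lintegral_mono fun y => ?_
  calc F y * wt 4 a (u - y) ≤ F y * (ENNReal.ofReal ((1 + a * |x - u|) ^ 4) * wt 4 a (x - y)) := by
        gcongr; exact wt_shift ha x u y
    _ = _ := by ring

lemma Pk_le_of_near {a : ℝ} (ha : 0 < a) (F : ℝ → ℝ≥0∞) {x u : ℝ} (h : a * |x - u| ≤ 1) :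
    Pk a F u ≤ 16 * Pk a F x := by
  refine (Pk_shift ha F x u).trans ?_
  gcongr
  calc ENNReal.ofReal ((1 + a * |x - u|) ^ 4) ≤ ENNReal.ofReal 16 := by
        refine ENNReal.ofReal_le_ofReal ?_
        calc (1 + a * |x - u|) ^ 4 ≤ (1 + 1) ^ 4 := by gcongr
          _ = 16 := by norm_num
    _ = 16 := by simp

/-- The integral of the weight of order `r` and unit scale. -/
noncomputable def wInt (r : ℝ) : ℝ≥0∞ := ∫⁻ x : ℝ, ENNReal.ofReal ((1 + |x|) ^ (-r))

lemma wInt_ne_top {r : ℝ} (hr : 1 < r) : wInt r ≠ ∞ := by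
  have := finite_integral_one_add_norm (E := ℝ) (μ := volume) (r := r) (by simpa using hr)
  exact this.ne

lemma lintegral_wInt {r a : ℝ} (ha : 0 < a) (x : ℝ) :
    ∫⁻ u, ENNReal.ofReal ((1 + a * |x - u|) ^ (-r)) = ENNReal.ofReal a⁻¹ * wInt r := by
  rw [lintegral_sub_left_eq_self (fun u => ENNReal.ofReal ((1 + a * |u|) ^ (-r))) x]
  have := lintegral_comp_mul_left ha (F := fun x => ENNReal.ofReal ((1 + |x|) ^ (-r)))
    (by fun_prop)
  simp_rw [abs_mul, abs_of_pos ha] at this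
  exact this

lemma lintegral_wt {N : ℕ} {a : ℝ} (ha : 0 < a) (x : ℝ) :
    ∫⁻ u, wt N a (x - u) = wInt N := by
  have e : ∀ u, wt N a (x - u) =
      ENNReal.ofReal a * ENNReal.ofReal ((1 + a * |x - u|) ^ (-(N : ℝ))) := fun u => by
    unfold wt
    rw [← ENNReal.ofReal_mul ha.le, Real.rpow_neg (by positivity), Real.rpow_natCast,
      div_eq_mul_inv]
  simp_rw [e]
  rw [lintegral_const_mul' _ _ ENNReal.ofReal_ne_top, lintegral_wInt ha, ← mul_assoc,
    ← ENNReal.ofReal_mul ha.le, mul_inv_cancel₀ ha.ne']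
  simp

lemma lintegral_wt_mul_Pk_le {a : ℝ} (ha : 0 < a) (F G : ℝ → ℝ≥0∞) (x : ℝ) :
    ∫⁻ u, Pk a F u * Pk a G u * wt 10 a (x - u) ≤ wInt 2 * (Pk a F x * Pk a G x) := by
  calc ∫⁻ u, Pk a F u * Pk a G u * wt 10 a (x - u)
      ≤ ∫⁻ u, wt 2 a (x - u) * (Pk a F x * Pk a G x) := by
        refine lintegral_mono fun u => ?_
        have e : wt 2 a (x - u) = wt 10 a (x - u) * (ENNReal.ofReal ((1 + a * |x - u|) ^ 4) *
            ENNReal.ofReal ((1 + a * |x - u|) ^ 4)) := by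
          unfold wt
          rw [← ENNReal.ofReal_mul (by positivity), ← ENNReal.ofReal_mul (by positivity)]
          congr 1
          have : 0 < 1 + a * |x - u| := by positivity
          field_simp
        rw [e]
        calc _ ≤ (ENNReal.ofReal ((1 + a * |x - u|) ^ 4) * Pk a F x) *
              (ENNReal.ofReal ((1 + a * |x - u|) ^ 4) * Pk a G x) * wt 10 a (x - u) := by
              gcongr <;> exact Pk_shift ha _ x u
          _ = _ := by ring
    _ = _ := by
        rw [lintegral_mul_const _ (by fun_prop), lintegral_wt ha]
        norm_num

lemma Pk_le_M3_self {k : ℤ} {F : ℝ → ℝ≥0∞} (hF : Measurable F) (x : ℝ) :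
    Pk ((2 : ℝ) ^ k) F x ≤ 32 * M3 F x := by
  set a : ℝ := (2 : ℝ) ^ k with ha
  have ha0 : 0 < a := by positivity
  set J : ℕ → ℤ × ℤ := fun m => dyAt (m - k) x with hJ
  have hsz : ∀ m, sz (J m) = 2 ^ m / a := fun m => by
    simp only [hJ, sz, dyAt]
    rw [zpow_sub₀ (by norm_num), zpow_natCast]
  have hpt : ∀ y, wt 4 a (x - y) ≤
      ∑' m : ℕ, ENNReal.ofReal (16 * a / 16 ^ m) * (tri (J m)).indicator 1 y := by
    intro y
    obtain ⟨m₀, hm₀⟩ := pow_unbounded_of_one_lt (a * |x - y|) (_root_.one_lt_two (α := ℝ))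
    have hex : ∃ m : ℕ, a * |x - y| < 2 ^ m := ⟨m₀, hm₀⟩
    classical
    set m := Nat.find hex with hm
    have hlt : a * |x - y| < 2 ^ m := Nat.find_spec hex
    refine le_trans ?_ (ENNReal.le_tsum m)
    have hmem : y ∈ tri (J m) := by
      have hd : |x - y| < (2 : ℝ) ^ ((m : ℤ) - k) := by
        rw [zpow_sub₀ (by norm_num), zpow_natCast, ← ha, lt_div_iff₀ ha0, mul_comm]
        exact hlt
      have hx := mem_dyI_dyAt ((m : ℤ) - k) x
      have hs : sz (J m) = 2 ^ ((m : ℤ) - k) := rfl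
      unfold dyI at hx
      rw [abs_lt] at hd
      rw [← hs] at hd
      exact ⟨by nlinarith [hx.1], by nlinarith [hx.2]⟩
    rw [Set.indicator_of_mem hmem, Pi.one_apply, mul_one]
    refine ENNReal.ofReal_le_ofReal ?_
    rw [div_le_div_iff₀ (by positivity) (by positivity)]
    have key : (2 : ℝ) ^ m ≤ 2 * (1 + a * |x - y|) := by
      have h0 : 0 ≤ a * |x - y| := by positivity
      rcases Nat.eq_zero_or_pos m with h | h
      · rw [h]; norm_num; linarith
      · have := Nat.find_min hex (m := m - 1) (by omega)
        have h2 : (2 : ℝ) ^ m = 2 * 2 ^ (m - 1) := by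
          rw [← pow_succ']; congr 1; omega
        rw [h2]
        have := not_lt.1 this
        linarith
    calc a * 16 ^ m = a * ((2 : ℝ) ^ m) ^ 4 := by
          rw [← pow_mul, mul_comm m 4, pow_mul]; norm_num
      _ ≤ a * (2 * (1 + a * |x - y|)) ^ 4 := by gcongr
      _ = _ := by ring
  calc Pk a F x ≤ ∫⁻ y, ∑' m : ℕ, ENNReal.ofReal (16 * a / 16 ^ m) *
        (tri (J m)).indicator F y := by
        refine lintegral_mono fun y => ?_
        refine (mul_le_mul_right (hpt y) _).trans (le_of_eq ?_)
        rw [← ENNReal.tsum_mul_left]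
        refine tsum_congr fun m => ?_
        by_cases hy : y ∈ tri (J m)
        · simp only [Set.indicator_of_mem hy, Pi.one_apply]; ring
        · simp only [Set.indicator_of_notMem hy]; ring
    _ = ∑' m : ℕ, ENNReal.ofReal (16 * a / 16 ^ m) * ∫⁻ y in tri (J m), F y := by
        rw [lintegral_tsum fun m =>
          ((hF.indicator (measurableSet_tri _)).const_mul _).aemeasurable]
        refine tsum_congr fun m => ?_
        rw [lintegral_const_mul' _ _ ENNReal.ofReal_ne_top,
          lintegral_indicator (measurableSet_tri _)]
    _ ≤ ∑' m : ℕ, 16 * (2⁻¹ : ℝ≥0∞) ^ m * M3 F x := by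
        refine ENNReal.tsum_le_tsum fun m => ?_
        have hx : x ∈ tri (J m) := dyI_subset_tri _ (mem_dyI_dyAt _ _)
        refine (mul_le_mul_right (setLIntegral_tri_le F hx) _).trans ?_
        rw [← mul_assoc]
        refine mul_le_mul_left ?_ _
        rw [hsz, ← ENNReal.ofReal_mul (by positivity)]
        have : 16 * (2⁻¹ : ℝ≥0∞) ^ m = ENNReal.ofReal (16 * (2⁻¹) ^ m) := by
          rw [ENNReal.ofReal_mul (by norm_num), ENNReal.ofReal_pow (by norm_num),
            ENNReal.ofReal_inv_of_pos (by norm_num)]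
          simp
        rw [this]
        refine ENNReal.ofReal_le_ofReal ?_
        have h1 : 16 * a / 16 ^ m * (2 ^ m / a) = 16 * (8⁻¹) ^ m := by
          rw [show (16 : ℝ) ^ m = 8 ^ m * 2 ^ m by rw [← mul_pow]; norm_num, inv_pow]
          field_simp
        rw [h1]
        gcongr
        norm_num
    _ = 32 * M3 F x := by
        rw [ENNReal.tsum_mul_right, ENNReal.tsum_mul_left, ENNReal.tsum_geometric]
        congr 1
        rw [ENNReal.one_sub_inv_two, inv_inv]
        norm_num

lemma Pk_le_M3 {k : ℤ} {F : ℝ → ℝ≥0∞} (hF : Measurable F) {x x₀ : ℝ}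
    (h : (2 : ℝ) ^ k * |x₀ - x| ≤ 1) : Pk ((2 : ℝ) ^ k) F x ≤ 512 * M3 F x₀ := by
  refine (Pk_le_of_near (by positivity) F h).trans ?_
  refine (mul_le_mul_right (Pk_le_M3_self hF x₀) _).trans (le_of_eq ?_)
  rw [← mul_assoc]; norm_num

/-- `min (v, 1/v)`. -/
noncomputable def mn (v : ℝ) : ℝ := min v v⁻¹

lemma mn_pos {v : ℝ} (hv : 0 < v) : 0 < mn v := lt_min hv (by positivity)

lemma tsum_mn {θ : ℝ} (hθ : 0 < θ) : ∃ C : ℝ≥0, ∀ (Λ : Finset ℤ) (v : ℝ), 0 < v →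
    ∑ k ∈ Λ, ENNReal.ofReal (mn ((2 : ℝ) ^ k * v) ^ θ) ≤ C := by
  set r : ℝ := (2⁻¹ : ℝ) ^ θ with hr
  have hr0 : 0 < r := by positivity
  have hr1 : r < 1 := Real.rpow_lt_one (by norm_num) (by norm_num) hθ
  have hs : Summable fun n : ℤ => r ^ n.natAbs := by
    refine Summable.of_nat_of_neg ?_ ?_ <;> simpa using summable_geometric_of_lt_one hr0.le hr1
  have hs' : Summable fun n : ℤ => 2 ^ θ * r ^ n.natAbs := hs.mul_left _
  refine ⟨(∑' n : ℤ, 2 ^ θ * r ^ n.natAbs).toNNReal, fun Λ v hv => ?_⟩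
  obtain ⟨m, hm1, hm2⟩ := exists_mem_Ico_zpow hv (_root_.one_lt_two (α := ℝ))
  have hterm : ∀ k : ℤ, mn ((2 : ℝ) ^ k * v) ^ θ ≤ 2 ^ θ * r ^ (k + m).natAbs := by
    intro k
    have h1 : mn ((2 : ℝ) ^ k * v) ≤ 2 * 2⁻¹ ^ (k + m).natAbs := by
      rcases le_or_gt 0 (k + m) with h | h
      · refine (min_le_right _ _).trans ?_
        have e : (2⁻¹ : ℝ) ^ (k + m).natAbs = ((2 : ℝ) ^ (k + m))⁻¹ := by
          rw [inv_pow, ← zpow_natCast, Int.natAbs_of_nonneg h]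
        rw [e, zpow_add₀ (by norm_num)]
        have : ((2 : ℝ) ^ k * v)⁻¹ ≤ ((2 : ℝ) ^ k * 2 ^ m)⁻¹ := by gcongr
        have h0 : 0 < ((2 : ℝ) ^ k * 2 ^ m)⁻¹ := by positivity
        linarith
      · refine (min_le_left _ _).trans ?_
        have e : (2⁻¹ : ℝ) ^ (k + m).natAbs = (2 : ℝ) ^ (k + m) := by
          rw [inv_pow, ← zpow_natCast, ← zpow_neg, Int.ofNat_natAbs_of_nonpos h.le, neg_neg]
        rw [e, zpow_add₀ (by norm_num)]
        have : (2 : ℝ) ^ k * v ≤ 2 ^ k * 2 ^ (m + 1) := by gcongr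
        rw [zpow_add₀ (by norm_num), zpow_one] at this
        linarith
    have h0 : 0 ≤ mn ((2 : ℝ) ^ k * v) := (mn_pos (by positivity)).le
    calc mn ((2 : ℝ) ^ k * v) ^ θ ≤ (2 * 2⁻¹ ^ (k + m).natAbs) ^ θ :=
          Real.rpow_le_rpow h0 h1 hθ.le
      _ = 2 ^ θ * r ^ (k + m).natAbs := by
          rw [Real.mul_rpow (by norm_num) (by positivity), hr, ← Real.rpow_natCast,
            ← Real.rpow_natCast, ← Real.rpow_mul (by norm_num), ← Real.rpow_mul (by norm_num),
            mul_comm θ]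
  rw [← ENNReal.ofReal_sum_of_nonneg fun k _ => Real.rpow_nonneg (mn_pos (by positivity)).le _]
  refine ENNReal.ofReal_le_ofReal ?_
  calc ∑ k ∈ Λ, mn ((2 : ℝ) ^ k * v) ^ θ ≤ ∑ k ∈ Λ, 2 ^ θ * r ^ (k + m).natAbs :=
        Finset.sum_le_sum fun k _ => hterm k
    _ ≤ ∑' k : ℤ, 2 ^ θ * r ^ (k + m).natAbs := by
        refine Summable.sum_le_tsum Λ (fun _ _ => by positivity) ?_
        exact (Equiv.addRight m).summable_iff.2 hs'
    _ = _ := (Equiv.addRight m).tsum_eq (fun n : ℤ => 2 ^ θ * r ^ n.natAbs)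

/-- A continuous kernel with polynomial decay and a matching Lipschitz bound. -/
structure Bump (C : ℝ≥0) (u : ℝ → ℂ) : Prop where
  cont : Continuous u
  bd : ∀ x, ‖u x‖ₑ ≤ C * wt 10 1 x
  lip : ∀ a b : ℝ, |a - b| ≤ 1 → ‖u a - u b‖ₑ ≤ C * ENNReal.ofReal |a - b| * wt 10 1 a

/-- Measurable functions with polynomial decay. -/
structure Nice (f : ℝ → ℂ) : Prop where
  meas : Measurable f
  bd : ∃ C : ℝ≥0, ∀ x, ‖f x‖ₑ ≤ C * wt 8 1 x

lemma enorm_two_zpow (k : ℤ) : ‖(2 : ℂ) ^ k‖ₑ = ENNReal.ofReal ((2 : ℝ) ^ k) := by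
  rw [← ofReal_norm, norm_zpow]; simp

lemma ofReal_mul_wt_one (N : ℕ) {a : ℝ} (ha : 0 < a) (x : ℝ) :
    ENNReal.ofReal a * wt N 1 (a * x) = wt N a x := by
  unfold wt
  rw [← ENNReal.ofReal_mul ha.le, abs_mul, abs_of_pos ha, one_mul, mul_one_div]

section
variable {C : ℝ≥0} {u : ℝ → ℂ}

lemma Bump.continuous_dil (hu : Bump C u) (k : ℤ) : Continuous (dil u k) := by
  unfold dil
  exact continuous_const.mul (hu.cont.comp (continuous_const.mul continuous_id))

lemma Bump.enorm_dil_le (hu : Bump C u) (k : ℤ) (x : ℝ) :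
    ‖dil u k x‖ₑ ≤ C * wt 10 ((2 : ℝ) ^ k) x := by
  unfold dil
  rw [enorm_mul, enorm_two_zpow, ← ofReal_mul_wt_one 10 (by positivity)]
  calc _ ≤ ENNReal.ofReal ((2 : ℝ) ^ k) * (C * wt 10 1 ((2 : ℝ) ^ k * x)) := by
        gcongr; exact hu.bd _
    _ = _ := by ring

lemma Bump.enorm_dil_sub_le (hu : Bump C u) (k : ℤ) {a b : ℝ} (h : (2 : ℝ) ^ k * |a - b| ≤ 1) :
    ‖dil u k a - dil u k b‖ₑ ≤
      C * ENNReal.ofReal ((2 : ℝ) ^ k * |a - b|) * wt 10 ((2 : ℝ) ^ k) a := by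
  unfold dil
  have e : |(2 : ℝ) ^ k * a - (2 : ℝ) ^ k * b| = (2 : ℝ) ^ k * |a - b| := by
    rw [← mul_sub, abs_mul, abs_of_pos (by positivity)]
  rw [← mul_sub, enorm_mul, enorm_two_zpow, ← ofReal_mul_wt_one 10 (by positivity)]
  calc _ ≤ ENNReal.ofReal ((2 : ℝ) ^ k) * (C * ENNReal.ofReal ((2 : ℝ) ^ k * |a - b|) *
          wt 10 1 ((2 : ℝ) ^ k * a)) := by
        gcongr
        rw [← e]
        exact hu.lip _ _ (e.trans_le h)
    _ = _ := by ring

lemma Bump.enorm_dil_le_const (hu : Bump C u) (k : ℤ) (x : ℝ) :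
    ‖dil u k x‖ₑ ≤ C * ENNReal.ofReal ((2 : ℝ) ^ k) :=
  (hu.enorm_dil_le k x).trans (by gcongr; exact wt_le (by positivity) x)

lemma Bump.norm_dil_le_const (hu : Bump C u) (k : ℤ) (x : ℝ) :
    ‖dil u k x‖ ≤ C * (2 : ℝ) ^ k := by
  have := hu.enorm_dil_le_const k x
  rw [← ofReal_norm, ← ENNReal.ofReal_coe_nnreal, ← ENNReal.ofReal_mul (by positivity)] at this
  exact (ENNReal.ofReal_le_ofReal_iff (by positivity)).1 this

lemma Bump.integrable_dil (hu : Bump C u) (k : ℤ) : Integrable (dil u k) := by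
  refine ⟨(hu.continuous_dil k).aestronglyMeasurable, ?_⟩
  refine lt_of_le_of_lt (lintegral_mono fun x => hu.enorm_dil_le k x) ?_
  rw [lintegral_const_mul' _ _ ENNReal.coe_ne_top]
  have := lintegral_wt (N := 10) (a := (2 : ℝ) ^ k) (by positivity) 0
  simp only [zero_sub, wt_abs] at this
  rw [this]
  exact ENNReal.mul_lt_top ENNReal.coe_lt_top (wInt_ne_top (by norm_num)).lt_top

lemma conv_le_Pk {F : ℝ → ℝ≥0∞} {k : ℤ} {x : ℝ} :
    ∫⁻ t, F t * wt 10 ((2 : ℝ) ^ k) (x - t) ≤ Pk ((2 : ℝ) ^ k) F x :=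
  lintegral_mono fun _ => mul_le_mul_right (wt_anti (by norm_num) (by positivity) _) _

lemma Bump.enorm_conv_le (hu : Bump C u) (f : ℝ → ℂ) (k : ℤ) (x : ℝ) :
    ‖conv f (dil u k) x‖ₑ ≤ C * Pk ((2 : ℝ) ^ k) (fun y => ‖f y‖ₑ) x := by
  unfold conv
  refine (enorm_integral_le_lintegral_enorm _).trans ?_
  refine le_trans ?_ (mul_le_mul_right conv_le_Pk _)
  rw [← lintegral_const_mul' _ _ ENNReal.coe_ne_top]
  refine lintegral_mono fun t => ?_
  rw [enorm_mul]
  calc _ ≤ ‖f t‖ₑ * (C * wt 10 ((2 : ℝ) ^ k) (x - t)) := by gcongr; exact hu.enorm_dil_le _ _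
    _ = _ := by ring

end

section
variable {f g : ℝ → ℂ}

lemma Nice.integrable (hf : Nice f) : Integrable f := by
  obtain ⟨C, hC⟩ := hf.bd
  refine ⟨hf.meas.aestronglyMeasurable, lt_of_le_of_lt (lintegral_mono hC) ?_⟩
  rw [lintegral_const_mul' _ _ ENNReal.coe_ne_top]
  have := lintegral_wt (N := 8) (a := 1) one_pos 0
  simp only [zero_sub, wt_abs] at this
  rw [this]
  exact ENNReal.mul_lt_top ENNReal.coe_lt_top (wInt_ne_top (by norm_num)).lt_top

lemma Nice.bdd (hf : Nice f) : ∃ C : ℝ≥0, ∀ x, ‖f x‖ₑ ≤ C := by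
  obtain ⟨C, hC⟩ := hf.bd
  refine ⟨C, fun x => (hC x).trans ?_⟩
  calc (C : ℝ≥0∞) * wt 8 1 x ≤ C * 1 := by
        gcongr; simpa using wt_le (N := 8) one_pos x
    _ = C := mul_one _

lemma Nice.of_le (hg : Measurable g) {C : ℝ≥0} (hf : Nice f) (h : ∀ x, ‖g x‖ₑ ≤ C * ‖f x‖ₑ) :
    Nice g := by
  obtain ⟨D, hD⟩ := hf.bd
  refine ⟨hg, C * D, fun x => (h x).trans ?_⟩
  rw [ENNReal.coe_mul, mul_assoc]
  gcongr; exact hD x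

lemma Nice.indicator (hf : Nice f) {s : Set ℝ} (hs : MeasurableSet s) : Nice (s.indicator f) :=
  Nice.of_le (hf.meas.indicator hs) (C := 1) hf fun x => by
    simpa using enorm_indicator_le_enorm_self f x

lemma Nice.add (hf : Nice f) (hg : Nice g) : Nice (fun x => f x + g x) := by
  obtain ⟨C, hC⟩ := hf.bd
  obtain ⟨D, hD⟩ := hg.bd
  refine ⟨hf.meas.add hg.meas, C + D, fun x => (enorm_add_le _ _).trans ?_⟩
  rw [ENNReal.coe_add, add_mul]
  exact add_le_add (hC x) (hD x)

lemma Nice.sub (hf : Nice f) (hg : Nice g) : Nice (fun x => f x - g x) := by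
  have : Nice fun x => - g x := Nice.of_le hg.meas.neg (C := 1) hg fun x => by simp
  simpa [sub_eq_add_neg] using hf.add this

lemma integrable_mul_shift {C : ℝ≥0} {u : ℝ → ℂ} (hf : Integrable f) (hu : Bump C u) (k : ℤ)
    (x : ℝ) : Integrable fun t => f t * dil u k (x - t) := by
  refine hf.mul_bdd (c := C * (2 : ℝ) ^ k) ?_ (Eventually.of_forall fun t =>
    hu.norm_dil_le_const _ _)
  exact ((hu.continuous_dil k).comp (continuous_const.sub continuous_id)).aestronglyMeasurable

lemma integrable_mul_shift' {C : ℝ≥0} {u : ℝ → ℂ} (hf : Measurable f) {D : ℝ≥0}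
    (hD : ∀ x, ‖f x‖ₑ ≤ D) (hu : Bump C u) (k : ℤ)
    (x : ℝ) : Integrable fun t => f t * dil u k (x - t) := by
  refine Integrable.bdd_mul (c := D) ((hu.integrable_dil k).comp_sub_left x)
    hf.aestronglyMeasurable (Eventually.of_forall fun t => ?_)
  have := hD t
  rw [← ofReal_norm, ← ENNReal.ofReal_coe_nnreal] at this
  exact (ENNReal.ofReal_le_ofReal_iff (by positivity)).1 this

lemma measurable_conv {C : ℝ≥0} {u : ℝ → ℂ} (hf : Measurable f) (hu : Bump C u) (k : ℤ) :
    Measurable (conv f (dil u k)) := by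
  unfold conv
  have : Measurable fun z : ℝ × ℝ => f z.2 * dil u k (z.1 - z.2) := by
    have := (hu.continuous_dil k).measurable
    fun_prop
  exact (this.stronglyMeasurable.integral_prod_right').measurable

lemma Nice.conv_bdd {C : ℝ≥0} {u : ℝ → ℂ} (hf : Nice f) (hu : Bump C u) (k : ℤ) :
    ∃ D : ℝ≥0, ∀ x, ‖conv f (dil u k) x‖ₑ ≤ D := by
  obtain ⟨D, hD⟩ := hf.bdd
  have hw : wInt 4 ≠ ∞ := wInt_ne_top (by norm_num)
  refine ⟨C * (D * (wInt 4).toNNReal), fun x => (hu.enorm_conv_le f k x).trans ?_⟩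
  rw [ENNReal.coe_mul, ENNReal.coe_mul, ENNReal.coe_toNNReal hw]
  gcongr
  calc Pk ((2 : ℝ) ^ k) (fun y => ‖f y‖ₑ) x ≤ ∫⁻ y, D * wt 4 ((2 : ℝ) ^ k) (x - y) :=
        lintegral_mono fun y => mul_le_mul_left (hD y) _
    _ = _ := by
        rw [lintegral_const_mul' _ _ ENNReal.coe_ne_top, lintegral_wt (by positivity)]
        norm_num

lemma conv_sub {C : ℝ≥0} {u : ℝ → ℂ} (hf : Nice f) (hg : Nice g) (hu : Bump C u) (k : ℤ) (x : ℝ) :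
    conv (fun y => f y - g y) (dil u k) x = conv f (dil u k) x - conv g (dil u k) x := by
  unfold conv
  rw [← integral_sub (integrable_mul_shift hf.integrable hu k x)
    (integrable_mul_shift hg.integrable hu k x)]
  simp_rw [sub_mul]

end

/-- A single scale of the paraproduct. -/
noncomputable def Tk (u v w : ℝ → ℂ) (k : ℤ) (f g : ℝ → ℂ) (x : ℝ) : ℂ :=
  conv (fun y => conv f (dil u k) y * conv g (dil v k) y) (dil w k) x

/-- The paraproduct with general kernels. -/
noncomputable def T (u v w : ℝ → ℂ) (Λ : Finset ℤ) (f g : ℝ → ℂ) (x : ℝ) : ℂ :=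
  ∑ k ∈ Λ, Tk u v w k f g x

lemma Tk_swap (u v w : ℝ → ℂ) (k : ℤ) (f g : ℝ → ℂ) : Tk u v w k f g = Tk v u w k g f := by
  unfold Tk; simp_rw [mul_comm]

lemma T_swap (u v w : ℝ → ℂ) (Λ : Finset ℤ) (f g : ℝ → ℂ) : T u v w Λ f g = T v u w Λ g f := by
  unfold T; simp_rw [Tk_swap u v w]

section
variable {C : ℝ≥0} {u v w : ℝ → ℂ} {f f' g g' : ℝ → ℂ}

lemma measurable_mul_conv (hu : Bump C u) (hv : Bump C v) (k : ℤ) (hf : Nice f) (hg : Nice g) :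
    Measurable fun y => conv f (dil u k) y * conv g (dil v k) y :=
  (measurable_conv hf.meas hu k).mul (measurable_conv hg.meas hv k)

lemma mul_conv_bdd (hu : Bump C u) (hv : Bump C v) (k : ℤ) (hf : Nice f) (hg : Nice g) :
    ∃ D : ℝ≥0, ∀ y, ‖conv f (dil u k) y * conv g (dil v k) y‖ₑ ≤ D := by
  obtain ⟨D, hD⟩ := hf.conv_bdd hu k
  obtain ⟨E, hE⟩ := hg.conv_bdd hv k
  refine ⟨D * E, fun y => ?_⟩
  rw [enorm_mul, ENNReal.coe_mul]
  exact mul_le_mul' (hD y) (hE y)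

lemma Tk_integrable (hu : Bump C u) (hv : Bump C v) (hw : Bump C w) (k : ℤ) (hf : Nice f)
    (hg : Nice g) (x : ℝ) :
    Integrable fun t => conv f (dil u k) t * conv g (dil v k) t * dil w k (x - t) := by
  obtain ⟨D, hD⟩ := mul_conv_bdd hu hv k hf hg
  exact integrable_mul_shift' (measurable_mul_conv hu hv k hf hg) hD hw k x

lemma measurable_Tk (hu : Bump C u) (hv : Bump C v) (hw : Bump C w) (k : ℤ) (hf : Nice f)
    (hg : Nice g) : Measurable (Tk u v w k f g) :=
  measurable_conv (measurable_mul_conv hu hv k hf hg) hw k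

lemma measurable_T (hu : Bump C u) (hv : Bump C v) (hw : Bump C w) (Λ : Finset ℤ) (hf : Nice f)
    (hg : Nice g) : Measurable (T u v w Λ f g) :=
  Finset.measurable_fun_sum Λ fun k _ => measurable_Tk hu hv hw k hf hg

lemma Tk_sub_left (hu : Bump C u) (hv : Bump C v) (hw : Bump C w) (k : ℤ) (hf : Nice f)
    (hf' : Nice f') (hg : Nice g) (x : ℝ) :
    Tk u v w k (fun y => f y - f' y) g x = Tk u v w k f g x - Tk u v w k f' g x := by
  unfold Tk
  simp_rw [conv_sub hf hf' hu k]
  rw [conv, conv, conv, ← integral_sub (Tk_integrable hu hv hw k hf hg x)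
    (Tk_integrable hu hv hw k hf' hg x)]
  refine integral_congr_ae (Eventually.of_forall fun t => ?_)
  ring

lemma T_sub_left (hu : Bump C u) (hv : Bump C v) (hw : Bump C w) (Λ : Finset ℤ) (hf : Nice f)
    (hf' : Nice f') (hg : Nice g) (x : ℝ) :
    T u v w Λ (fun y => f y - f' y) g x = T u v w Λ f g x - T u v w Λ f' g x := by
  unfold T
  rw [← Finset.sum_sub_distrib]
  exact Finset.sum_congr rfl fun k _ => Tk_sub_left hu hv hw k hf hf' hg x

lemma T_sub_right (hu : Bump C u) (hv : Bump C v) (hw : Bump C w) (Λ : Finset ℤ) (hf : Nice f)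
    (hg : Nice g) (hg' : Nice g') (x : ℝ) :
    T u v w Λ f (fun y => g y - g' y) x = T u v w Λ f g x - T u v w Λ f g' x := by
  rw [T_swap u v, T_swap u v, T_swap u v w Λ f g']
  exact T_sub_left hv hu hw Λ hg hg' hf x

/-- Pointwise bound for one scale when the two inner convolutions are controlled. -/
lemma enorm_Tk_le_of (hw : Bump C w) {k : ℤ} {F G : ℝ → ℝ≥0∞} {c d : ℝ≥0}
    (h1 : ∀ y, ‖conv f (dil u k) y‖ₑ ≤ c * Pk ((2 : ℝ) ^ k) F y)
    (h2 : ∀ y, ‖conv g (dil v k) y‖ₑ ≤ d * Pk ((2 : ℝ) ^ k) G y) (x : ℝ) :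
    ‖Tk u v w k f g x‖ₑ ≤ (C * c * d * wInt 2) *
      (Pk ((2 : ℝ) ^ k) F x * Pk ((2 : ℝ) ^ k) G x) := by
  have key := lintegral_wt_mul_Pk_le (a := (2 : ℝ) ^ k) (by positivity) F G x
  unfold Tk
  rw [conv]
  refine (enorm_integral_le_lintegral_enorm _).trans ?_
  calc ∫⁻ t, ‖conv f (dil u k) t * conv g (dil v k) t * dil w k (x - t)‖ₑ
      ≤ ∫⁻ t, (C * c * d) *
        (Pk ((2 : ℝ) ^ k) F t * Pk ((2 : ℝ) ^ k) G t * wt 10 ((2 : ℝ) ^ k) (x - t)) := by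
        refine lintegral_mono fun t => ?_
        rw [enorm_mul, enorm_mul]
        calc _ ≤ (c * Pk ((2 : ℝ) ^ k) F t) * (d * Pk ((2 : ℝ) ^ k) G t) *
              (C * wt 10 ((2 : ℝ) ^ k) (x - t)) :=
              mul_le_mul' (mul_le_mul' (h1 t) (h2 t)) (hw.enorm_dil_le _ _)
          _ = _ := by ring
    _ ≤ _ := by
        rw [lintegral_const_mul' _ _ (by finiteness), mul_assoc (_ * _ * _ : ℝ≥0∞)]
        gcongr

lemma enorm_Tk_le (hu : Bump C u) (hv : Bump C v) (hw : Bump C w) (k : ℤ) (f g : ℝ → ℂ) (x : ℝ) :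
    ‖Tk u v w k f g x‖ₑ ≤ (C * C * C * wInt 2) *
      (Pk ((2 : ℝ) ^ k) (fun y => ‖f y‖ₑ) x * Pk ((2 : ℝ) ^ k) (fun y => ‖g y‖ₑ) x) :=
  enorm_Tk_le_of hw (hu.enorm_conv_le f k) (hv.enorm_conv_le g k) x

lemma enorm_Tk_sub_le (hu : Bump C u) (hv : Bump C v) (hw : Bump C w) (k : ℤ) (hf : Nice f)
    (hg : Nice g) {x x' : ℝ} (h : (2 : ℝ) ^ k * |x - x'| ≤ 1) :
    ‖Tk u v w k f g x - Tk u v w k f g x'‖ₑ ≤ (C * C * C * wInt 2) *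
      (ENNReal.ofReal ((2 : ℝ) ^ k * |x - x'|) *
      (Pk ((2 : ℝ) ^ k) (fun y => ‖f y‖ₑ) x * Pk ((2 : ℝ) ^ k) (fun y => ‖g y‖ₑ) x)) := by
  have key := lintegral_wt_mul_Pk_le (a := (2 : ℝ) ^ k) (by positivity)
    (fun y => ‖f y‖ₑ) (fun y => ‖g y‖ₑ) x
  unfold Tk
  rw [conv, conv, ← integral_sub (Tk_integrable hu hv hw k hf hg x)
    (Tk_integrable hu hv hw k hf hg x')]
  refine (enorm_integral_le_lintegral_enorm _).trans ?_
  set F := fun y => ‖f y‖ₑ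
  set G := fun y => ‖g y‖ₑ
  set m := ENNReal.ofReal ((2 : ℝ) ^ k * |x - x'|)
  calc ∫⁻ t, ‖conv f (dil u k) t * conv g (dil v k) t * dil w k (x - t) -
        conv f (dil u k) t * conv g (dil v k) t * dil w k (x' - t)‖ₑ
      ≤ ∫⁻ t, (C * C * C * m) *
        (Pk ((2 : ℝ) ^ k) F t * Pk ((2 : ℝ) ^ k) G t * wt 10 ((2 : ℝ) ^ k) (x - t)) := by
        refine lintegral_mono fun t => ?_
        rw [← mul_sub, enorm_mul, enorm_mul]
        have e : x - t - (x' - t) = x - x' := by ring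
        calc _ ≤ (C * Pk ((2 : ℝ) ^ k) F t) * (C * Pk ((2 : ℝ) ^ k) G t) *
              (C * m * wt 10 ((2 : ℝ) ^ k) (x - t)) := by
              refine mul_le_mul' (mul_le_mul' (hu.enorm_conv_le f k t) (hv.enorm_conv_le g k t)) ?_
              have := hw.enorm_dil_sub_le k (a := x - t) (b := x' - t) (by rwa [e])
              rwa [e] at this
          _ = _ := by ring
    _ ≤ (C * C * C * m) * (wInt 2 * (Pk ((2 : ℝ) ^ k) F x * Pk ((2 : ℝ) ^ k) G x)) := by
        rw [lintegral_const_mul' _ _ (by finiteness)]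
        gcongr
    _ = _ := by ring

end

/-- The maximal interval of `S` containing a point. -/
noncomputable def stopIx (S : Set (ℤ × ℤ)) (x : ℝ) : ℤ × ℤ :=
  open Classical in if h : ∃ j ∈ stopMax S, x ∈ dyI j then h.choose else (0, 0)

lemma stopIx_eq {S : Set (ℤ × ℤ)} {j : ℤ × ℤ} (hj : j ∈ stopMax S) {x : ℝ} (hx : x ∈ dyI j) :
    stopIx S x = j := by
  have h : ∃ j ∈ stopMax S, x ∈ dyI j := ⟨j, hj, hx⟩
  unfold stopIx
  rw [dif_pos h]
  exact stopMax_unique h.choose_spec.1 hj h.choose_spec.2 hx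

lemma stopIx_spec {S : Set (ℤ × ℤ)} {x : ℝ} (hx : x ∈ stopSet S) :
    stopIx S x ∈ stopMax S ∧ x ∈ dyI (stopIx S x) := by
  obtain ⟨j, hj, hx⟩ := Set.mem_iUnion₂.1 hx
  rw [stopIx_eq hj hx]
  exact ⟨hj, hx⟩

lemma stopIx_of_notMem {S : Set (ℤ × ℤ)} {x : ℝ} (hx : x ∉ stopSet S) : stopIx S x = (0, 0) := by
  unfold stopIx
  rw [dif_neg]
  rintro ⟨j, hj, hxj⟩
  exact hx (Set.mem_iUnion₂.2 ⟨j, hj, hxj⟩)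

lemma measurable_stopIx (S : Set (ℤ × ℤ)) : Measurable (stopIx S) := by
  refine measurable_to_countable' fun j => ?_
  by_cases hj : j ∈ stopMax S
  · have : stopIx S ⁻¹' {j} = dyI j ∪ ((stopSet S)ᶜ ∩ {_x | j = (0, 0)}) := by
      ext x
      simp only [Set.mem_preimage, Set.mem_singleton_iff, Set.mem_union, Set.mem_inter_iff,
        Set.mem_compl_iff, Set.mem_ofPred_eq]
      constructor
      · intro h
        by_cases hx : x ∈ stopSet S
        · left; rw [← h]; exact (stopIx_spec hx).2
        · right; exact ⟨hx, by rw [← h, stopIx_of_notMem hx]⟩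
      · rintro (h | ⟨h, h'⟩)
        · exact stopIx_eq hj h
        · rw [stopIx_of_notMem h, h']
    rw [this]
    exact (measurableSet_dyI j).union ((measurableSet_stopSet S).compl.inter (by measurability))
  · have : stopIx S ⁻¹' {j} = (stopSet S)ᶜ ∩ {_x | j = (0, 0)} := by
      ext x
      simp only [Set.mem_preimage, Set.mem_singleton_iff, Set.mem_inter_iff,
        Set.mem_compl_iff, Set.mem_ofPred_eq]
      constructor
      · intro h
        by_cases hx : x ∈ stopSet S
        · exact absurd (h ▸ (stopIx_spec hx).1) hj
        · exact ⟨hx, by rw [← h, stopIx_of_notMem hx]⟩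
      · rintro ⟨h, h'⟩
        rw [stopIx_of_notMem h, h']
    rw [this]
    exact (measurableSet_stopSet S).compl.inter (by measurability)

lemma Bump.enorm_conv_bad_le {C : ℝ≥0} {u b : ℝ → ℂ} (hu : Bump C u) {S : Set (ℤ × ℤ)}
    (hb : Integrable b) (hsupp : ∀ x ∉ stopSet S, b x = 0)
    (hmean : ∀ j ∈ stopMax S, ∫ x in dyI j, b x = 0) (k : ℤ) (y : ℝ) :
    ‖conv b (dil u k) y‖ₑ ≤ C * Pk ((2 : ℝ) ^ k)
      (fun t => ‖b t‖ₑ * ENNReal.ofReal ((2 : ℝ) ^ k * sz (stopIx S t))) y := by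
  have hint := integrable_mul_shift hb hu k y
  have e1 : conv b (dil u k) y = ∫ t in stopSet S, b t * dil u k (y - t) := by
    unfold conv
    refine (setIntegral_eq_integral_of_forall_compl_eq_zero fun t ht => ?_).symm
    rw [hsupp t ht, zero_mul]
  have e2 : stopSet S = ⋃ j : stopMax S, dyI j := by
    unfold stopSet; rw [Set.biUnion_eq_iUnion]
  have hdisj : Pairwise (Function.onFun Disjoint fun j : stopMax S => dyI j) := fun a b hab =>
    stopMax_disjoint S a.2 b.2 (fun h => hab (Subtype.ext h))
  rw [e1, e2, integral_iUnion (s := fun j : stopMax S => dyI j)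
    (fun j => measurableSet_dyI j) hdisj hint.integrableOn]
  refine enorm_tsum_le_tsum_enorm.trans ?_
  set ρ := fun t => ‖b t‖ₑ * ENNReal.ofReal ((2 : ℝ) ^ k * sz (stopIx S t)) with hρ
  calc ∑' j : stopMax S, ‖∫ t in dyI j, b t * dil u k (y - t)‖ₑ
      ≤ ∑' j : stopMax S, ∫⁻ t in dyI j, C * (ρ t * wt 10 ((2 : ℝ) ^ k) (y - t)) := by
        refine ENNReal.tsum_le_tsum fun j => ?_
        have hρj : ∀ t ∈ dyI j, ρ t = ‖b t‖ₑ * ENNReal.ofReal ((2 : ℝ) ^ k * sz j) := fun t ht => by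
          simp only [hρ, stopIx_eq j.2 ht]
        rcases le_or_gt ((2 : ℝ) ^ k * sz j) 1 with h | h
        · have e3 : ∫ t in dyI j, b t * dil u k (y - t) =
              ∫ t in dyI j, b t * (dil u k (y - t) - dil u k (y - ctr j)) := by
            simp_rw [mul_sub]
            rw [integral_sub hint.integrableOn (hb.integrableOn.mul_const _),
              integral_mul_const, hmean j j.2, zero_mul, sub_zero]
          rw [e3]
          refine (enorm_integral_le_lintegral_enorm _).trans ?_
          refine setLIntegral_mono' (measurableSet_dyI _) fun t ht => ?_
          rw [hρj t ht, enorm_mul]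
          have hd : |(y - t) - (y - ctr j)| ≤ sz j := by
            have := abs_sub_ctr_le ht
            rw [show y - t - (y - ctr j) = -(t - ctr j) by ring, abs_neg]
            linarith [sz_pos j]
          have hd2 : (2 : ℝ) ^ k * |(y - t) - (y - ctr j)| ≤ (2 : ℝ) ^ k * sz j := by gcongr
          calc _ ≤ ‖b t‖ₑ * (C * ENNReal.ofReal ((2 : ℝ) ^ k * |(y - t) - (y - ctr j)|) *
                wt 10 ((2 : ℝ) ^ k) (y - t)) := by
                gcongr
                exact hu.enorm_dil_sub_le k (hd2.trans h)
            _ ≤ ‖b t‖ₑ * (C * ENNReal.ofReal ((2 : ℝ) ^ k * sz j) *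
                wt 10 ((2 : ℝ) ^ k) (y - t)) := by gcongr
            _ = _ := by ring
        · refine (enorm_integral_le_lintegral_enorm _).trans ?_
          refine setLIntegral_mono' (measurableSet_dyI _) fun t ht => ?_
          rw [hρj t ht, enorm_mul]
          calc _ ≤ ‖b t‖ₑ * (C * wt 10 ((2 : ℝ) ^ k) (y - t)) := by
                gcongr; exact hu.enorm_dil_le _ _
            _ ≤ ‖b t‖ₑ * (C * wt 10 ((2 : ℝ) ^ k) (y - t)) *
                ENNReal.ofReal ((2 : ℝ) ^ k * sz j) := by
                refine le_mul_of_one_le_right' ?_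
                rw [← ENNReal.ofReal_one]
                exact ENNReal.ofReal_le_ofReal h.le
            _ = _ := by ring
    _ = C * ∫⁻ t in stopSet S, ρ t * wt 10 ((2 : ℝ) ^ k) (y - t) := by
        rw [← lintegral_stopSet, lintegral_const_mul' _ _ ENNReal.coe_ne_top]
    _ ≤ _ := by
        gcongr
        exact (setLIntegral_le_lintegral _ _).trans conv_le_Pk

/-- The pointwise lattice norm of a family of functions. -/
noncomputable def vn {ι : Type} (N : (ι → ℝ≥0∞) → ℝ≥0∞) (f : ι → ℝ → ℂ) (x : ℝ) : ℝ≥0∞ :=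
  N fun i => ‖f i x‖ₑ

section
variable {ι : Type} {N : (ι → ℝ≥0∞) → ℝ≥0∞} {f g : ι → ℝ → ℂ}

lemma measurable_vn (h : LatNorm N) (hf : ∀ i, Measurable (f i)) : Measurable (vn N f) :=
  h.meas fun i => (hf i).enorm

lemma vn_decay (h : LatNorm N) (hf : ∀ i, Nice (f i)) :
    ∃ C : ℝ≥0, ∀ x, vn N f x ≤ C * wt 8 1 x := by
  obtain ⟨S, K, hK⟩ := h.fin
  choose C hC using fun i => (hf i).bd
  refine ⟨K * ∑ i ∈ S, C i, fun x => (hK _).trans ?_⟩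
  rw [ENNReal.coe_mul, mul_assoc, ENNReal.ofNNReal_finsetSum, Finset.sum_mul]
  gcongr with i
  exact hC i x

lemma lintegral_vn_ne_top (h : LatNorm N) (hf : ∀ i, Nice (f i)) : ∫⁻ x, vn N f x ≠ ∞ := by
  obtain ⟨C, hC⟩ := vn_decay h hf
  refine ne_top_of_le_ne_top ?_ (lintegral_mono hC)
  rw [lintegral_const_mul' _ _ ENNReal.coe_ne_top]
  have := lintegral_wt (N := 8) (a := 1) one_pos 0
  simp only [zero_sub, wt_abs] at this
  rw [this]
  exact ENNReal.mul_ne_top ENNReal.coe_ne_top (wInt_ne_top (by norm_num))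

lemma MinkNorm.lintegral_mul_le (h : MinkNorm N) (hf : ∀ i, Measurable (f i)) {κ : ℝ → ℝ≥0∞}
    (hκ : Measurable κ) (hκ' : ∀ y, κ y ≠ ∞) :
    N (fun i => ∫⁻ y, κ y * ‖f i y‖ₑ) ≤ ∫⁻ y, κ y * vn N f y := by
  refine (h.mink fun i => hκ.mul (hf i).enorm).trans (le_of_eq ?_)
  refine lintegral_congr fun y => ?_
  exact h.smul (hκ' y) _

lemma MinkNorm.Pk_le (h : MinkNorm N) (hf : ∀ i, Measurable (f i)) (a x : ℝ) :
    N (fun i => Pk a (fun y => ‖f i y‖ₑ) x) ≤ Pk a (vn N f) x := by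
  have := h.lintegral_mul_le hf (κ := fun y => wt 4 a (x - y)) (by fun_prop)
    fun y => wt_ne_top _ _ _
  simpa only [Pk, mul_comm] using this

lemma MinkNorm.setLIntegral_le (h : MinkNorm N) (hf : ∀ i, Measurable (f i)) {s : Set ℝ}
    (hs : MeasurableSet s) :
    N (fun i => ∫⁻ y in s, ‖f i y‖ₑ) ≤ ∫⁻ y in s, vn N f y := by
  have := h.lintegral_mul_le hf (κ := s.indicator 1) (measurable_one.indicator hs)
    fun y => by by_cases hy : y ∈ s <;> simp [hy]
  have e : ∀ F : ℝ → ℝ≥0∞, ∫⁻ y, s.indicator 1 y * F y = ∫⁻ y in s, F y := fun F => by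
    rw [← lintegral_indicator hs]
    refine lintegral_congr fun y => ?_
    by_cases hy : y ∈ s <;> simp [hy]
  simpa only [e] using this

end

lemma rpow_tsum_le {κ : Type*} (a : κ → ℝ≥0∞) {t : ℝ} (ht : 0 < t) (ht1 : t ≤ 1) :
    (∑' j, a j) ^ t ≤ ∑' j, a j ^ t := by
  have hfin : ∀ s : Finset κ, (∑ j ∈ s, a j) ^ t ≤ ∑ j ∈ s, a j ^ t := by
    classical
    intro s
    induction s using Finset.induction_on with
    | empty => simp [ht]
    | insert k S hk ih =>
      rw [Finset.sum_insert hk, Finset.sum_insert hk]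
      exact (ENNReal.rpow_add_le_add_rpow _ _ ht.le ht1).trans (by gcongr)
  have hlim : Tendsto (fun s : Finset κ => (∑ j ∈ s, a j) ^ t) atTop (𝓝 ((∑' j, a j) ^ t)) :=
    (ENNReal.continuous_rpow_const.tendsto _).comp ENNReal.summable.hasSum
  exact le_of_tendsto' hlim fun s => (hfin s).trans (ENNReal.sum_le_tsum s)

/-- The kernel of the tails created by the bad part, at scale `2^k`. -/
noncomputable def badK (S : Set (ℤ × ℤ)) (k : ℤ) (x y : ℝ) : ℝ≥0∞ :=
  (stopSet S).indicator (fun y => ENNReal.ofReal ((2 : ℝ) ^ k * sz (stopIx S y)) *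
    wt 4 ((2 : ℝ) ^ k) (x - ctr (stopIx S y))) y

lemma measurable_badK (S : Set (ℤ × ℤ)) (k : ℤ) (x : ℝ) : Measurable (badK S k x) := by
  refine Measurable.indicator ?_ (measurableSet_stopSet S)
  exact (measurable_of_countable (fun j : ℤ × ℤ => ENNReal.ofReal ((2 : ℝ) ^ k * sz j) *
    wt 4 ((2 : ℝ) ^ k) (x - ctr j))).comp (measurable_stopIx S)

lemma badK_ne_top (S : Set (ℤ × ℤ)) (k : ℤ) (x y : ℝ) : badK S k x y ≠ ∞ := by
  unfold badK
  by_cases hy : y ∈ stopSet S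
  · rw [Set.indicator_of_mem hy]; exact ENNReal.mul_ne_top ENNReal.ofReal_ne_top (wt_ne_top _ _ _)
  · rw [Set.indicator_of_notMem hy]; exact ENNReal.zero_ne_top

lemma lintegral_badK (S : Set (ℤ × ℤ)) (k : ℤ) (x : ℝ) (F : ℝ → ℝ≥0∞) :
    ∫⁻ y, badK S k x y * F y = ∑' j : stopMax S, ENNReal.ofReal ((2 : ℝ) ^ k * sz j) *
      wt 4 ((2 : ℝ) ^ k) (x - ctr j) * ∫⁻ y in dyI j, F y := by
  have e : ∫⁻ y, badK S k x y * F y = ∫⁻ y in stopSet S, badK S k x y * F y := by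
    rw [← lintegral_indicator (measurableSet_stopSet S)]
    refine lintegral_congr fun y => ?_
    by_cases hy : y ∈ stopSet S
    · rw [Set.indicator_of_mem hy]
    · rw [Set.indicator_of_notMem hy, badK, Set.indicator_of_notMem hy, zero_mul]
  rw [e, lintegral_stopSet]
  refine tsum_congr fun j => ?_
  rw [← lintegral_const_mul' _ _ (ENNReal.mul_ne_top ENNReal.ofReal_ne_top (wt_ne_top _ _ _))]
  refine setLIntegral_congr_fun (measurableSet_dyI _) fun y hy => ?_
  have hy' : y ∈ stopSet S := Set.mem_iUnion₂.2 ⟨j, j.2, hy⟩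
  simp only [badK, Set.indicator_of_mem hy', stopIx_eq j.2 hy]

lemma wt_le_ctr {a : ℝ} (ha : 0 < a) {j : ℤ × ℤ} {x y : ℝ} (hx : 4 * sz j ≤ |x - ctr j|)
    (hy : y ∈ dyI j) : wt 4 a (x - y) ≤ 16 * wt 4 a (x - ctr j) := by
  have h1 := abs_sub_ctr_le hy
  have h2 : |x - ctr j| ≤ 2 * |x - y| := by
    have := abs_sub_le x y (ctr j)
    linarith [sz_pos j]
  unfold wt
  rw [show (16 : ℝ≥0∞) = ENNReal.ofReal 16 by simp, ← ENNReal.ofReal_mul (by norm_num)]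
  refine ENNReal.ofReal_le_ofReal ?_
  rw [mul_div_assoc', div_le_div_iff₀ (by positivity) (by positivity)]
  have h3 : 1 + a * |x - ctr j| ≤ 2 * (1 + a * |x - y|) := by nlinarith
  calc a * (1 + a * |x - ctr j|) ^ 4 ≤ a * (2 * (1 + a * |x - y|)) ^ 4 := by gcongr
    _ = _ := by ring

lemma Pk_bad_le {S : Set (ℤ × ℤ)} {b f : ℝ → ℂ} (hsupp : ∀ x ∉ stopSet S, b x = 0)
    (hbf : ∀ j ∈ stopMax S, ∫⁻ y in dyI j, ‖b y‖ₑ ≤ 2 * ∫⁻ y in dyI j, ‖f y‖ₑ) (k : ℤ) {x : ℝ}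
    (hx : ∀ j ∈ stopMax S, 4 * sz j ≤ |x - ctr j|) :
    Pk ((2 : ℝ) ^ k) (fun t => ‖b t‖ₑ * ENNReal.ofReal ((2 : ℝ) ^ k * sz (stopIx S t))) x ≤
      32 * ∫⁻ y, badK S k x y * ‖f y‖ₑ := by
  calc _ ≤ ∫⁻ y, 16 * (badK S k x y * ‖b y‖ₑ) := by
        refine lintegral_mono fun y => ?_
        by_cases hy : y ∈ stopSet S
        · obtain ⟨h1, h2⟩ := stopIx_spec hy
          simp only [badK, Set.indicator_of_mem hy]
          calc _ ≤ ‖b y‖ₑ * ENNReal.ofReal ((2 : ℝ) ^ k * sz (stopIx S y)) *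
                (16 * wt 4 ((2 : ℝ) ^ k) (x - ctr (stopIx S y))) := by
                gcongr
                exact wt_le_ctr (by positivity) (hx _ h1) h2
            _ = _ := by ring
        · simp [hsupp y hy]
    _ = 16 * ∑' j : stopMax S, ENNReal.ofReal ((2 : ℝ) ^ k * sz j) *
          wt 4 ((2 : ℝ) ^ k) (x - ctr j) * ∫⁻ y in dyI j, ‖b y‖ₑ := by
        rw [lintegral_const_mul' _ _ (by norm_num), lintegral_badK]
    _ ≤ 16 * ∑' j : stopMax S, 2 * (ENNReal.ofReal ((2 : ℝ) ^ k * sz j) *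
          wt 4 ((2 : ℝ) ^ k) (x - ctr j) * ∫⁻ y in dyI j, ‖f y‖ₑ) := by
        refine mul_le_mul_right (ENNReal.tsum_le_tsum fun j => ?_) _
        calc _ ≤ ENNReal.ofReal ((2 : ℝ) ^ k * sz j) * wt 4 ((2 : ℝ) ^ k) (x - ctr j) *
              (2 * ∫⁻ y in dyI j, ‖f y‖ₑ) := by gcongr; exact hbf j j.2
          _ = _ := by ring
    _ = _ := by
        rw [ENNReal.tsum_mul_left, ← lintegral_badK, ← mul_assoc]; norm_num

lemma bad_weight_le (k : ℤ) {h d : ℝ} (hh : 0 < h) (hd : h ≤ |d|) {t : ℝ} (ht : 0 < t)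
    (ht1 : t ≤ 1) :
    (ENNReal.ofReal ((2 : ℝ) ^ k * h) * wt 4 ((2 : ℝ) ^ k) d * ENNReal.ofReal h) ^ t ≤
      4 * ENNReal.ofReal ((1 + h⁻¹ * |d|) ^ (-(2 * t))) *
        ENNReal.ofReal (mn ((2 : ℝ) ^ k * |d|) ^ (2 * t)) := by
  have hd0 : 0 < |d| := hh.trans_le hd
  set a : ℝ := (2 : ℝ) ^ k with ha
  have ha0 : 0 < a := by positivity
  set v := a * |d| with hv
  have hv0 : 0 < v := by positivity
  have hmn : v ^ 2 / (1 + v) ^ 4 ≤ mn v ^ 2 := by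
    unfold mn
    rcases le_total v v⁻¹ with h1 | h1
    · rw [min_eq_left h1]
      exact div_le_self (by positivity) (one_le_pow₀ (by linarith))
    · rw [min_eq_right h1, inv_pow, div_le_iff₀ (by positivity), inv_mul_eq_div,
        le_div_iff₀ (by positivity)]
      calc v ^ 2 * v ^ 2 = v ^ 4 := by ring
        _ ≤ _ := by gcongr; linarith
  have h2 : h / |d| ≤ 2 * (1 + h⁻¹ * |d|)⁻¹ := by
    rw [← div_eq_mul_inv, div_le_div_iff₀ hd0 (by positivity)]
    have : h * (1 + h⁻¹ * |d|) = h + |d| := by field_simp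
    rw [this]; linarith
  have hm0 : 0 < mn v := mn_pos hv0
  rw [wt, ← ENNReal.ofReal_mul (by positivity), ← ENNReal.ofReal_mul (by positivity),
    ENNReal.ofReal_rpow_of_nonneg (by positivity) ht.le,
    show (4 : ℝ≥0∞) = ENNReal.ofReal 4 by simp, ← ENNReal.ofReal_mul (by norm_num),
    ← ENNReal.ofReal_mul (by positivity)]
  refine ENNReal.ofReal_le_ofReal ?_
  have h3 : a * h * (a / (1 + a * |d|) ^ 4) * h ≤ (2 * (1 + h⁻¹ * |d|)⁻¹ * mn v) ^ 2 := by
    calc a * h * (a / (1 + a * |d|) ^ 4) * h = (h / |d|) ^ 2 * (v ^ 2 / (1 + v) ^ 4) := by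
          rw [hv]; field_simp
      _ ≤ (2 * (1 + h⁻¹ * |d|)⁻¹) ^ 2 * mn v ^ 2 := by gcongr
      _ = _ := by ring
  have h4 : (2 : ℝ) ^ (2 * t) ≤ 4 := by
    calc (2 : ℝ) ^ (2 * t) ≤ 2 ^ (2 : ℝ) := by gcongr <;> linarith
      _ = 4 := by norm_num
  calc _ ≤ ((2 * (1 + h⁻¹ * |d|)⁻¹ * mn v) ^ 2) ^ t := Real.rpow_le_rpow (by positivity) h3 ht.le
    _ = 2 ^ (2 * t) * (1 + h⁻¹ * |d|) ^ (-(2 * t)) * mn v ^ (2 * t) := by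
        rw [← Real.rpow_natCast, ← Real.rpow_mul (by positivity),
          Real.mul_rpow (by positivity) hm0.le, Real.mul_rpow (by norm_num) (by positivity),
          Real.inv_rpow (by positivity), Real.rpow_neg (by positivity)]
        norm_num
    _ ≤ _ := by gcongr

section
variable {ι : Type} {N₁ N₂ NY : (ι → ℝ≥0∞) → ℝ≥0∞} {t : ℝ} {C : ℝ≥0} {u v w : ℝ → ℂ}

lemma vn_T_rpow_le (hY : QNorm t NY) {τ : ℝ} (hτ : 0 < τ) (hτt : τ ≤ t) (Λ : Finset ℤ)
    (f g : ι → ℝ → ℂ) (x : ℝ) :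
    vn NY (fun i => T u v w Λ (f i) (g i)) x ^ τ ≤
      ∑ k ∈ Λ, vn NY (fun i => Tk u v w k (f i) (g i)) x ^ τ := by
  refine le_trans ?_ (hY.sum_le hτ hτt Λ fun k i => ‖Tk u v w k (f i) (g i) x‖ₑ)
  refine ENNReal.rpow_le_rpow (hY.mono fun i => ?_) hτ.le
  exact enorm_sum_le _ _

lemma lintegral_bad_le (ht : 1 / 2 < t) (ht1 : t ≤ 1) (C : ℝ≥0) : ∃ K : ℝ≥0,
    ∀ {ι : Type} {N₁ N₂ NY : (ι → ℝ≥0∞) → ℝ≥0∞} {u v w : ℝ → ℂ}, MinkNorm N₁ → MinkNorm N₂ →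
    QNorm t NY → (∀ a b, NY (fun i => a i * b i) ≤ N₁ a * N₂ b) →
    Bump C u → Bump C v → Bump C w →
    ∀ (Λ : Finset ℤ) (S : Set (ℤ × ℤ)) (f b g : ι → ℝ → ℂ),
    (∀ i, Nice (f i)) → (∀ i, Nice (b i)) → (∀ i, Nice (g i)) →
    (∀ i, ∀ x ∉ stopSet S, b i x = 0) →
    (∀ i, ∀ j ∈ stopMax S, ∫ x in dyI j, b i x = 0) →
    (∀ i, ∀ j ∈ stopMax S, ∫⁻ y in dyI j, ‖b i y‖ₑ ≤ 2 * ∫⁻ y in dyI j, ‖f i y‖ₑ) →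
    ∀ (α γ : ℝ≥0) (X : Set ℝ), MeasurableSet X →
    (∀ j ∈ stopMax S, ∫⁻ y in dyI j, vn N₁ f y ≤ α * ENNReal.ofReal (sz j)) →
    (∀ x ∉ X, ∀ j ∈ stopMax S, 4 * sz j ≤ |x - ctr j|) →
    (∀ x ∉ X, ∀ k : ℤ, Pk ((2 : ℝ) ^ k) (vn N₂ g) x ≤ γ) →
    ∫⁻ x in Xᶜ, vn NY (fun i => T u v w Λ (b i) (g i)) x ^ t ≤
      K * ((α * γ : ℝ≥0) : ℝ≥0∞) ^ t * volume (stopSet S) := by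
  have ht0 : 0 < t := by linarith
  obtain ⟨Cm, hCm⟩ := tsum_mn (θ := 2 * t) (by linarith)
  have hw2 : wInt 2 ≠ ∞ := wInt_ne_top (by norm_num)
  have hwt : wInt (2 * t) ≠ ∞ := wInt_ne_top (by linarith)
  set L : ℝ≥0 := C * C * C * (wInt 2).toNNReal * 32 with hL
  refine ⟨L ^ t * (4 * Cm * (wInt (2 * t)).toNNReal), ?_⟩
  intro ι N₁ N₂ NY u v w h₁ h₂ hY hH hu hv hw Λ S f b g hf hb hg hsupp hmean hbf α γ X hX hα hXd hγ
  have pt : ∀ x ∉ X, vn NY (fun i => T u v w Λ (b i) (g i)) x ^ t ≤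
      (L : ℝ≥0∞) ^ t * ((α * γ : ℝ≥0) : ℝ≥0∞) ^ t * ∑' j : stopMax S,
        4 * Cm * ENNReal.ofReal ((1 + (sz j)⁻¹ * |x - ctr j|) ^ (-(2 * t))) := by
    intro x hx
    refine (vn_T_rpow_le hY ht0 le_rfl Λ b g x).trans ?_
    have hk : ∀ k ∈ Λ, vn NY (fun i => Tk u v w k (b i) (g i)) x ^ t ≤
        (L : ℝ≥0∞) ^ t * ((α * γ : ℝ≥0) : ℝ≥0∞) ^ t * ∑' j : stopMax S,
        4 * ENNReal.ofReal ((1 + (sz j)⁻¹ * |x - ctr j|) ^ (-(2 * t))) *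
          ENNReal.ofReal (mn ((2 : ℝ) ^ k * |x - ctr j|) ^ (2 * t)) := by
      intro k _
      have h1 : vn NY (fun i => Tk u v w k (b i) (g i)) x ≤ L * ((α * γ : ℝ≥0) : ℝ≥0∞) *
          ∑' j : stopMax S, ENNReal.ofReal ((2 : ℝ) ^ k * sz j) *
            wt 4 ((2 : ℝ) ^ k) (x - ctr j) * ENNReal.ofReal (sz j) := by
        have hLt : (L : ℝ≥0∞) = C * C * C * wInt 2 * 32 := by
          rw [hL]; push_cast; rw [ENNReal.coe_toNNReal hw2]
        calc vn NY (fun i => Tk u v w k (b i) (g i)) x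
            ≤ NY (fun i => L * ((∫⁻ y, badK S k x y * ‖f i y‖ₑ) *
                Pk ((2 : ℝ) ^ k) (fun y => ‖g i y‖ₑ) x)) := by
              refine hY.mono fun i => ?_
              refine (enorm_Tk_le_of hw (hu.enorm_conv_bad_le (hb i).integrable (hsupp i)
                (hmean i) k) (hv.enorm_conv_le (g i) k) x).trans ?_
              rw [hLt]
              calc _ ≤ (C * C * C * wInt 2) * ((32 * ∫⁻ y, badK S k x y * ‖f i y‖ₑ) *
                    Pk ((2 : ℝ) ^ k) (fun y => ‖g i y‖ₑ) x) := by
                    gcongr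
                    exact Pk_bad_le (hsupp i) (hbf i) k (hXd x hx)
                _ = _ := by ring
          _ ≤ L * ((∫⁻ y, badK S k x y * vn N₁ f y) * Pk ((2 : ℝ) ^ k) (vn N₂ g) x) := by
              rw [hY.smul ENNReal.coe_ne_top]
              gcongr
              refine (hH _ _).trans ?_
              exact mul_le_mul' (h₁.lintegral_mul_le (fun i => (hf i).meas) (measurable_badK S k x)
                (badK_ne_top S k x)) (h₂.Pk_le (fun i => (hg i).meas) _ _)
          _ ≤ L * ((∑' j : stopMax S, ENNReal.ofReal ((2 : ℝ) ^ k * sz j) *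
                wt 4 ((2 : ℝ) ^ k) (x - ctr j) * (α * ENNReal.ofReal (sz j))) * γ) := by
              rw [lintegral_badK]
              gcongr with j
              · exact hα j j.2
              · exact hγ x hx k
          _ = _ := by
              have : ∀ j : stopMax S, ENNReal.ofReal ((2 : ℝ) ^ k * sz j) *
                wt 4 ((2 : ℝ) ^ k) (x - ctr j) * (α * ENNReal.ofReal (sz j)) =
                  α * (ENNReal.ofReal ((2 : ℝ) ^ k * sz j) *
                wt 4 ((2 : ℝ) ^ k) (x - ctr j) * ENNReal.ofReal (sz j)) := fun j => by ring
              simp_rw [this]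
              rw [ENNReal.tsum_mul_left, ENNReal.coe_mul α γ]
              ring
      calc _ ≤ (L * ((α * γ : ℝ≥0) : ℝ≥0∞) *
          ∑' j : stopMax S, ENNReal.ofReal ((2 : ℝ) ^ k * sz j) *
            wt 4 ((2 : ℝ) ^ k) (x - ctr j) * ENNReal.ofReal (sz j)) ^ t :=
            ENNReal.rpow_le_rpow h1 ht0.le
        _ ≤ _ := by
            rw [ENNReal.mul_rpow_of_nonneg _ _ ht0.le, ENNReal.mul_rpow_of_nonneg _ _ ht0.le]
            gcongr
            refine (rpow_tsum_le _ ht0 ht1).trans (ENNReal.tsum_le_tsum fun j => ?_)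
            exact bad_weight_le k (sz_pos _) (by linarith [hXd x hx j j.2, sz_pos j]) ht0 ht1
    refine (Finset.sum_le_sum hk).trans ?_
    rw [← Finset.mul_sum]
    gcongr
    rw [← Summable.tsum_finsetSum fun _ _ => ENNReal.summable]
    refine ENNReal.tsum_le_tsum fun j => ?_
    rw [← Finset.mul_sum]
    calc _ ≤ 4 * ENNReal.ofReal ((1 + (sz j)⁻¹ * |x - ctr j|) ^ (-(2 * t))) * Cm := by
          gcongr
          refine hCm Λ _ ?_
          linarith [hXd x hx j j.2, sz_pos j]
      _ = _ := by ring
  calc _ ≤ ∫⁻ x in Xᶜ, (L : ℝ≥0∞) ^ t * ((α * γ : ℝ≥0) : ℝ≥0∞) ^ t * ∑' j : stopMax S,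
        4 * Cm * ENNReal.ofReal ((1 + (sz j)⁻¹ * |x - ctr j|) ^ (-(2 * t))) :=
        setLIntegral_mono' hX.compl fun x hx => pt x hx
    _ ≤ ∫⁻ x, (L : ℝ≥0∞) ^ t * ((α * γ : ℝ≥0) : ℝ≥0∞) ^ t * ∑' j : stopMax S,
        4 * Cm * ENNReal.ofReal ((1 + (sz j)⁻¹ * |x - ctr j|) ^ (-(2 * t))) :=
        setLIntegral_le_lintegral _ _
    _ = (L : ℝ≥0∞) ^ t * ((α * γ : ℝ≥0) : ℝ≥0∞) ^ t * ∑' j : stopMax S,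
        4 * Cm * (ENNReal.ofReal (sz j) * wInt (2 * t)) := by
        rw [lintegral_const_mul' _ _ (by
          refine ENNReal.mul_ne_top ?_ ?_ <;>
          exact ENNReal.rpow_ne_top_of_nonneg ht0.le ENNReal.coe_ne_top)]
        congr 1
        rw [lintegral_tsum fun j => by fun_prop]
        refine tsum_congr fun j => ?_
        rw [lintegral_const_mul' _ _ (by finiteness)]
        congr 1
        have := lintegral_wInt (r := 2 * t) (a := (sz j)⁻¹) (inv_pos.2 (sz_pos j)) (ctr j)
        rw [inv_inv] at this
        rw [← this]
        simp_rw [abs_sub_comm]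
    _ = _ := by
        rw [volume_stopSet, ENNReal.tsum_mul_left, ENNReal.tsum_mul_right]
        push_cast
        rw [ENNReal.coe_toNNReal hwt, ENNReal.coe_rpow_of_nonneg _ ht0.le]
        ring

end

/-- The good part of a Calderón–Zygmund decomposition. -/
noncomputable def gd (S : Set (ℤ × ℤ)) (f : ℝ → ℂ) (x : ℝ) : ℂ :=
  open Classical in
  if x ∈ stopSet S then ((sz (stopIx S x))⁻¹ : ℝ) * ∫ y in dyI (stopIx S x), f y else f x

section
variable {S : Set (ℤ × ℤ)} {f : ℝ → ℂ}

lemma gd_of_notMem {x : ℝ} (hx : x ∉ stopSet S) : gd S f x = f x := by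
  unfold gd; rw [if_neg hx]

lemma gd_of_mem {j : ℤ × ℤ} (hj : j ∈ stopMax S) {x : ℝ} (hx : x ∈ dyI j) :
    gd S f x = ((sz j)⁻¹ : ℝ) * ∫ y in dyI j, f y := by
  have hx' : x ∈ stopSet S := Set.mem_iUnion₂.2 ⟨j, hj, hx⟩
  unfold gd
  rw [if_pos hx', stopIx_eq hj hx]

lemma measurable_gd (hf : Measurable f) : Measurable (gd S f) := by
  classical
  refine Measurable.ite (measurableSet_stopSet S) ?_ hf
  exact (measurable_of_countable (fun j : ℤ × ℤ => (((sz j)⁻¹ : ℝ) : ℂ) * ∫ y in dyI j, f y)).comp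
    (measurable_stopIx S)

lemma enorm_gd_le {j : ℤ × ℤ} (hj : j ∈ stopMax S) {x : ℝ} (hx : x ∈ dyI j) :
    ‖gd S f x‖ₑ ≤ ENNReal.ofReal (sz j)⁻¹ * ∫⁻ y in dyI j, ‖f y‖ₑ := by
  rw [gd_of_mem hj hx, enorm_mul]
  have : ‖(((sz j)⁻¹ : ℝ) : ℂ)‖ₑ = ENNReal.ofReal (sz j)⁻¹ := by
    rw [← ofReal_norm, Complex.norm_real, Real.norm_of_nonneg (inv_nonneg.2 (sz_pos j).le)]
  rw [this]
  gcongr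
  exact enorm_integral_le_lintegral_enorm _

lemma inv_mul_sz (j : ℤ × ℤ) : ENNReal.ofReal (sz j)⁻¹ * ENNReal.ofReal (sz j) = 1 := by
  rw [← ENNReal.ofReal_mul (inv_nonneg.2 (sz_pos j).le), inv_mul_cancel₀ (sz_pos j).ne',
    ENNReal.ofReal_one]

lemma Nice.gd {n₀ : ℤ} (hS : ∀ j ∈ S, j.1 ≤ n₀) (hf : Nice f) : Nice (gd S f) := by
  obtain ⟨C, hC⟩ := hf.bd
  set R : ℝ := (2 : ℝ) ^ n₀ with hR
  have hR0 : 0 < R := by positivity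
  set L : ℝ≥0 := Real.toNNReal ((1 + R) ^ 8) with hL
  have hL1 : (1 : ℝ≥0∞) ≤ L := by
    rw [hL, ← ENNReal.ofReal]
    rw [← ENNReal.ofReal_one]
    exact ENNReal.ofReal_le_ofReal (one_le_pow₀ (by linarith))
  refine ⟨measurable_gd hf.meas, C * L, fun x => ?_⟩
  by_cases hx : x ∈ stopSet S
  · obtain ⟨h1, h2⟩ := stopIx_spec hx
    set j := stopIx S x
    have hsz : sz j ≤ R := zpow_le_zpow_right₀ (by norm_num) (hS j h1.1)
    refine (enorm_gd_le h1 h2).trans ?_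
    have hin : ∀ y ∈ dyI j, ‖f y‖ₑ ≤ C * L * wt 8 1 x := by
      intro y hy
      refine (hC y).trans ?_
      rw [mul_assoc]
      gcongr
      have h3 : |x - y| ≤ R := by
        have a1 := abs_sub_ctr_le hy
        have a2 := abs_sub_ctr_le h2
        have := abs_sub_le x (ctr j) y
        rw [abs_sub_comm (ctr j) y] at this
        linarith
      have := wt_shift (N := 8) one_pos x y 0
      simp only [sub_zero] at this
      refine this.trans ?_
      rw [hL, ← ENNReal.ofReal]
      gcongr
      linarith
    calc _ ≤ ENNReal.ofReal (sz j)⁻¹ * ∫⁻ y in dyI j, C * L * wt 8 1 x := by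
          gcongr ENNReal.ofReal (sz j)⁻¹ * ?_
          exact setLIntegral_mono' (measurableSet_dyI j) hin
      _ = ENNReal.ofReal (sz j)⁻¹ * ENNReal.ofReal (sz j) * (C * L * wt 8 1 x) := by
          rw [setLIntegral_const, volume_dyI]; ring
      _ = _ := by rw [inv_mul_sz, one_mul, ENNReal.coe_mul]
  · rw [gd_of_notMem hx]
    refine (hC x).trans ?_
    rw [ENNReal.coe_mul]
    gcongr
    exact le_mul_of_one_le_right' hL1

lemma bad_of_notMem {x : ℝ} (hx : x ∉ stopSet S) : f x - gd S f x = 0 := by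
  rw [gd_of_notMem hx, sub_self]

lemma integral_bad (hf : Integrable f) {j : ℤ × ℤ} (hj : j ∈ stopMax S) :
    ∫ x in dyI j, (f x - gd S f x) = 0 := by
  rw [setIntegral_congr_fun (g := fun x => f x - ((sz j)⁻¹ : ℝ) * ∫ y in dyI j, f y)
    (measurableSet_dyI j) fun x hx => by simp only [gd_of_mem hj hx]]
  have hv : volume.real (dyI j) = sz j := by
    rw [Measure.real, volume_dyI, ENNReal.toReal_ofReal (sz_pos j).le]
  rw [integral_sub hf.integrableOn (integrableOn_const (by rw [volume_dyI]; simp)),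
    setIntegral_const, hv]
  have : (sz j : ℂ) ≠ 0 := by exact_mod_cast (sz_pos j).ne'
  rw [Complex.real_smul, Complex.ofReal_inv, mul_inv_cancel_left₀ this, sub_self]

lemma lintegral_gd_le {j : ℤ × ℤ} (hj : j ∈ stopMax S) :
    ∫⁻ x in dyI j, ‖gd S f x‖ₑ ≤ ∫⁻ x in dyI j, ‖f x‖ₑ := by
  calc _ ≤ ∫⁻ x in dyI j, ENNReal.ofReal (sz j)⁻¹ * ∫⁻ y in dyI j, ‖f y‖ₑ :=
        setLIntegral_mono' (measurableSet_dyI j) fun x hx => enorm_gd_le hj hx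
    _ = ENNReal.ofReal (sz j)⁻¹ * ENNReal.ofReal (sz j) * ∫⁻ y in dyI j, ‖f y‖ₑ := by
        rw [setLIntegral_const, volume_dyI]; ring
    _ = _ := by rw [inv_mul_sz, one_mul]

lemma lintegral_bad_part_le (hf : Measurable f) {j : ℤ × ℤ} (hj : j ∈ stopMax S) :
    ∫⁻ x in dyI j, ‖f x - gd S f x‖ₑ ≤ 2 * ∫⁻ x in dyI j, ‖f x‖ₑ := by
  calc _ ≤ ∫⁻ x in dyI j, (‖f x‖ₑ + ‖gd S f x‖ₑ) := lintegral_mono fun x => enorm_sub_le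
    _ = (∫⁻ x in dyI j, ‖f x‖ₑ) + ∫⁻ x in dyI j, ‖gd S f x‖ₑ := lintegral_add_left hf.enorm _
    _ ≤ _ := by rw [two_mul]; exact add_le_add le_rfl (lintegral_gd_le hj)

end

section
variable {ι : Type} {N : (ι → ℝ≥0∞) → ℝ≥0∞} {S : Set (ℤ × ℤ)} {f : ι → ℝ → ℂ}

lemma vn_gd_le (h : MinkNorm N) (hf : ∀ i, Measurable (f i)) {j : ℤ × ℤ} (hj : j ∈ stopMax S)
    {x : ℝ} (hx : x ∈ dyI j) :
    vn N (fun i => gd S (f i)) x ≤ ENNReal.ofReal (sz j)⁻¹ * ∫⁻ y in dyI j, vn N f y := by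
  calc _ ≤ N (fun i => ENNReal.ofReal (sz j)⁻¹ * ∫⁻ y in dyI j, ‖f i y‖ₑ) :=
        h.mono fun i => enorm_gd_le hj hx
    _ ≤ _ := by
        rw [h.smul ENNReal.ofReal_ne_top]
        gcongr
        exact h.setLIntegral_le hf (measurableSet_dyI j)

lemma vn_gd_of_notMem {x : ℝ} (hx : x ∉ stopSet S) :
    vn N (fun i => gd S (f i)) x = vn N f x := by
  unfold vn; simp_rw [gd_of_notMem hx]

lemma lintegral_vn_gd_le (h : MinkNorm N) (hf : ∀ i, Measurable (f i)) :
    ∫⁻ x, vn N (fun i => gd S (f i)) x ≤ ∫⁻ x, vn N f x := by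
  rw [← lintegral_add_compl _ (measurableSet_stopSet S),
    ← lintegral_add_compl (vn N f) (measurableSet_stopSet S)]
  refine add_le_add ?_ (le_of_eq ?_)
  · rw [lintegral_stopSet, lintegral_stopSet]
    refine ENNReal.tsum_le_tsum fun j => ?_
    calc _ ≤ ∫⁻ x in dyI j, ENNReal.ofReal (sz j)⁻¹ * ∫⁻ y in dyI j, vn N f y :=
          setLIntegral_mono' (measurableSet_dyI j) fun x hx => vn_gd_le h hf j.2 hx
      _ = ENNReal.ofReal (sz j)⁻¹ * ENNReal.ofReal (sz j) * ∫⁻ y in dyI j, vn N f y := by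
          rw [setLIntegral_const, volume_dyI]; ring
      _ = _ := by rw [inv_mul_sz, one_mul]
  · exact setLIntegral_congr_fun (measurableSet_stopSet S).compl fun x hx => vn_gd_of_notMem hx

lemma ae_vn_gd_le (h : MinkNorm N) (hf : ∀ i, Nice (f i)) {α : ℝ≥0} (hα : α ≠ 0)
    (hS : ∀ x, BddAbove {n | dyAt n x ∈ S}) (hFS : big (vn N f) α ⊆ S) :
    ∀ᵐ x, vn N (fun i => gd S (f i)) x ≤ 2 * α := by
  have hF := lintegral_vn_ne_top h.toLatNorm hf
  have hα' : (α : ℝ≥0∞) ≠ 0 := by exact_mod_cast hα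
  filter_upwards [ae_le_Md (measurable_vn h.toLatNorm fun i => (hf i).meas) hF] with x hx
  by_cases hxS : x ∈ stopSet S
  · obtain ⟨h1, h2⟩ := stopIx_spec hxS
    refine (vn_gd_le h (fun i => (hf i).meas) h1 h2).trans ?_
    calc _ ≤ ENNReal.ofReal (sz (stopIx S x))⁻¹ *
          (2 * α * ENNReal.ofReal (sz (stopIx S x))) := by
          gcongr; exact av_stopMax_le hFS h1
      _ = ENNReal.ofReal (sz (stopIx S x))⁻¹ * ENNReal.ofReal (sz (stopIx S x)) * (2 * α) := by
          ring
      _ = _ := by rw [inv_mul_sz, one_mul]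
  · rw [vn_gd_of_notMem hxS]
    have h1 : ¬ (α : ℝ≥0∞) < Md (vn N f) x := by
      rw [lt_Md_iff hF hα', mem_stopSet (bddAbove_big hF hα')]
      rintro ⟨n, hn⟩
      exact hxS ((mem_stopSet hS).2 ⟨n, hFS hn⟩)
    calc vn N f x ≤ α := hx.trans (not_lt.1 h1)
      _ ≤ 2 * α := le_mul_of_one_le_left' (by norm_num)

end

lemma LqNorm_le_of_ae_le {F : ℝ → ℝ≥0∞} {a : ℝ≥0∞} (ha : 1 < a) {α : ℝ≥0} (hα : α ≠ 0)
    {m : ℝ≥0∞} (hb : ∀ᵐ x, F x ≤ 2 * α) (hm : ∫⁻ x, F x ≤ α * m) :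
    LqNorm volume a F ≤ 2 * α * m ^ (1 / a.toReal) := by
  unfold LqNorm
  split_ifs with h
  · rw [h]
    simpa using essSup_le_of_ae_le _ hb
  · have h1 : 1 < a.toReal := by
      rw [← ENNReal.toReal_one]
      exact (ENNReal.toReal_lt_toReal ENNReal.one_ne_top h).2 ha
    have h0 : 0 < a.toReal := by linarith
    have hα' : (2 * α : ℝ≥0∞) ≠ 0 := by simpa using hα
    have hαt : (2 * α : ℝ≥0∞) ≠ ∞ := by finiteness
    have key : ∫⁻ x, F x ^ a.toReal ≤ (2 * α) ^ a.toReal * m := by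
      calc ∫⁻ x, F x ^ a.toReal ≤ ∫⁻ x, (2 * α) ^ (a.toReal - 1) * F x := by
            refine lintegral_mono_ae ?_
            filter_upwards [hb] with x hx
            have : F x ^ a.toReal = F x ^ (a.toReal - 1) * F x := by
              conv_rhs => rw [← ENNReal.rpow_one (F x), ← ENNReal.rpow_mul, one_mul]
              rw [← ENNReal.rpow_add_of_nonneg _ _ (by linarith) zero_le_one]
              congr 1; ring
            rw [this]
            gcongr
        _ = (2 * α) ^ (a.toReal - 1) * ∫⁻ x, F x := by
            rw [lintegral_const_mul' _ _ (ENNReal.rpow_ne_top_of_nonneg (by linarith) hαt)]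
        _ ≤ (2 * α) ^ (a.toReal - 1) * (2 * α * m) := by
            gcongr
            refine hm.trans ?_
            gcongr
            exact le_mul_of_one_le_left' (by norm_num)
        _ = _ := by
            rw [← mul_assoc]
            congr 1
            conv_lhs => rw [← ENNReal.rpow_one (2 * (α : ℝ≥0∞)), ← ENNReal.rpow_mul, one_mul]
            rw [← ENNReal.rpow_add _ _ hα' hαt]
            congr 1; ring
    calc _ ≤ ((2 * α) ^ a.toReal * m) ^ (1 / a.toReal) := ENNReal.rpow_le_rpow key (by positivity)
      _ = _ := by
          rw [ENNReal.mul_rpow_of_nonneg _ _ (by positivity), ← ENNReal.rpow_mul,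
            mul_one_div_cancel h0.ne', ENNReal.rpow_one]

/-- The `L^p × L^q → L^s` bound of the paraproduct on families of nice functions. -/
def BddAt {ι : Type} (A : ℝ≥0) (u v w : ℝ → ℂ) (N₁ N₂ NY : (ι → ℝ≥0∞) → ℝ≥0∞)
    (p q s : ℝ≥0∞) : Prop :=
  ∀ (Λ : Finset ℤ) (f g : ι → ℝ → ℂ), (∀ i, Nice (f i)) → (∀ i, Nice (g i)) →
    LqNorm volume s (vn NY fun i => T u v w Λ (f i) (g i)) ≤
      A * LqNorm volume p (vn N₁ f) * LqNorm volume q (vn N₂ g)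

lemma toReal_inv_add {p q s : ℝ≥0∞} (hp : p ≠ 0) (hq : q ≠ 0) (h : s⁻¹ = p⁻¹ + q⁻¹) :
    1 / s.toReal = 1 / p.toReal + 1 / q.toReal := by
  have := congrArg ENNReal.toReal h
  rw [ENNReal.toReal_add (ENNReal.inv_ne_top.2 hp) (ENNReal.inv_ne_top.2 hq),
    ENNReal.toReal_inv, ENNReal.toReal_inv, ENNReal.toReal_inv] at this
  simpa [one_div] using this

lemma volume_lt_le {X : Set ℝ} (hX : MeasurableSet X) {U : ℝ → ℝ≥0∞} (hU : Measurable U) {t : ℝ}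
    (ht : 0 < t) {c : ℝ≥0} (hc : c ≠ 0) {M : ℝ≥0∞} (h : ∫⁻ x in X, U x ^ t ≤ M * (c : ℝ≥0∞) ^ t) :
    volume ({x | (c : ℝ≥0∞) < U x} ∩ X) ≤ M := by
  have hc' : (c : ℝ≥0∞) ≠ 0 := by exact_mod_cast hc
  have hct0 : (c : ℝ≥0∞) ^ t ≠ 0 := by
    rw [Ne, ENNReal.rpow_eq_zero_iff]; simp [hc, ht.not_gt]
  have hctt : (c : ℝ≥0∞) ^ t ≠ ∞ := ENNReal.rpow_ne_top_of_nonneg ht.le ENNReal.coe_ne_top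
  have h1 := mul_meas_ge_le_lintegral₀ (μ := volume.restrict X) (hU.pow_const t).aemeasurable
    ((c : ℝ≥0∞) ^ t)
  have h2 : volume ({x | (c : ℝ≥0∞) < U x} ∩ X) ≤
      (volume.restrict X) {x | (c : ℝ≥0∞) ^ t ≤ U x ^ t} := by
    rw [← Measure.restrict_apply' hX]
    refine measure_mono fun x hx => ?_
    exact ENNReal.rpow_le_rpow (le_of_lt hx) ht.le
  have h3 : (c : ℝ≥0∞) ^ t * volume ({x | (c : ℝ≥0∞) < U x} ∩ X) ≤ (c : ℝ≥0∞) ^ t * M := by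
    calc _ ≤ _ := mul_le_mul_right h2 _
      _ ≤ _ := h1
      _ ≤ _ := h
      _ = _ := mul_comm _ _
  exact (ENNReal.mul_le_mul_iff_right hct0 hctt).1 h3

/-- The standing assumptions on the value spaces and on the kernels of a paraproduct. -/
structure Setting {ι : Type} (t : ℝ) (C : ℝ≥0) (N₁ N₂ NY : (ι → ℝ≥0∞) → ℝ≥0∞) (u v w : ℝ → ℂ) :
    Prop where
  left : MinkNorm N₁
  right : MinkNorm N₂
  out : QNorm t NY
  holder : ∀ a b, NY (fun i => a i * b i) ≤ N₁ a * N₂ b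
  bump_left : Bump C u
  bump_right : Bump C v
  bump_out : Bump C w

lemma Setting.swap {ι : Type} {t : ℝ} {C : ℝ≥0} {N₁ N₂ NY : (ι → ℝ≥0∞) → ℝ≥0∞} {u v w : ℝ → ℂ}
    (H : Setting t C N₁ N₂ NY u v w) : Setting t C N₂ N₁ NY v u w where
  left := H.right
  right := H.left
  out := H.out
  holder a b := by simpa only [mul_comm] using H.holder b a
  bump_left := H.bump_right
  bump_right := H.bump_left
  bump_out := H.bump_out

lemma Setting.measurable {ι : Type} {t : ℝ} {C : ℝ≥0} {N₁ N₂ NY : (ι → ℝ≥0∞) → ℝ≥0∞}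
    {u v w : ℝ → ℂ} (H : Setting t C N₁ N₂ NY u v w) (Λ : Finset ℤ) {f g : ι → ℝ → ℂ}
    (hf : ∀ i, Nice (f i)) (hg : ∀ i, Nice (g i)) :
    Measurable (vn NY fun i => T u v w Λ (f i) (g i)) :=
  measurable_vn H.out.toLatNorm fun i =>
    measurable_T H.bump_left H.bump_right H.bump_out Λ (hf i) (hg i)

lemma dist_ctr_le_of_notMem {S : Set (ℤ × ℤ)} {x : ℝ}
    (hx : x ∉ ⋃ j ∈ stopMax S, Metric.ball (ctr j) (4 * sz j)) {j : ℤ × ℤ} (hj : j ∈ stopMax S) :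
    4 * sz j ≤ |x - ctr j| := by
  by_contra h
  exact hx (Set.mem_iUnion₂.2 ⟨j, hj, by rwa [Metric.mem_ball, Real.dist_eq, ← not_le]⟩)

lemma volume_iUnion_ball_le (S : Set (ℤ × ℤ)) :
    volume (⋃ j ∈ stopMax S, Metric.ball (ctr j) (4 * sz j)) ≤ 8 * volume (stopSet S) := by
  rw [volume_stopSet, ← ENNReal.tsum_mul_left]
  refine (measure_biUnion_le _ (Set.to_countable _) _).trans (ENNReal.tsum_le_tsum fun j => ?_)
  rw [Real.volume_ball, ← mul_assoc, ENNReal.ofReal_mul (by norm_num)]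
  norm_num

lemma volume_stopSet_union_le {F G : ℝ → ℝ≥0∞} (hF : ∫⁻ x, F x ≠ ∞) (hG : ∫⁻ x, G x ≠ ∞)
    {α β : ℝ≥0∞} (hα : α ≠ 0) (hβ : β ≠ 0) (hα' : α ≠ ∞) (hβ' : β ≠ ∞)
    (hS : ∀ x, BddAbove {n | dyAt n x ∈ big F α ∪ big G β}) :
    volume (stopSet (big F α ∪ big G β)) ≤ (∫⁻ x, F x) / α + (∫⁻ x, G x) / β := by
  have hsub : stopSet (big F α ∪ big G β) ⊆ {x | α < Md F x} ∪ {x | β < Md G x} := by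
    intro x hx
    obtain ⟨n, hn | hn⟩ := (mem_stopSet hS).1 hx
    · exact Or.inl ((lt_Md_iff hF hα).2 ((mem_stopSet (bddAbove_big hF hα)).2 ⟨n, hn⟩))
    · exact Or.inr ((lt_Md_iff hG hβ).2 ((mem_stopSet (bddAbove_big hG hβ)).2 ⟨n, hn⟩))
  refine (measure_mono hsub).trans ((measure_union_le _ _).trans (add_le_add ?_ ?_))
  · rw [ENNReal.le_div_iff_mul_le (Or.inl hα) (Or.inl hα'), mul_comm]; exact weak_Md hF hα
  · rw [ENNReal.le_div_iff_mul_le (Or.inl hβ) (Or.inl hβ'), mul_comm]; exact weak_Md hG hβ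

lemma volume_bad_le {t : ℝ} (ht : 1 / 2 < t) (ht1 : t ≤ 1) (C D : ℝ≥0) :
    ∃ K : ℝ≥0, ∀ {ι : Type} {N₁ N₂ NY : (ι → ℝ≥0∞) → ℝ≥0∞} {u v w : ℝ → ℂ},
    Setting t C N₁ N₂ NY u v w → ∀ (Λ : Finset ℤ) (S : Set (ℤ × ℤ)) (n₀ : ℤ) (f g : ι → ℝ → ℂ),
    (∀ i, Nice (f i)) → (∀ i, Nice (g i)) → ∀ α β : ℝ≥0, α ≠ 0 → β ≠ 0 →
    (∀ j ∈ S, j.1 ≤ n₀) → big (vn N₁ f) α ⊆ S →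
    (∀ x ∉ ⋃ j ∈ stopMax S, Metric.ball (ctr j) (4 * sz j),
      ∀ k : ℤ, Pk ((2 : ℝ) ^ k) (vn N₂ g) x ≤ (D * β : ℝ≥0)) →
    volume ({x | ((α * β : ℝ≥0) : ℝ≥0∞) <
        vn NY (fun i => T u v w Λ (fun y => f i y - gd S (f i) y) (g i)) x} ∩
      (⋃ j ∈ stopMax S, Metric.ball (ctr j) (4 * sz j))ᶜ) ≤ K * volume (stopSet S) := by
  obtain ⟨K, hK⟩ := lintegral_bad_le ht ht1 C
  have ht0 : 0 < t := by linarith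
  refine ⟨K * (2 * D) ^ t, ?_⟩
  intro ι N₁ N₂ NY u v w H Λ S n₀ f g hf hg α β hα hβ hS hFS hγ
  have hX : MeasurableSet (⋃ j ∈ stopMax S, Metric.ball (ctr j) (4 * sz j)) :=
    MeasurableSet.biUnion (Set.to_countable _) fun j _ => measurableSet_ball
  have hb : ∀ i, Nice (fun y => f i y - gd S (f i) y) := fun i => (hf i).sub ((hf i).gd hS)
  refine volume_lt_le hX.compl (H.measurable Λ hb hg) ht0 (mul_ne_zero hα hβ) ?_
  refine (hK H.left H.right H.out H.holder H.bump_left H.bump_right H.bump_out Λ S f _ g hf hb hg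
    (fun i x hx => bad_of_notMem hx) (fun i j hj => integral_bad (hf i).integrable hj)
    (fun i j hj => lintegral_bad_part_le (hf i).meas hj) (2 * α) (D * β) _ hX
    (fun j hj => by push_cast; exact av_stopMax_le hFS hj)
    (fun x hx j hj => dist_ctr_le_of_notMem hx hj) hγ).trans (le_of_eq ?_)
  rw [show 2 * α * (D * β) = (2 * D) * (α * β) by ring, ENNReal.coe_mul (2 * D) (α * β),
    ENNReal.mul_rpow_of_nonneg _ _ ht0.le, ENNReal.coe_mul K, ← ENNReal.coe_rpow_of_nonneg _ ht0.le]
  ring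

lemma volume_good_le {ι : Type} {N₁ N₂ NY : (ι → ℝ≥0∞) → ℝ≥0∞} {u v w : ℝ → ℂ} {A t : _}
    {C : ℝ≥0} (H : Setting t C N₁ N₂ NY u v w) {a₁ a₂ a : ℝ≥0∞}
    (h1 : 1 < a₁) (h2 : 1 < a₂) (ha : a ≠ 0) (ha' : a ≠ ∞) (hHa : a⁻¹ = a₁⁻¹ + a₂⁻¹)
    (hB : BddAt A u v w N₁ N₂ NY a₁ a₂ a) (Λ : Finset ℤ) {f g : ι → ℝ → ℂ}
    (hf : ∀ i, Nice (f i)) (hg : ∀ i, Nice (g i)) {α β : ℝ≥0} (hα : α ≠ 0) (hβ : β ≠ 0)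
    {m : ℝ≥0∞} (hfα : ∀ᵐ x, vn N₁ f x ≤ 2 * α) (hfm : ∫⁻ x, vn N₁ f x ≤ α * m)
    (hgβ : ∀ᵐ x, vn N₂ g x ≤ 2 * β) (hgm : ∫⁻ x, vn N₂ g x ≤ β * m) :
    volume {x | ((α * β : ℝ≥0) : ℝ≥0∞) < vn NY (fun i => T u v w Λ (f i) (g i)) x} ≤
      ((4 * A) ^ a.toReal : ℝ≥0) * m := by
  have ha0 : 0 < a.toReal := ENNReal.toReal_pos ha ha'
  have hinv := toReal_inv_add (by positivity) (by positivity) hHa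
  have key := (hB Λ f g hf hg).trans (mul_le_mul' (mul_le_mul' le_rfl
    (LqNorm_le_of_ae_le h1 hα hfα hfm)) (LqNorm_le_of_ae_le h2 hβ hgβ hgm))
  have e : (A : ℝ≥0∞) * (2 * α * m ^ (1 / a₁.toReal)) * (2 * β * m ^ (1 / a₂.toReal)) =
      ((4 * A) * (α * β) : ℝ≥0) * m ^ (1 / a.toReal) := by
    rw [hinv, ENNReal.rpow_add_of_nonneg _ _ (by positivity) (by positivity)]
    push_cast; ring
  rw [e, LqNorm, if_neg ha'] at key
  have key2 := ENNReal.rpow_le_rpow key ha0.le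
  rw [← ENNReal.rpow_mul, one_div_mul_cancel ha0.ne', ENNReal.rpow_one,
    ENNReal.mul_rpow_of_nonneg _ _ ha0.le, ← ENNReal.rpow_mul, one_div_mul_cancel ha0.ne',
    ENNReal.rpow_one] at key2
  have := volume_lt_le MeasurableSet.univ (H.measurable Λ hf hg) ha0 (mul_ne_zero hα hβ)
    (M := ((4 * A) ^ a.toReal : ℝ≥0) * m) (by
      rw [Measure.restrict_univ]
      refine key2.trans (le_of_eq ?_)
      rw [ENNReal.coe_mul (4 * A) (α * β), ENNReal.mul_rpow_of_nonneg _ _ ha0.le,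
        ← ENNReal.coe_rpow_of_nonneg (4 * A) ha0.le]
      ring)
  rwa [Set.inter_univ] at this

lemma vn_T_le_good_bad {ι : Type} {N₁ N₂ NY : (ι → ℝ≥0∞) → ℝ≥0∞} {u v w : ℝ → ℂ} {t : ℝ}
    {C : ℝ≥0} (H : Setting t C N₁ N₂ NY u v w) {τ : ℝ} (hτ : 0 < τ) (hτt : τ ≤ t) (Λ : Finset ℤ)
    {f g f' g' : ι → ℝ → ℂ} (hf : ∀ i, Nice (f i)) (hg : ∀ i, Nice (g i)) (hf' : ∀ i, Nice (f' i))
    (hg' : ∀ i, Nice (g' i)) (x : ℝ) :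
    vn NY (fun i => T u v w Λ (f i) (g i)) x ^ τ ≤
      vn NY (fun i => T u v w Λ (f' i) (g' i)) x ^ τ +
      (vn NY (fun i => T u v w Λ (fun y => f i y - f' i y) (g i)) x ^ τ +
      vn NY (fun i => T v u w Λ (fun y => g i y - g' i y) (f' i)) x ^ τ) := by
  unfold vn
  refine le_trans ?_ ((H.out.subadd' hτ hτt _ _).trans (add_le_add le_rfl
    (H.out.subadd' hτ hτt _ _)))
  refine ENNReal.rpow_le_rpow (H.out.mono fun i => ?_) hτ.le
  refine le_trans (le_of_eq ?_) ((enorm_add_le _ _).trans (add_le_add le_rfl (enorm_add_le _ _)))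
  beta_reduce
  rw [T_sub_left H.bump_left H.bump_right H.bump_out Λ (hf i) (hf' i) (hg i),
    T_swap v u, T_sub_right H.bump_left H.bump_right H.bump_out Λ (hf' i) (hg i) (hg' i)]
  congr 1; ring

/-- The weak-type endpoint estimate: interpolation-free form of `L¹ × L¹ → L^{1/2,∞}`. -/
lemma weak_type {t : ℝ} (ht : 1 / 2 < t) (ht1 : t ≤ 1) (C A : ℝ≥0) {a₁ a₂ a : ℝ≥0∞}
    (h1 : 1 < a₁) (h2 : 1 < a₂) (ha : a ≠ 0) (ha' : a ≠ ∞) (hHa : a⁻¹ = a₁⁻¹ + a₂⁻¹) :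
    ∃ K : ℝ≥0, ∀ {ι : Type} {N₁ N₂ NY : (ι → ℝ≥0∞) → ℝ≥0∞} {u v w : ℝ → ℂ},
    Setting t C N₁ N₂ NY u v w → BddAt A u v w N₁ N₂ NY a₁ a₂ a →
    ∀ (Λ : Finset ℤ) (f g : ι → ℝ → ℂ), (∀ i, Nice (f i)) → (∀ i, Nice (g i)) →
    ∀ α β : ℝ≥0, α ≠ 0 → β ≠ 0 →
    volume {x | ((3 : ℝ≥0) ^ (1 / t) * (α * β) : ℝ≥0) < vn NY (fun i => T u v w Λ (f i) (g i)) x} ≤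
      K * ((∫⁻ x, vn N₁ f x) / α + (∫⁻ x, vn N₂ g x) / β) := by
  have ht0 : 0 < t := by linarith
  obtain ⟨K₁, hK₁⟩ := volume_bad_le ht ht1 C 96
  obtain ⟨K₂, hK₂⟩ := volume_bad_le ht ht1 C (2 * (wInt 4).toNNReal)
  have hw4 : wInt 4 ≠ ∞ := wInt_ne_top (by norm_num)
  refine ⟨8 + (4 * A) ^ a.toReal + K₁ + K₂, ?_⟩
  intro ι N₁ N₂ NY u v w H hB Λ f g hf hg α β hα hβ
  have hα' : (α : ℝ≥0∞) ≠ 0 := by exact_mod_cast hα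
  have hβ' : (β : ℝ≥0∞) ≠ 0 := by exact_mod_cast hβ
  have hF := lintegral_vn_ne_top H.left.toLatNorm hf
  have hG := lintegral_vn_ne_top H.right.toLatNorm hg
  have hGm := measurable_vn H.right.toLatNorm fun i => (hg i).meas
  obtain ⟨n₁, hn₁⟩ := exists_bound_big hF hα'
  obtain ⟨n₂, hn₂⟩ := exists_bound_big hG hβ'
  set S := big (vn N₁ f) α ∪ big (vn N₂ g) β with hS
  set m := (∫⁻ x, vn N₁ f x) / α + (∫⁻ x, vn N₂ g x) / β with hm
  have hSn : ∀ j ∈ S, j.1 ≤ max n₁ n₂ := by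
    rintro j (hj | hj)
    · exact (hn₁ j hj).trans (le_max_left _ _)
    · exact (hn₂ j hj).trans (le_max_right _ _)
  have hSb : ∀ x, BddAbove {n | dyAt n x ∈ S} := fun x => ⟨max n₁ n₂, fun n hn => hSn _ hn⟩
  have hvol : volume (stopSet S) ≤ m :=
    volume_stopSet_union_le hF hG hα' hβ' ENNReal.coe_ne_top ENNReal.coe_ne_top hSb
  have hfg : ∀ i, Nice (gd S (f i)) := fun i => (hf i).gd hSn
  have hgg : ∀ i, Nice (gd S (g i)) := fun i => (hg i).gd hSn
  have haef := ae_vn_gd_le H.left hf hα hSb (Set.subset_union_left)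
  have haeg := ae_vn_gd_le H.right hg hβ hSb (Set.subset_union_right)
  set X := ⋃ j ∈ stopMax S, Metric.ball (ctr j) (4 * sz j) with hX
  have hgood : volume {x | ((α * β : ℝ≥0) : ℝ≥0∞) <
      vn NY (fun i => T u v w Λ (gd S (f i)) (gd S (g i))) x} ≤
      ((4 * A) ^ a.toReal : ℝ≥0) * m := by
    refine volume_good_le H h1 h2 ha ha' hHa hB Λ hfg hgg hα hβ haef ?_ haeg ?_
    · refine (lintegral_vn_gd_le H.left fun i => (hf i).meas).trans ?_
      rw [hm, mul_add, ENNReal.mul_div_cancel hα' ENNReal.coe_ne_top]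
      exact le_self_add
    · refine (lintegral_vn_gd_le H.right fun i => (hg i).meas).trans ?_
      rw [hm, mul_add, ENNReal.mul_div_cancel hβ' ENNReal.coe_ne_top]
      exact le_add_self
  have hbad1 := hK₁ H Λ S _ f g hf hg α β hα hβ hSn Set.subset_union_left (by
    intro x hx k
    refine (Pk_le_M3_self hGm x).trans ?_
    have : M3 (vn N₂ g) x ≤ 3 * β := not_lt.1 fun h =>
      hx (lt_M3_subset hSb Set.subset_union_right h)
    calc 32 * M3 (vn N₂ g) x ≤ 32 * (3 * β) := mul_le_mul_right this _
      _ = _ := by rw [← mul_assoc]; push_cast; norm_num)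
  have hbad2 := hK₂ H.swap Λ S _ g (fun i => gd S (f i)) hg hfg β α hβ hα hSn
    Set.subset_union_right (by
    intro x hx k
    calc Pk ((2 : ℝ) ^ k) (vn N₁ fun i => gd S (f i)) x
        ≤ ∫⁻ y, 2 * α * wt 4 ((2 : ℝ) ^ k) (x - y) := by
          refine lintegral_mono_ae ?_
          filter_upwards [haef] with y hy
          exact mul_le_mul_left hy _
      _ = 2 * α * wInt 4 := by
          rw [lintegral_const_mul' _ _ (by finiteness), lintegral_wt (by positivity)]
          norm_num
      _ = _ := by
          push_cast
          rw [ENNReal.coe_toNNReal hw4]; ring)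
  rw [mul_comm β α] at hbad2
  have hsub : {x | ((3 : ℝ≥0) ^ (1 / t) * (α * β) : ℝ≥0) <
      vn NY (fun i => T u v w Λ (f i) (g i)) x} ⊆ X ∪ ({x | ((α * β : ℝ≥0) : ℝ≥0∞) <
      vn NY (fun i => T u v w Λ (gd S (f i)) (gd S (g i))) x} ∪
      (({x | ((α * β : ℝ≥0) : ℝ≥0∞) <
        vn NY (fun i => T u v w Λ (fun y => f i y - gd S (f i) y) (g i)) x} ∩ Xᶜ) ∪
      ({x | ((α * β : ℝ≥0) : ℝ≥0∞) <
        vn NY (fun i => T v u w Λ (fun y => g i y - gd S (g i) y) (gd S (f i))) x} ∩ Xᶜ))) := by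
    intro x hx
    by_contra hcon
    simp only [Set.mem_union, Set.mem_inter_iff, not_or, Set.mem_compl_iff, not_and_or, not_not,
      Set.mem_ofPred_eq, not_lt] at hcon
    obtain ⟨c0, c1, c2, c3⟩ := hcon
    have c2 := c2.resolve_right c0
    have c3 := c3.resolve_right c0
    have := (vn_T_le_good_bad H ht0 le_rfl Λ hf hg hfg hgg x).trans (add_le_add
      (ENNReal.rpow_le_rpow c1 ht0.le) (add_le_add (ENNReal.rpow_le_rpow c2 ht0.le)
      (ENNReal.rpow_le_rpow c3 ht0.le)))
    have e : ((3 : ℝ≥0) ^ (1 / t) * (α * β) : ℝ≥0) ^ t =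
        (α * β) ^ t + ((α * β) ^ t + (α * β) ^ t) := by
      rw [NNReal.mul_rpow, ← NNReal.rpow_mul, one_div_mul_cancel ht0.ne', NNReal.rpow_one]; ring
    have hlt := ENNReal.rpow_lt_rpow (show _ < _ from hx) ht0
    rw [← ENNReal.coe_rpow_of_nonneg _ ht0.le, e] at hlt
    push_cast at hlt
    rw [← ENNReal.coe_rpow_of_nonneg _ ht0.le] at this
    exact absurd hlt (not_lt.2 this)
  refine (measure_mono hsub).trans ((measure_union_le _ _).trans ?_)
  refine (add_le_add (volume_iUnion_ball_le S) ((measure_union_le _ _).trans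
    (add_le_add hgood ((measure_union_le _ _).trans (add_le_add hbad1 hbad2))))).trans ?_
  calc _ ≤ 8 * m + (((4 * A) ^ a.toReal : ℝ≥0) * m + (K₁ * m + K₂ * m)) :=
        add_le_add (mul_le_mul_right hvol _) (add_le_add le_rfl
          (add_le_add (mul_le_mul_right hvol _) (mul_le_mul_right hvol _)))
    _ = _ := by push_cast; ring

section
variable {ι : Type} {t : ℝ} {C : ℝ≥0} {N₁ N₂ NY : (ι → ℝ≥0∞) → ℝ≥0∞} {u v w : ℝ → ℂ}

lemma Setting.vn_Tk_le (H : Setting t C N₁ N₂ NY u v w) (k : ℤ) {f g : ι → ℝ → ℂ}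
    (hf : ∀ i, Measurable (f i)) (hg : ∀ i, Measurable (g i)) (x : ℝ) :
    vn NY (fun i => Tk u v w k (f i) (g i)) x ≤ (C * C * C * (wInt 2).toNNReal : ℝ≥0) *
      (Pk ((2 : ℝ) ^ k) (vn N₁ f) x * Pk ((2 : ℝ) ^ k) (vn N₂ g) x) := by
  have hw2 : wInt 2 ≠ ∞ := wInt_ne_top (by norm_num)
  refine (H.out.mono fun i => enorm_Tk_le H.bump_left H.bump_right H.bump_out k _ _ x).trans ?_
  rw [H.out.smul (by finiteness)]
  push_cast
  rw [ENNReal.coe_toNNReal hw2]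
  exact mul_le_mul_right ((H.holder _ _).trans
    (mul_le_mul' (H.left.Pk_le hf _ x) (H.right.Pk_le hg _ x))) _

lemma Setting.vn_Tk_sub_le (H : Setting t C N₁ N₂ NY u v w) (k : ℤ) {f g : ι → ℝ → ℂ}
    (hf : ∀ i, Nice (f i)) (hg : ∀ i, Nice (g i)) {x x' : ℝ} (h : (2 : ℝ) ^ k * |x - x'| ≤ 1) :
    NY (fun i => ‖Tk u v w k (f i) (g i) x - Tk u v w k (f i) (g i) x'‖ₑ) ≤
      (C * C * C * (wInt 2).toNNReal : ℝ≥0) * (ENNReal.ofReal ((2 : ℝ) ^ k * |x - x'|) *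
      (Pk ((2 : ℝ) ^ k) (vn N₁ f) x * Pk ((2 : ℝ) ^ k) (vn N₂ g) x)) := by
  have hw2 : wInt 2 ≠ ∞ := wInt_ne_top (by norm_num)
  refine (H.out.mono fun i => enorm_Tk_sub_le H.bump_left H.bump_right H.bump_out k (hf i) (hg i)
    h).trans ?_
  rw [H.out.smul (by finiteness), H.out.smul (by finiteness)]
  push_cast
  rw [ENNReal.coe_toNNReal hw2]
  exact mul_le_mul_right (mul_le_mul_right ((H.holder _ _).trans
    (mul_le_mul' (H.left.Pk_le (fun i => (hf i).meas) _ x)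
      (H.right.Pk_le (fun i => (hg i).meas) _ x))) _) _

lemma Setting.vn_T_eq_zero (H : Setting t C N₁ N₂ NY u v w) (ht : 0 < t) (Λ : Finset ℤ)
    {f g : ι → ℝ → ℂ} (hf : ∀ i, Measurable (f i)) (hg : ∀ i, Measurable (g i))
    (h : ∫⁻ x, vn N₁ f x = 0) (x : ℝ) : vn NY (fun i => T u v w Λ (f i) (g i)) x = 0 := by
  have hP : ∀ k : ℤ, Pk ((2 : ℝ) ^ k) (vn N₁ f) x = 0 := fun k => by
    have h0 := (lintegral_eq_zero_iff (measurable_vn H.left.toLatNorm hf)).1 h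
    refine (lintegral_congr_ae (g := fun _ => 0) ?_).trans (by simp)
    filter_upwards [h0] with y hy
    rw [hy]; simp
  have h1 : ∀ k, vn NY (fun i => Tk u v w k (f i) (g i)) x = 0 := fun k => by
    have := H.vn_Tk_le k hf hg x
    rw [hP, zero_mul, mul_zero] at this
    exact le_antisymm this zero_le
  have h2 := vn_T_rpow_le (u := u) (v := v) (w := w) H.out ht le_rfl Λ f g x
  simp_rw [h1, ENNReal.zero_rpow_of_pos ht] at h2
  rw [Finset.sum_const_zero, nonpos_iff_eq_zero, ENNReal.rpow_eq_zero_iff] at h2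
  rcases h2 with h2 | h2
  · exact h2.1
  · exact absurd h2.2 (not_lt.2 ht.le)

end

lemma lintegral_rpow_quarter_le {U : ℝ → ℝ≥0∞} (hU : Measurable U) (hUt : ∀ x, U x ≠ ∞)
    {L : ℝ≥0} (hL : L ≠ 0) {M : ℝ≥0∞}
    (h : ∀ n : ℕ, volume {x | ((16 ^ n * L : ℝ≥0) : ℝ≥0∞) < U x} ≤ M * (2 ^ (2 * n))⁻¹) (Q : Set ℝ) :
    ∫⁻ x in Q, U x ^ (1 / 4 : ℝ) ≤ (volume Q + 4 * M) * (L : ℝ≥0∞) ^ (1 / 4 : ℝ) := by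
  have e16 : ∀ n : ℕ, ((16 ^ n * L : ℝ≥0) : ℝ≥0∞) ^ (1 / 4 : ℝ) = 2 ^ n * (L : ℝ≥0∞) ^ (1 / 4 : ℝ) := by
    intro n
    rw [ENNReal.coe_mul, ENNReal.mul_rpow_of_nonneg _ _ (by norm_num)]
    congr 1
    rw [show ((16 ^ n : ℝ≥0) : ℝ≥0∞) = ((2 : ℝ≥0∞) ^ n) ^ (4 : ℝ) by
      rw [show (4 : ℝ) = ((4 : ℕ) : ℝ) by norm_num, ENNReal.rpow_natCast, ← pow_mul, mul_comm n 4,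
        pow_mul]
      push_cast; norm_num]
    rw [← ENNReal.rpow_mul]; norm_num
  have hmeas : ∀ n : ℕ, MeasurableSet {x | ((16 ^ n * L : ℝ≥0) : ℝ≥0∞) < U x} := fun n =>
    measurableSet_lt measurable_const hU
  have pt : ∀ x, U x ^ (1 / 4 : ℝ) ≤ (L : ℝ≥0∞) ^ (1 / 4 : ℝ) + ∑' n : ℕ,
      {x | ((16 ^ n * L : ℝ≥0) : ℝ≥0∞) < U x}.indicator
        (fun _ => 2 ^ (n + 1) * (L : ℝ≥0∞) ^ (1 / 4 : ℝ)) x := by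
    intro x
    by_cases hx : U x ≤ L
    · exact (ENNReal.rpow_le_rpow hx (by norm_num)).trans le_self_add
    · have hex : ∃ n : ℕ, U x ≤ ((16 ^ n * L : ℝ≥0) : ℝ≥0∞) := by
        lift U x to ℝ≥0 using hUt x with y
        obtain ⟨n, hn⟩ := pow_unbounded_of_one_lt (y / L) (show (1 : ℝ≥0) < 16 by norm_num)
        refine ⟨n, ?_⟩
        rw [div_lt_iff₀ (pos_iff_ne_zero.2 hL)] at hn
        exact_mod_cast hn.le
      classical
      have hspec := Nat.find_spec hex
      have hmin : ∀ m < Nat.find hex, _ := fun m hm => Nat.find_min hex hm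
      obtain ⟨n, hn⟩ : ∃ n, Nat.find hex = n + 1 := by
        refine Nat.exists_eq_succ_of_ne_zero fun h0 => hx ?_
        rw [h0] at hspec; simpa using hspec
      rw [hn] at hspec
      have hlt := not_le.1 (hmin n (by omega))
      refine le_trans ?_ (le_add_left (ENNReal.le_tsum n))
      rw [Set.indicator_of_mem (show x ∈ {x | ((16 ^ n * L : ℝ≥0) : ℝ≥0∞) < U x} from hlt), ← e16]
      exact ENNReal.rpow_le_rpow hspec (by norm_num)
  calc _ ≤ ∫⁻ x in Q, ((L : ℝ≥0∞) ^ (1 / 4 : ℝ) + ∑' n : ℕ,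
      {x | ((16 ^ n * L : ℝ≥0) : ℝ≥0∞) < U x}.indicator
        (fun _ => 2 ^ (n + 1) * (L : ℝ≥0∞) ^ (1 / 4 : ℝ)) x) := lintegral_mono pt
    _ = (L : ℝ≥0∞) ^ (1 / 4 : ℝ) * volume Q + ∑' n : ℕ, 2 ^ (n + 1) * (L : ℝ≥0∞) ^ (1 / 4 : ℝ) *
        (volume.restrict Q) {x | ((16 ^ n * L : ℝ≥0) : ℝ≥0∞) < U x} := by
        rw [lintegral_add_left measurable_const, setLIntegral_const,
          lintegral_tsum fun n => (measurable_const.indicator (hmeas n)).aemeasurable]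
        simp_rw [lintegral_indicator_const (hmeas _)]
    _ ≤ (L : ℝ≥0∞) ^ (1 / 4 : ℝ) * volume Q + ∑' n : ℕ,
        2 * (L : ℝ≥0∞) ^ (1 / 4 : ℝ) * M * (2⁻¹) ^ n := by
        refine add_le_add le_rfl (ENNReal.tsum_le_tsum fun n => ?_)
        refine (mul_le_mul_right ((Measure.restrict_apply_le _ _).trans (h n)) _).trans
          (le_of_eq ?_)
        have : (2 : ℝ≥0∞) ^ n * (2 ^ (2 * n))⁻¹ = (2⁻¹) ^ n := by
          rw [two_mul, pow_add, ENNReal.mul_inv (by simp) (by simp), ← mul_assoc,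
            ENNReal.mul_inv_cancel (by simp) (by simp), one_mul, ENNReal.inv_pow]
        rw [← this]; ring
    _ = _ := by
        rw [ENNReal.tsum_mul_left, ENNReal.tsum_geometric, ENNReal.one_sub_inv_two, inv_inv]
        ring

/-- Kolmogorov's inequality for the paraproduct. -/
lemma kolmogorov {t : ℝ} (ht : 1 / 2 < t) (ht1 : t ≤ 1) (C A : ℝ≥0) {a₁ a₂ a : ℝ≥0∞}
    (h1 : 1 < a₁) (h2 : 1 < a₂) (ha : a ≠ 0) (ha' : a ≠ ∞) (hHa : a⁻¹ = a₁⁻¹ + a₂⁻¹) :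
    ∃ K : ℝ≥0, ∀ {ι : Type} {N₁ N₂ NY : (ι → ℝ≥0∞) → ℝ≥0∞} {u v w : ℝ → ℂ},
    Setting t C N₁ N₂ NY u v w → BddAt A u v w N₁ N₂ NY a₁ a₂ a →
    ∀ (Λ : Finset ℤ) (f g : ι → ℝ → ℂ), (∀ i, Nice (f i)) → (∀ i, Nice (g i)) →
    ∀ (Q : Set ℝ) (α β : ℝ≥0), ∫⁻ x, vn N₁ f x ≤ α * volume Q → ∫⁻ x, vn N₂ g x ≤ β * volume Q →
    ∫⁻ x in Q, vn NY (fun i => T u v w Λ (f i) (g i)) x ^ (1 / 4 : ℝ) ≤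
      K * volume Q * ((α * β : ℝ≥0) : ℝ≥0∞) ^ (1 / 4 : ℝ) := by
  obtain ⟨K, hK⟩ := weak_type ht ht1 C A h1 h2 ha ha' hHa
  have ht0 : 0 < t := by linarith
  refine ⟨(1 + 8 * K) * ((3 : ℝ≥0) ^ (1 / t)) ^ (1 / 4 : ℝ), ?_⟩
  intro ι N₁ N₂ NY u v w H hB Λ f g hf hg Q α β hα hβ
  by_cases hα0 : α = 0
  · rw [hα0, ENNReal.coe_zero, zero_mul] at hα
    simp_rw [H.vn_T_eq_zero ht0 Λ (fun i => (hf i).meas) (fun i => (hg i).meas) (le_antisymm hα zero_le)]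
    rw [ENNReal.zero_rpow_of_pos (by norm_num)]; simp
  by_cases hβ0 : β = 0
  · rw [hβ0, ENNReal.coe_zero, zero_mul] at hβ
    simp_rw [T_swap u v, H.swap.vn_T_eq_zero ht0 Λ (fun i => (hg i).meas) (fun i => (hf i).meas)
      (le_antisymm hβ zero_le)]
    rw [ENNReal.zero_rpow_of_pos (by norm_num)]; simp
  have h3 : (3 : ℝ≥0) ^ (1 / t) ≠ 0 := by
    rw [Ne, NNReal.rpow_eq_zero_iff]; norm_num
  have := lintegral_rpow_quarter_le (H.measurable Λ hf hg)
    (fun x => H.out.toLatNorm.ne_top fun i => enorm_ne_top)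
    (L := (3 : ℝ≥0) ^ (1 / t) * (α * β)) (mul_ne_zero h3 (mul_ne_zero hα0 hβ0))
    (M := 2 * K * volume Q) (by
      intro n
      have hn : (2 ^ (2 * n) : ℝ≥0) ≠ 0 := by positivity
      have := hK H hB Λ f g hf hg (2 ^ (2 * n) * α) (2 ^ (2 * n) * β) (mul_ne_zero hn hα0)
        (mul_ne_zero hn hβ0)
      rw [show (3 : ℝ≥0) ^ (1 / t) * (2 ^ (2 * n) * α * (2 ^ (2 * n) * β)) =
        16 ^ n * ((3 : ℝ≥0) ^ (1 / t) * (α * β)) by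
          rw [show (16 : ℝ≥0) = 2 ^ 2 * 2 ^ 2 by norm_num, mul_pow, ← pow_mul]; ring] at this
      refine this.trans ?_
      have aux : ∀ (γ : ℝ≥0), γ ≠ 0 → ∀ I : ℝ≥0∞, I ≤ γ * volume Q →
          I / ((2 ^ (2 * n) * γ : ℝ≥0) : ℝ≥0∞) ≤ volume Q * (2 ^ (2 * n))⁻¹ := by
        intro γ hγ I hI
        have hγ' : (γ : ℝ≥0∞) ≠ 0 := by exact_mod_cast hγ
        refine (ENNReal.div_le_div_right hI _).trans (le_of_eq ?_)
        rw [ENNReal.coe_mul, mul_comm ((2 ^ (2 * n) : ℝ≥0) : ℝ≥0∞) γ,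
          ENNReal.mul_div_mul_left _ _ hγ' ENNReal.coe_ne_top, div_eq_mul_inv]
        push_cast; rfl
      calc _ ≤ K * (volume Q * (2 ^ (2 * n))⁻¹ + volume Q * (2 ^ (2 * n))⁻¹) :=
            mul_le_mul_right (add_le_add (aux α hα0 _ hα) (aux β hβ0 _ hβ)) _
        _ = _ := by ring) Q
  refine this.trans (le_of_eq ?_)
  generalize (3 : ℝ≥0) ^ (1 / t) = c
  rw [ENNReal.coe_mul c (α * β), ENNReal.mul_rpow_of_nonneg _ _ (by norm_num),
    ENNReal.coe_mul (1 + 8 * K), ENNReal.coe_rpow_of_nonneg c (by norm_num)]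
  push_cast; ring

lemma wt_four_le {a : ℝ} (ha : 0 < a) (x : ℝ) :
    wt 4 a x ≤ ENNReal.ofReal (a * (1 + a⁻¹) ^ 4) * wt 4 1 x := by
  unfold wt
  rw [← ENNReal.ofReal_mul (by positivity)]
  refine ENNReal.ofReal_le_ofReal ?_
  rw [one_mul, mul_one_div, div_le_div_iff₀ (by positivity) (by positivity), mul_assoc, ← mul_pow]
  gcongr
  have h1 : a⁻¹ * a = 1 := inv_mul_cancel₀ ha.ne'
  have h2 : (1 + a⁻¹) * (1 + a * |x|) = 1 + a⁻¹ + a * |x| + (a⁻¹ * a) * |x| := by ring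
  rw [h2, h1]
  have : 0 < a⁻¹ := by positivity
  have : 0 ≤ a * |x| := by positivity
  linarith

lemma Pk_decay {F : ℝ → ℝ≥0∞} {C : ℝ≥0} (hF : ∀ x, F x ≤ C * wt 8 1 x) {a : ℝ} (ha : 0 < a) :
    ∃ K : ℝ≥0, ∀ x, Pk a F x ≤ K * wt 4 1 x := by
  have hw4 : wInt 4 ≠ ∞ := wInt_ne_top (by norm_num)
  refine ⟨C * Real.toNNReal (a * (1 + a⁻¹) ^ 4) * (wInt 4).toNNReal, fun x => ?_⟩
  have pt : ∀ y, F y * wt 4 a (x - y) ≤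
      (C * ENNReal.ofReal (a * (1 + a⁻¹) ^ 4) * wt 4 1 x) * wt 4 1 (0 - y) := by
    intro y
    have h1 := wt_shift (N := 4) (a := 1) one_pos (x + y) x y
    rw [add_sub_cancel_right, add_sub_cancel_left, one_mul] at h1
    have h2 : wt 8 1 y * ENNReal.ofReal ((1 + |y|) ^ 4) = wt 4 1 (0 - y) := by
      unfold wt
      rw [← ENNReal.ofReal_mul (by positivity), zero_sub, abs_neg, one_mul]
      congr 1
      have : 0 < 1 + |y| := by positivity
      field_simp
    calc F y * wt 4 a (x - y) ≤ (C * wt 8 1 y) * (ENNReal.ofReal (a * (1 + a⁻¹) ^ 4) *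
          (ENNReal.ofReal ((1 + |y|) ^ 4) * wt 4 1 x)) :=
          mul_le_mul' (hF y) ((wt_four_le ha _).trans (mul_le_mul_right h1 _))
      _ = _ := by rw [← h2]; ring
  calc Pk a F x ≤ _ := lintegral_mono pt
    _ = (C * ENNReal.ofReal (a * (1 + a⁻¹) ^ 4) * wt 4 1 x) * wInt 4 := by
        rw [lintegral_const_mul' _ _ (ENNReal.mul_ne_top (by finiteness) (wt_ne_top _ _ _)),
          lintegral_wt one_pos]
        norm_num
    _ = _ := by
        push_cast
        rw [ENNReal.coe_toNNReal hw4, ENNReal.ofReal]; ring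

section
variable {ι : Type} {t : ℝ} {C : ℝ≥0} {N₁ N₂ NY : (ι → ℝ≥0∞) → ℝ≥0∞} {u v w : ℝ → ℂ}

lemma wt_four_mul_self_rpow (x : ℝ) : (wt 4 1 x * wt 4 1 x) ^ (1 / 4 : ℝ) = wt 2 1 x := by
  unfold wt
  rw [← ENNReal.ofReal_mul (by positivity), ENNReal.ofReal_rpow_of_nonneg (by positivity)
    (by norm_num)]
  congr 1
  have h : 0 < 1 + 1 * |x| := by positivity
  rw [show 1 / (1 + 1 * |x|) ^ 4 * (1 / (1 + 1 * |x|) ^ 4) = (1 / (1 + 1 * |x|) ^ 2) ^ (4 : ℝ) by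
    rw [show (4 : ℝ) = ((4 : ℕ) : ℝ) by norm_num, Real.rpow_natCast]; field_simp,
    ← Real.rpow_mul (by positivity)]
  norm_num

lemma Setting.vn_T_decay (H : Setting t C N₁ N₂ NY u v w) (ht : 1 / 2 < t) (Λ : Finset ℤ)
    {f g : ι → ℝ → ℂ} (hf : ∀ i, Nice (f i)) (hg : ∀ i, Nice (g i)) :
    ∃ K : ℝ≥0, ∀ x, vn NY (fun i => T u v w Λ (f i) (g i)) x ^ (1 / 4 : ℝ) ≤ K * wt 2 1 x := by
  obtain ⟨C₁, hC₁⟩ := vn_decay H.left.toLatNorm hf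
  obtain ⟨C₂, hC₂⟩ := vn_decay H.right.toLatNorm hg
  choose K₁ hK₁ using fun k : ℤ => Pk_decay hC₁ (a := (2 : ℝ) ^ k) (by positivity)
  choose K₂ hK₂ using fun k : ℤ => Pk_decay hC₂ (a := (2 : ℝ) ^ k) (by positivity)
  set L : ℝ≥0 := C * C * C * (wInt 2).toNNReal
  refine ⟨∑ k ∈ Λ, (L * (K₁ k * K₂ k)) ^ (1 / 4 : ℝ), fun x => ?_⟩
  refine (vn_T_rpow_le H.out (by norm_num) (by linarith) Λ f g x).trans ?_
  rw [ENNReal.ofNNReal_finsetSum, Finset.sum_mul]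
  refine Finset.sum_le_sum fun k _ => ?_
  rw [← wt_four_mul_self_rpow, ENNReal.coe_rpow_of_nonneg _ (by norm_num),
    ← ENNReal.mul_rpow_of_nonneg _ _ (by norm_num)]
  refine ENNReal.rpow_le_rpow ?_ (by norm_num)
  refine (H.vn_Tk_le k (fun i => (hf i).meas) (fun i => (hg i).meas) x).trans ?_
  calc _ ≤ (L : ℝ≥0∞) * (K₁ k * wt 4 1 x * (K₂ k * wt 4 1 x)) :=
        mul_le_mul_right (mul_le_mul' (hK₁ k x) (hK₂ k x)) _
    _ = _ := by
        rw [ENNReal.coe_mul L (K₁ k * K₂ k)]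
        push_cast; ring

lemma abs_sub_le_sz {j : ℤ × ℤ} {x y : ℝ} (hx : x ∈ dyI j) (hy : y ∈ dyI j) :
    |x - y| ≤ sz j := by
  have hx' : _ ≤ x ∧ x < _ := hx
  have hy' : _ ≤ y ∧ y < _ := hy
  rw [abs_le]
  constructor <;> nlinarith [hx'.1, hx'.2, hy'.1, hy'.2]

lemma sz_le_abs_sub {j : ℤ × ℤ} {x y : ℝ} (hx : x ∈ dyI j) (hy : y ∉ tri j) :
    sz j ≤ |x - y| := by
  have hx' : _ ≤ x ∧ x < _ := hx
  have hy' : ¬ (_ ≤ y ∧ y < _) := hy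
  rw [not_and_or, not_le, not_lt] at hy'
  rcases hy' with h | h
  · exact le_trans (by nlinarith [hx'.1]) (le_abs_self _)
  · exact le_trans (by nlinarith [hx'.2]) (neg_le_abs _)

lemma M3_mono {F G : ℝ → ℝ≥0∞} (h : ∀ x, F x ≤ G x) (x : ℝ) : M3 F x ≤ M3 G x := by
  refine iSup_mono fun j => Set.indicator_le_indicator ?_
  exact ENNReal.div_le_div_right (lintegral_mono h) _

lemma Pk_far_le {j : ℤ × ℤ} (k : ℤ) {F : ℝ → ℝ≥0∞}
    (hF : Measurable F) (h0 : ∀ y ∈ tri j, F y = 0) {x x₀ : ℝ} (hx : x ∈ dyI j) (hx₀ : x₀ ∈ dyI j) :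
    Pk ((2 : ℝ) ^ k) F x ≤ ENNReal.ofReal (16 * (((2 : ℝ) ^ k * sz j)⁻¹) ^ 3) * (512 * M3 F x₀) := by
  have hs : 0 < sz j := sz_pos j
  have hsz : sz j = (2 : ℝ) ^ j.1 := rfl
  have ha0 : ((2 : ℝ) ^ (-j.1)) * sz j = 1 := by
    rw [hsz, ← zpow_add₀ (by norm_num)]; simp
  refine le_trans ?_ (mul_le_mul_right (Pk_le_M3 (k := -j.1) hF (x := x) (x₀ := x₀) ?_) _)
  · unfold Pk
    rw [← lintegral_const_mul' _ _ ENNReal.ofReal_ne_top]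
    refine lintegral_mono fun y => ?_
    by_cases hy : y ∈ tri j
    · simp [h0 y hy]
    · rw [mul_left_comm]
      refine mul_le_mul_right ?_ _
      have hr := sz_le_abs_sub hx hy
      unfold wt
      rw [← ENNReal.ofReal_mul (by positivity)]
      refine ENNReal.ofReal_le_ofReal ?_
      set r := |x - y|
      set b : ℝ := (2 : ℝ) ^ (-j.1) with hb
      have hb0 : 0 < b := by positivity
      set V := (2 : ℝ) ^ k * sz j with hV
      have hV0 : 0 < V := by positivity
      have hkV : (2 : ℝ) ^ k = V * b := by rw [hV, mul_assoc, mul_comm (sz j), ha0, mul_one]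
      rw [hkV]
      have hbr : 1 ≤ b * r := by rw [← ha0]; gcongr
      have h1 : V * (1 + b * r) ≤ 2 * (1 + V * b * r) := by
        have : V * 1 ≤ V * (b * r) := by gcongr
        nlinarith
      have h2 : (V * (1 + b * r)) ^ 4 ≤ (2 * (1 + V * b * r)) ^ 4 := by gcongr
      have h3 : 0 < 1 + V * b * r := by positivity
      have h4 : 0 < 1 + b * r := by positivity
      rw [inv_pow, ← div_eq_mul_inv, div_mul_div_comm, div_le_div_iff₀ (by positivity)
        (by positivity)]
      calc V * b * (V ^ 3 * (1 + b * r) ^ 4) = b * (V * (1 + b * r)) ^ 4 := by ring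
        _ ≤ b * (2 * (1 + V * b * r)) ^ 4 := by gcongr
        _ = _ := by ring
  · calc (2 : ℝ) ^ (-j.1) * |x₀ - x| ≤ (2 : ℝ) ^ (-j.1) * sz j := by
          gcongr; exact abs_sub_le_sz hx₀ hx
      _ = 1 := ha0

lemma Pk_le_mul_M3 {j : ℤ × ℤ} {k : ℤ} (hk : 1 ≤ (2 : ℝ) ^ k * sz j) {F : ℝ → ℝ≥0∞}
    (hF : Measurable F) {x x₀ : ℝ} (hx : x ∈ dyI j) (hx₀ : x₀ ∈ dyI j) :
    Pk ((2 : ℝ) ^ k) F x ≤ ENNReal.ofReal ((2 : ℝ) ^ k * sz j) * (512 * M3 F x₀) := by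
  have hs : 0 < sz j := sz_pos j
  have hsz : sz j = (2 : ℝ) ^ j.1 := rfl
  have ha0 : ((2 : ℝ) ^ (-j.1)) * sz j = 1 := by
    rw [hsz, ← zpow_add₀ (by norm_num)]; simp
  refine le_trans ?_ (mul_le_mul_right (Pk_le_M3 (k := -j.1) hF (x := x) (x₀ := x₀) ?_) _)
  · unfold Pk
    rw [← lintegral_const_mul' _ _ ENNReal.ofReal_ne_top]
    refine lintegral_mono fun y => ?_
    rw [mul_left_comm]
    refine mul_le_mul_right ?_ _
    unfold wt
    rw [← ENNReal.ofReal_mul (by positivity)]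
    refine ENNReal.ofReal_le_ofReal ?_
    set r := |x - y|
    have hr0 : 0 ≤ r := abs_nonneg _
    set b : ℝ := (2 : ℝ) ^ (-j.1) with hb
    have hb0 : 0 < b := by positivity
    set V := (2 : ℝ) ^ k * sz j with hV
    have hkV : (2 : ℝ) ^ k = V * b := by rw [hV, mul_assoc, mul_comm (sz j), ha0, mul_one]
    rw [hkV, ← mul_div_assoc]
    gcongr
    exact le_mul_of_one_le_left hb0.le hk
  · calc (2 : ℝ) ^ (-j.1) * |x₀ - x| ≤ (2 : ℝ) ^ (-j.1) * sz j := by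
          gcongr; exact abs_sub_le_sz hx₀ hx
      _ = 1 := ha0

lemma Setting.vn_Tk_far_le (H : Setting t C N₁ N₂ NY u v w) {j : ℤ × ℤ} {k : ℤ}
    (hk : 1 ≤ (2 : ℝ) ^ k * sz j) {f g : ι → ℝ → ℂ}
    (hf : ∀ i, Measurable (f i)) (hg : ∀ i, Measurable (g i)) (h0 : ∀ i, ∀ y ∈ tri j, f i y = 0)
    {x x₀ : ℝ} (hx : x ∈ dyI j) (hx₀ : x₀ ∈ dyI j) :
    vn NY (fun i => Tk u v w k (f i) (g i)) x ≤
      (C * C * C * (wInt 2).toNNReal * (16 * 512 * 512) : ℝ≥0) *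
      (ENNReal.ofReal (mn ((2 : ℝ) ^ k * sz j)) * (M3 (vn N₁ f) x₀ * M3 (vn N₂ g) x₀)) := by
  have hF0 : ∀ y ∈ tri j, vn N₁ f y = 0 := fun y hy => by
    unfold vn; simp_rw [h0 _ y hy, enorm_zero]; exact H.left.toLatNorm.zero
  set L : ℝ≥0 := C * C * C * (wInt 2).toNNReal with hL
  set V := (2 : ℝ) ^ k * sz j with hV
  have hV0 : 0 < V := by linarith
  have hmn : mn V = V⁻¹ := min_eq_right ((inv_le_one_of_one_le₀ hk).trans hk)
  have hVV : ENNReal.ofReal (16 * V⁻¹ ^ 3) * ENNReal.ofReal V ≤ 16 * ENNReal.ofReal (mn V) := by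
    rw [show (16 : ℝ≥0∞) = ENNReal.ofReal 16 by norm_num, ← ENNReal.ofReal_mul (by positivity),
      ← ENNReal.ofReal_mul (by positivity), hmn]
    refine ENNReal.ofReal_le_ofReal ?_
    have h1 : V⁻¹ ≤ 1 := inv_le_one_of_one_le₀ hk
    calc 16 * V⁻¹ ^ 3 * V = 16 * (V⁻¹ * (V⁻¹ * (V⁻¹ * V))) := by ring
      _ = 16 * (V⁻¹ * V⁻¹) := by rw [inv_mul_cancel₀ hV0.ne', mul_one]
      _ ≤ 16 * (V⁻¹ * 1) := by gcongr
      _ = _ := by ring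
  refine (H.vn_Tk_le k hf hg x).trans ?_
  calc _ ≤ (L : ℝ≥0∞) * ((ENNReal.ofReal (16 * V⁻¹ ^ 3) * (512 * M3 (vn N₁ f) x₀)) *
        (ENNReal.ofReal V * (512 * M3 (vn N₂ g) x₀))) :=
        mul_le_mul_right (mul_le_mul' (Pk_far_le k (measurable_vn H.left.toLatNorm hf) hF0 hx hx₀)
          (Pk_le_mul_M3 hk (measurable_vn H.right.toLatNorm hg) hx hx₀)) _
    _ = (L : ℝ≥0∞) * 512 * 512 * (M3 (vn N₁ f) x₀ * M3 (vn N₂ g) x₀) *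
        (ENNReal.ofReal (16 * V⁻¹ ^ 3) * ENNReal.ofReal V) := by ring
    _ ≤ (L : ℝ≥0∞) * 512 * 512 * (M3 (vn N₁ f) x₀ * M3 (vn N₂ g) x₀) *
        (16 * ENNReal.ofReal (mn V)) := mul_le_mul_right hVV _
    _ = _ := by rw [ENNReal.coe_mul L]; push_cast; ring

lemma Setting.Tk_osc_le (H : Setting t C N₁ N₂ NY u v w) (ht : 1 / 2 < t) {j : ℤ × ℤ} (k : ℤ)
    {f g : ι → ℝ → ℂ} (hf : ∀ i, Nice (f i)) (hg : ∀ i, Nice (g i))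
    (h0 : ∀ i, ∀ y ∈ tri j, f i y = 0)
    {x x' x₀ : ℝ} (hx : x ∈ dyI j) (hx' : x' ∈ dyI j) (hx₀ : x₀ ∈ dyI j) :
    NY (fun i => ‖Tk u v w k (f i) (g i) x - Tk u v w k (f i) (g i) x'‖ₑ) ^ (1 / 4 : ℝ) ≤
      2 * ((C * C * C * (wInt 2).toNNReal * (16 * 512 * 512) : ℝ≥0) *
      (ENNReal.ofReal (mn ((2 : ℝ) ^ k * sz j)) *
        (M3 (vn N₁ f) x₀ * M3 (vn N₂ g) x₀))) ^ (1 / 4 : ℝ) := by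
  rcases le_total 1 ((2 : ℝ) ^ k * sz j) with hk | hk
  · refine (ENNReal.rpow_le_rpow (H.out.mono fun i => enorm_sub_le) (by norm_num)).trans ?_
    refine (H.out.subadd' (τ := 1 / 4) (by norm_num) (by linarith) _ _).trans ?_
    rw [two_mul]
    exact add_le_add
      (ENNReal.rpow_le_rpow (H.vn_Tk_far_le hk (fun i => (hf i).meas) (fun i => (hg i).meas) h0
        hx hx₀) (by norm_num))
      (ENNReal.rpow_le_rpow (H.vn_Tk_far_le hk (fun i => (hf i).meas) (fun i => (hg i).meas) h0
        hx' hx₀) (by norm_num))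
  · have hd : (2 : ℝ) ^ k * |x - x'| ≤ (2 : ℝ) ^ k * sz j := by
      gcongr; exact abs_sub_le_sz hx hx'
    have hd0 : (2 : ℝ) ^ k * |x₀ - x| ≤ 1 := by
      refine le_trans ?_ hk
      gcongr; exact abs_sub_le_sz hx₀ hx
    have hV0 : 0 < (2 : ℝ) ^ k * sz j := mul_pos (by positivity) (sz_pos j)
    have hmn : mn ((2 : ℝ) ^ k * sz j) = (2 : ℝ) ^ k * sz j :=
      min_eq_left (hk.trans ((one_le_inv₀ hV0).2 hk))
    set L : ℝ≥0 := C * C * C * (wInt 2).toNNReal with hL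
    refine le_trans (ENNReal.rpow_le_rpow ?_ (by norm_num))
      (le_mul_of_one_le_left' (by norm_num))
    refine (H.vn_Tk_sub_le k hf hg (hd.trans hk)).trans ?_
    rw [hmn]
    calc _ ≤ (L : ℝ≥0∞) * (ENNReal.ofReal ((2 : ℝ) ^ k * sz j) *
          ((512 * M3 (vn N₁ f) x₀) * (512 * M3 (vn N₂ g) x₀))) :=
          mul_le_mul_right (mul_le_mul' (ENNReal.ofReal_le_ofReal hd) (mul_le_mul'
            (Pk_le_M3 (measurable_vn H.left.toLatNorm fun i => (hf i).meas) hd0)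
            (Pk_le_M3 (measurable_vn H.right.toLatNorm fun i => (hg i).meas) hd0))) _
      _ = ((L * (512 * 512) : ℝ≥0) : ℝ≥0∞) * (ENNReal.ofReal ((2 : ℝ) ^ k * sz j) *
          (M3 (vn N₁ f) x₀ * M3 (vn N₂ g) x₀)) := by rw [ENNReal.coe_mul L]; push_cast; ring
      _ ≤ _ := by
          refine mul_le_mul_left ?_ _
          gcongr
          norm_num

end

lemma Setting.T_osc_le {t : ℝ} (ht : 1 / 2 < t) (C : ℝ≥0) : ∃ K : ℝ≥0,
    ∀ {ι : Type} {N₁ N₂ NY : (ι → ℝ≥0∞) → ℝ≥0∞} {u v w : ℝ → ℂ}, Setting t C N₁ N₂ NY u v w →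
    ∀ (Λ : Finset ℤ) {f g : ι → ℝ → ℂ}, (∀ i, Nice (f i)) → (∀ i, Nice (g i)) → ∀ {j : ℤ × ℤ},
    (∀ i, ∀ y ∈ tri j, f i y = 0) → ∀ x x' x₀ : ℝ, x ∈ dyI j → x' ∈ dyI j → x₀ ∈ dyI j →
    NY (fun i => ‖T u v w Λ (f i) (g i) x - T u v w Λ (f i) (g i) x'‖ₑ) ^ (1 / 4 : ℝ) ≤
      K * (M3 (vn N₁ f) x₀ * M3 (vn N₂ g) x₀) ^ (1 / 4 : ℝ) := by
  obtain ⟨Cm, hCm⟩ := tsum_mn (θ := 1 / 4) (by norm_num)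
  set L : ℝ≥0 := C * C * C * (wInt 2).toNNReal * (16 * 512 * 512) with hL
  refine ⟨2 * L ^ (1 / 4 : ℝ) * Cm, ?_⟩
  intro ι N₁ N₂ NY u v w H Λ f g hf hg j h0 x x' x₀ hx hx' hx₀
  set M := M3 (vn N₁ f) x₀ * M3 (vn N₂ g) x₀
  calc _ ≤ NY (fun i => ∑ k ∈ Λ, ‖Tk u v w k (f i) (g i) x - Tk u v w k (f i) (g i) x'‖ₑ) ^
        (1 / 4 : ℝ) := by
        refine ENNReal.rpow_le_rpow (H.out.mono fun i => ?_) (by norm_num)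
        unfold T
        rw [← Finset.sum_sub_distrib]
        exact enorm_sum_le _ _
    _ ≤ ∑ k ∈ Λ, NY (fun i => ‖Tk u v w k (f i) (g i) x - Tk u v w k (f i) (g i) x'‖ₑ) ^
        (1 / 4 : ℝ) := H.out.sum_le (by norm_num) (by linarith) Λ
          fun k i => ‖Tk u v w k (f i) (g i) x - Tk u v w k (f i) (g i) x'‖ₑ
    _ ≤ ∑ k ∈ Λ, 2 * (L : ℝ≥0∞) ^ (1 / 4 : ℝ) * M ^ (1 / 4 : ℝ) *
        ENNReal.ofReal (mn ((2 : ℝ) ^ k * sz j) ^ (1 / 4 : ℝ)) := by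
        refine Finset.sum_le_sum fun k _ => ?_
        refine (H.Tk_osc_le ht k hf hg h0 hx hx' hx₀).trans (le_of_eq ?_)
        rw [ENNReal.mul_rpow_of_nonneg _ _ (by norm_num), ENNReal.mul_rpow_of_nonneg _ _ (by norm_num),
          ENNReal.ofReal_rpow_of_nonneg (mn_pos (mul_pos (by positivity) (sz_pos j))).le
            (by norm_num)]
        ring
    _ ≤ 2 * (L : ℝ≥0∞) ^ (1 / 4 : ℝ) * M ^ (1 / 4 : ℝ) * Cm := by
        rw [← Finset.mul_sum]
        exact mul_le_mul_right (hCm Λ _ (sz_pos j)) _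
    _ = _ := by
        clear_value L
        rw [ENNReal.coe_mul, ENNReal.coe_mul, ← ENNReal.coe_rpow_of_nonneg L (by norm_num)]
        push_cast; ring

lemma LqNorm_M3_le {p : ℝ≥0∞} (hp : 1 < p) : ∃ C : ℝ≥0, ∀ F : ℝ → ℝ≥0∞, Measurable F →
    ∫⁻ x, F x ≠ ∞ → ∀ K : ℝ≥0, (∀ x, F x ≤ K) →
      LqNorm volume p (M3 F) ≤ C * LqNorm volume p F := by
  by_cases hp' : p = ∞
  · refine ⟨3, fun F _ _ _ _ => ?_⟩
    simp only [LqNorm, hp', if_true]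
    exact essSup_le_of_ae_le _ (Eventually.of_forall fun x =>
      M3_le_of_ae_le (ENNReal.ae_le_essSup F) x)
  · have h1 : 1 < p.toReal := by
      rw [← ENNReal.toReal_one]
      exact (ENNReal.toReal_lt_toReal ENNReal.one_ne_top hp').2 hp
    obtain ⟨C, hC⟩ := lintegral_M3_rpow h1
    refine ⟨C ^ (1 / p.toReal), fun F hF hF1 K hK => ?_⟩
    simp only [LqNorm, hp', if_false]
    rw [ENNReal.coe_rpow_of_nonneg _ (by positivity), ← ENNReal.mul_rpow_of_nonneg _ _ (by positivity)]
    exact ENNReal.rpow_le_rpow (hC F hF hF1 K hK) (by positivity)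

section
variable {ι : Type} {t : ℝ} {C : ℝ≥0} {N N₁ N₂ NY : (ι → ℝ≥0∞) → ℝ≥0∞} {u v w : ℝ → ℂ}

lemma vn_bdd (h : LatNorm N) {f : ι → ℝ → ℂ} (hf : ∀ i, Nice (f i)) :
    ∃ K : ℝ≥0, ∀ x, vn N f x ≤ K := by
  obtain ⟨K, hK⟩ := vn_decay h hf
  refine ⟨K, fun x => (hK x).trans ?_⟩
  calc (K : ℝ≥0∞) * wt 8 1 x ≤ K * ENNReal.ofReal 1 := mul_le_mul_right (wt_le one_pos x) _
    _ = K := by simp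

lemma M3_vn_ne_top (h : LatNorm N) {f : ι → ℝ → ℂ} (hf : ∀ i, Nice (f i)) (x : ℝ) :
    M3 (vn N f) x ≠ ∞ := by
  obtain ⟨K, hK⟩ := vn_bdd h hf
  exact ne_top_of_le_ne_top (by finiteness) (M3_le_of_ae_le (K := K) (Eventually.of_forall hK) x)

lemma QNorm.rpow_add_four_le {τ : ℝ} (h : QNorm t NY) (hτ : 0 < τ) (hτt : τ ≤ t)
    {e a b c d : ι → ℝ≥0∞} (he : ∀ i, e i ≤ a i + (b i + (c i + d i))) :
    NY e ^ τ ≤ NY a ^ τ + (NY b ^ τ + (NY c ^ τ + NY d ^ τ)) :=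
  (ENNReal.rpow_le_rpow (h.mono he) hτ.le).trans <| (h.subadd' hτ hτt _ _).trans <|
    add_le_add le_rfl <| (h.subadd' hτ hτt _ _).trans <| add_le_add le_rfl <| h.subadd' hτ hτt _ _

lemma vn_indicator_tri_le (h : LatNorm N) (f : ι → ℝ → ℂ) {j : ℤ × ℤ} {x₀ : ℝ}
    (hx₀ : x₀ ∈ dyI j) :
    ∫⁻ x, vn N (fun i => (tri j).indicator (f i)) x ≤ M3 (vn N f) x₀ * volume (dyI j) := by
  have : (vn N fun i => (tri j).indicator (f i)) = (tri j).indicator (vn N f) := by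
    funext x
    by_cases hx : x ∈ tri j
    · simp [vn, hx]
    · simp only [vn, hx, not_false_eq_true, Set.indicator_of_notMem, enorm_zero]
      exact h.zero
  rw [this, lintegral_indicator (measurableSet_tri j), volume_dyI, mul_comm]
  exact setLIntegral_tri_le _ (dyI_subset_tri j hx₀)

lemma vn_sub_indicator_le (h : LatNorm N) (f : ι → ℝ → ℂ) (s : Set ℝ) (x : ℝ) :
    vn N (fun i y => f i y - s.indicator (f i) y) x ≤ vn N f x := by
  refine h.mono fun i => ?_
  by_cases hx : x ∈ s <;> simp [hx]

lemma vn_indicator_le (h : LatNorm N) (f : ι → ℝ → ℂ) (s : Set ℝ) (x : ℝ) :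
    vn N (fun i => s.indicator (f i)) x ≤ vn N f x :=
  h.mono fun i => enorm_indicator_le_enorm_self (f i) x

end

lemma Setting.exists_oscillation {t : ℝ} (ht : 1 / 2 < t) (ht1 : t ≤ 1) (C A : ℝ≥0)
    {a₁ a₂ a : ℝ≥0∞} (h1 : 1 < a₁) (h2 : 1 < a₂) (ha : a ≠ 0) (ha' : a ≠ ∞)
    (hHa : a⁻¹ = a₁⁻¹ + a₂⁻¹) :
    ∃ K : ℝ≥0, ∀ {ι : Type} {N₁ N₂ NY : (ι → ℝ≥0∞) → ℝ≥0∞} {u v w : ℝ → ℂ},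
    Setting t C N₁ N₂ NY u v w → BddAt A u v w N₁ N₂ NY a₁ a₂ a →
    ∀ (Λ : Finset ℤ) (f g : ι → ℝ → ℂ), (∀ i, Nice (f i)) → (∀ i, Nice (g i)) → ∀ j : ℤ × ℤ,
    ∃ (c : ℝ≥0∞) (D : ℝ → ℝ≥0∞), Measurable D ∧
      (∀ x ∈ dyI j, vn NY (fun i => T u v w Λ (f i) (g i)) x ^ (1 / 4 : ℝ) ≤ D x + c ∧
        c ≤ D x + vn NY (fun i => T u v w Λ (f i) (g i)) x ^ (1 / 4 : ℝ)) ∧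
      ∀ x₀ ∈ dyI j, ∫⁻ x in dyI j, D x ≤ ENNReal.ofReal (sz j) *
        (K * (M3 (vn N₁ f) x₀ * M3 (vn N₂ g) x₀) ^ (1 / 4 : ℝ)) := by
  obtain ⟨K, hK⟩ := kolmogorov ht ht1 C A h1 h2 ha ha' hHa
  obtain ⟨K', hK'⟩ := Setting.T_osc_le ht C
  refine ⟨K + (K' + K'), ?_⟩
  intro ι N₁ N₂ NY u v w H hB Λ f g hf hg j
  have h4 : (0 : ℝ) < 1 / 4 := by norm_num
  have h4t : 1 / 4 ≤ t := by linarith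
  have hfi : ∀ i, Nice ((tri j).indicator (f i)) := fun i => (hf i).indicator (measurableSet_tri j)
  have hgi : ∀ i, Nice ((tri j).indicator (g i)) := fun i => (hg i).indicator (measurableSet_tri j)
  have hfo : ∀ i, Nice (fun y => f i y - (tri j).indicator (f i) y) := fun i => (hf i).sub (hfi i)
  have hgo : ∀ i, Nice (fun y => g i y - (tri j).indicator (g i) y) := fun i => (hg i).sub (hgi i)
  set P : ι → ℝ → ℂ := fun i => T u v w Λ ((tri j).indicator (f i)) ((tri j).indicator (g i))
    with hP
  set R : ι → ℝ → ℂ := fun i => T u v w Λ (fun y => f i y - (tri j).indicator (f i) y) (g i)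
    with hR
  set Z : ι → ℝ → ℂ := fun i => T v u w Λ (fun y => g i y - (tri j).indicator (g i) y)
    ((tri j).indicator (f i)) with hZ
  have hRm : ∀ i, Measurable (R i) := fun i =>
    measurable_T H.bump_left H.bump_right H.bump_out Λ (hfo i) (hg i)
  have hZm : ∀ i, Measurable (Z i) := fun i =>
    measurable_T H.bump_right H.bump_left H.bump_out Λ (hgo i) (hfi i)
  have hsum : ∀ i x, T u v w Λ (f i) (g i) x = P i x + R i x + Z i x := by
    intro i x
    simp only [hP, hR, hZ]
    rw [T_sub_left H.bump_left H.bump_right H.bump_out Λ (hf i) (hfi i) (hg i),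
      T_swap v u, T_sub_right H.bump_left H.bump_right H.bump_out Λ (hfi i) (hg i) (hgi i)]
    ring
  set y := ctr j
  have hy : y ∈ dyI j := ctr_mem j
  set D₁ : ℝ → ℝ≥0∞ := fun x => vn NY P x ^ (1 / 4 : ℝ) with hD₁
  set D₂ : ℝ → ℝ≥0∞ := fun x => NY (fun i => ‖R i x - R i y‖ₑ) ^ (1 / 4 : ℝ) with hD₂
  set D₃ : ℝ → ℝ≥0∞ := fun x => NY (fun i => ‖Z i x - Z i y‖ₑ) ^ (1 / 4 : ℝ) with hD₃
  have hD₁m : Measurable D₁ := (H.measurable Λ hfi hgi).pow_const _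
  have hD₂m : Measurable D₂ :=
    (H.out.meas fun i => ((hRm i).sub measurable_const).enorm).pow_const _
  have hD₃m : Measurable D₃ :=
    (H.out.meas fun i => ((hZm i).sub measurable_const).enorm).pow_const _
  refine ⟨NY (fun i => ‖R i y + Z i y‖ₑ) ^ (1 / 4 : ℝ), fun x => D₁ x + (D₂ x + D₃ x),
    hD₁m.add (hD₂m.add hD₃m), fun x hx => ⟨?_, ?_⟩, fun x₀ hx₀ => ?_⟩
  · rw [add_assoc, add_assoc]
    refine H.out.rpow_add_four_le h4 h4t fun i => ?_
    have e : T u v w Λ (f i) (g i) x =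
        P i x + ((R i x - R i y) + ((Z i x - Z i y) + (R i y + Z i y))) := by
      rw [hsum]; ring
    beta_reduce; rw [e]
    exact (enorm_add_le _ _).trans (add_le_add le_rfl ((enorm_add_le _ _).trans
      (add_le_add le_rfl (enorm_add_le _ _))))
  · rw [add_assoc, add_assoc]
    refine H.out.rpow_add_four_le h4 h4t fun i => ?_
    have e : R i y + Z i y =
        -P i x + (-(R i x - R i y) + (-(Z i x - Z i y) + T u v w Λ (f i) (g i) x)) := by
      rw [hsum]; ring
    beta_reduce; rw [e]
    refine (enorm_add_le _ _).trans (add_le_add (enorm_neg _).le ((enorm_add_le _ _).trans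
      (add_le_add (enorm_neg _).le ((enorm_add_le _ _).trans (add_le_add (enorm_neg _).le le_rfl)))))
  · have hM₁ := M3_vn_ne_top H.left.toLatNorm hf x₀
    have hM₂ := M3_vn_ne_top H.right.toLatNorm hg x₀
    set M := M3 (vn N₁ f) x₀ * M3 (vn N₂ g) x₀ with hM
    have b1 : ∫⁻ x in dyI j, D₁ x ≤ K * ENNReal.ofReal (sz j) * M ^ (1 / 4 : ℝ) := by
      have := hK H hB Λ _ _ hfi hgi (dyI j) (M3 (vn N₁ f) x₀).toNNReal (M3 (vn N₂ g) x₀).toNNReal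
        (by rw [ENNReal.coe_toNNReal hM₁]; exact vn_indicator_tri_le H.left.toLatNorm f hx₀)
        (by rw [ENNReal.coe_toNNReal hM₂]; exact vn_indicator_tri_le H.right.toLatNorm g hx₀)
      rw [ENNReal.coe_mul (M3 (vn N₁ f) x₀).toNNReal, ENNReal.coe_toNNReal hM₁,
        ENNReal.coe_toNNReal hM₂, volume_dyI] at this
      exact this
    have b2 : ∀ x ∈ dyI j, D₂ x ≤ K' * M ^ (1 / 4 : ℝ) := by
      intro x hx
      refine (hK' H Λ hfo hg (fun i z hz => by simp [hz]) x y x₀ hx hy hx₀).trans ?_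
      refine mul_le_mul_right (ENNReal.rpow_le_rpow (mul_le_mul' (M3_mono (fun z => ?_) _) le_rfl)
        h4.le) _
      exact vn_sub_indicator_le H.left.toLatNorm f _ z
    have b3 : ∀ x ∈ dyI j, D₃ x ≤ K' * M ^ (1 / 4 : ℝ) := by
      intro x hx
      refine (hK' H.swap Λ hgo hfi (fun i z hz => by simp [hz]) x y x₀ hx hy hx₀).trans ?_
      rw [hM, mul_comm (M3 (vn N₁ f) x₀)]
      refine mul_le_mul_right (ENNReal.rpow_le_rpow (mul_le_mul' (M3_mono (fun z => ?_) _)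
        (M3_mono (fun z => ?_) _)) h4.le) _
      · exact vn_sub_indicator_le H.right.toLatNorm g _ z
      · exact vn_indicator_le H.left.toLatNorm f _ z
    rw [lintegral_add_left hD₁m, lintegral_add_left hD₂m]
    calc _ ≤ K * ENNReal.ofReal (sz j) * M ^ (1 / 4 : ℝ) +
          ((∫⁻ x in dyI j, K' * M ^ (1 / 4 : ℝ)) + ∫⁻ x in dyI j, K' * M ^ (1 / 4 : ℝ)) :=
          add_le_add b1 (add_le_add (setLIntegral_mono' (measurableSet_dyI j) b2)
            (setLIntegral_mono' (measurableSet_dyI j) b3))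
      _ = _ := by
          rw [setLIntegral_const, volume_dyI]
          push_cast; ring

/-- A bound at one Hölder triple of exponents self-improves to every admissible triple. -/
lemma extrapolate {t : ℝ} (ht : 1 / 2 < t) (ht1 : t ≤ 1) (C A : ℝ≥0)
    {a₁ a₂ a : ℝ≥0∞} (h1 : 1 < a₁) (h2 : 1 < a₂) (ha : a ≠ 0) (ha' : a ≠ ∞)
    (hHa : a⁻¹ = a₁⁻¹ + a₂⁻¹) {p q s : ℝ≥0∞} (hp : 1 < p) (hq : 1 < q) (hs : 1 / 2 < s)
    (hs' : s < ∞) (hHs : s⁻¹ = p⁻¹ + q⁻¹) :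
    ∃ A' : ℝ≥0, ∀ {ι : Type} {N₁ N₂ NY : (ι → ℝ≥0∞) → ℝ≥0∞} {u v w : ℝ → ℂ},
    Setting t C N₁ N₂ NY u v w → BddAt A u v w N₁ N₂ NY a₁ a₂ a →
    BddAt A' u v w N₁ N₂ NY p q s := by
  obtain ⟨K, hK⟩ := Setting.exists_oscillation ht ht1 C A h1 h2 ha ha' hHa
  have hs0 : s ≠ 0 := ne_bot_of_gt hs
  have hsr : 1 / 2 < s.toReal := by
    have := (ENNReal.toReal_lt_toReal (by finiteness) hs'.ne).2 hs
    simpa using this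
  have hsr0 : 0 < s.toReal := by linarith
  obtain ⟨B, hB⟩ := lintegral_rpow_le_of_oscillation (σ := 4 * s.toReal) (by linarith)
  obtain ⟨Cp, hCp⟩ := LqNorm_M3_le hp
  obtain ⟨Cq, hCq⟩ := LqNorm_M3_le hq
  refine ⟨B ^ (1 / s.toReal) * K ^ (4 : ℝ) * (Cp * Cq), ?_⟩
  intro ι N₁ N₂ NY u v w H hBd Λ f g hf hg
  have hFm := measurable_vn H.left.toLatNorm fun i => (hf i).meas
  have hGm := measurable_vn H.right.toLatNorm fun i => (hg i).meas
  obtain ⟨KF, hKF⟩ := vn_bdd H.left.toLatNorm hf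
  obtain ⟨KG, hKG⟩ := vn_bdd H.right.toLatNorm hg
  set U := vn NY fun i => T u v w Λ (f i) (g i) with hU
  have hUm : Measurable U := H.measurable Λ hf hg
  obtain ⟨KU, hKU⟩ := H.vn_T_decay ht Λ hf hg
  have hUb : ∀ x, U x ^ (1 / 4 : ℝ) ≤ KU := fun x => (hKU x).trans <| by
    calc (KU : ℝ≥0∞) * wt 2 1 x ≤ KU * ENNReal.ofReal 1 := mul_le_mul_right (wt_le one_pos x) _
      _ = KU := by simp
  have hUi : ∫⁻ x, U x ^ (1 / 4 : ℝ) ≠ ∞ := by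
    refine ne_top_of_le_ne_top ?_ (lintegral_mono hKU)
    rw [lintegral_const_mul' _ _ ENNReal.coe_ne_top]
    have := lintegral_wt (N := 2) one_pos 0
    simp_rw [zero_sub, wt_abs] at this
    rw [this]
    exact ENNReal.mul_ne_top ENNReal.coe_ne_top (wInt_ne_top (by norm_num))
  set W : ℝ → ℝ≥0∞ := fun x => M3 (vn N₁ f) x * M3 (vn N₂ g) x with hW
  have key := hB (fun x => U x ^ (1 / 4 : ℝ)) (fun x => K * W x ^ (1 / 4 : ℝ)) (hUm.pow_const _)
    ((((measurable_M3 _).mul (measurable_M3 _)).pow_const _).const_mul _) hUi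
    (fun x => ENNReal.mul_ne_top ENNReal.coe_ne_top (ENNReal.rpow_ne_top_of_nonneg (by norm_num)
      (ENNReal.mul_ne_top (M3_vn_ne_top H.left.toLatNorm hf x)
        (M3_vn_ne_top H.right.toLatNorm hg x)))) KU hUb (hK H hBd Λ f g hf hg)
  have e1 : ∀ z : ℝ≥0∞, (z ^ (1 / 4 : ℝ)) ^ (4 * s.toReal) = z ^ s.toReal := fun z => by
    rw [← ENNReal.rpow_mul]; congr 1; ring
  simp_rw [ENNReal.mul_rpow_of_nonneg _ _ (show 0 ≤ 4 * s.toReal by linarith), e1] at key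
  rw [lintegral_const_mul' _ _ (ENNReal.rpow_ne_top_of_nonneg (by linarith) ENNReal.coe_ne_top)]
    at key
  have key2 : LqNorm volume s U ≤ (B ^ (1 / s.toReal) * K ^ (4 : ℝ) : ℝ≥0) * LqNorm volume s W := by
    simp only [LqNorm, hs'.ne, if_false]
    refine (ENNReal.rpow_le_rpow key (by positivity)).trans (le_of_eq ?_)
    rw [ENNReal.mul_rpow_of_nonneg _ _ (by positivity), ENNReal.mul_rpow_of_nonneg _ _ (by positivity),
      ← ENNReal.rpow_mul, show 4 * s.toReal * (1 / s.toReal) = 4 by field_simp, ENNReal.coe_mul,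
      ENNReal.coe_rpow_of_nonneg _ (by positivity), ENNReal.coe_rpow_of_nonneg _ (by norm_num),
      mul_assoc]
  have key3 : LqNorm volume s W ≤ LqNorm volume p (M3 (vn N₁ f)) * LqNorm volume q (M3 (vn N₂ g)) :=
    LqNorm_holder (by positivity) (by positivity) hs0 hs'.ne hHs (measurable_M3 _).aemeasurable
      (measurable_M3 _).aemeasurable
  calc _ ≤ _ := key2
    _ ≤ (B ^ (1 / s.toReal) * K ^ (4 : ℝ) : ℝ≥0) * ((Cp * LqNorm volume p (vn N₁ f)) *
        (Cq * LqNorm volume q (vn N₂ g))) :=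
        mul_le_mul_right (key3.trans (mul_le_mul'
          (hCp _ hFm (lintegral_vn_ne_top H.left.toLatNorm hf) KF hKF)
          (hCq _ hGm (lintegral_vn_ne_top H.right.toLatNorm hg) KG hKG))) _
    _ = _ := by
        rw [ENNReal.coe_mul (B ^ (1 / s.toReal) * K ^ (4 : ℝ)) (Cp * Cq)]
        push_cast; ring

lemma lintegral_mul_le_sqrt {f g : ℝ → ℝ≥0∞} (hf : Measurable f) (hg : Measurable g) :
    ∫⁻ x, f x * g x ≤ (∫⁻ x, f x ^ 2) ^ (1 / 2 : ℝ) * (∫⁻ x, g x ^ 2) ^ (1 / 2 : ℝ) := by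
  have := ENNReal.lintegral_mul_le_Lp_mul_Lq volume (p := 2) (q := 2) .two_two
    hf.aemeasurable hg.aemeasurable
  simpa using this

lemma sq_rpow_half (a : ℝ≥0∞) : (a ^ (1 / 2 : ℝ)) ^ 2 = a := by
  rw [← ENNReal.rpow_natCast, ← ENNReal.rpow_mul]; norm_num

/-- Young's inequality `‖F ∗ m‖₂ ≤ ‖m‖₁ ‖F‖₂`. -/
lemma lintegral_conv_sq_le {F m : ℝ → ℝ≥0∞} (hF : Measurable F) (hm : Measurable m) :
    ∫⁻ y, (∫⁻ z, F z * m (y - z)) ^ 2 ≤ (∫⁻ x, m x) ^ 2 * ∫⁻ x, F x ^ 2 := by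
  have h1 : ∀ y, (∫⁻ z, F z * m (y - z)) ^ 2 ≤
      (∫⁻ z, F z ^ 2 * m (y - z)) * ∫⁻ x, m x := fun y => by
    have hs : Measurable fun z => m (y - z) ^ (1 / 2 : ℝ) := by fun_prop
    have := lintegral_mul_le_sqrt (hF.mul hs) hs
    simp only [Pi.mul_apply, mul_pow, sq_rpow_half, mul_assoc, ← pow_two] at this
    rw [lintegral_sub_left_eq_self m y] at this
    calc _ ≤ _ := pow_le_pow_left₀ zero_le this 2
      _ = _ := by rw [mul_pow, sq_rpow_half, sq_rpow_half]
  refine (lintegral_mono h1).trans (le_of_eq ?_)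
  rw [lintegral_mul_const _ (by
    refine Measurable.lintegral_prod_right' (f := fun z : ℝ × ℝ => F z.2 ^ 2 * m (z.1 - z.2)) ?_
    fun_prop), lintegral_lintegral_swap (by fun_prop)]
  have : ∀ z, ∫⁻ y, F z ^ 2 * m (y - z) = F z ^ 2 * ∫⁻ x, m x := fun z => by
    rw [lintegral_const_mul _ (by fun_prop), lintegral_sub_right_eq_self m z]
  simp_rw [this]
  rw [lintegral_mul_const _ (by fun_prop)]
  ring

section
variable {C : ℝ≥0} {u v w : ℝ → ℂ}

lemma Bump.lintegral_dil_shift_le (hu : Bump C u) (k : ℤ) (a : ℝ) :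
    ∫⁻ x, ‖dil u k (x + a) - dil u k x‖ₑ ≤
      2 * C * wInt 10 * ENNReal.ofReal ((2 : ℝ) ^ k * |a|) := by
  have e1 : ∫⁻ x, wt 10 ((2 : ℝ) ^ k) x = wInt 10 := by
    have := lintegral_wt (N := 10) (a := (2 : ℝ) ^ k) (by positivity) 0
    simpa only [zero_sub, wt_abs, Nat.cast_ofNat] using this
  have e2 : ∫⁻ x, wt 10 ((2 : ℝ) ^ k) (x + a) = wInt 10 := by
    rw [lintegral_add_right_eq_self (fun x => wt 10 ((2 : ℝ) ^ k) x) a, e1]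
  have hd := (hu.continuous_dil k).measurable
  rcases le_total ((2 : ℝ) ^ k * |a|) 1 with h | h
  · calc ∫⁻ x, ‖dil u k (x + a) - dil u k x‖ₑ
        ≤ ∫⁻ x, C * ENNReal.ofReal ((2 : ℝ) ^ k * |a|) * wt 10 ((2 : ℝ) ^ k) (x + a) :=
          lintegral_mono fun x => by
            have := hu.enorm_dil_sub_le k (a := x + a) (b := x) (by simpa using h)
            simpa using this
      _ = C * ENNReal.ofReal ((2 : ℝ) ^ k * |a|) * wInt 10 := by
          rw [lintegral_const_mul _ (by fun_prop), e2]
      _ ≤ 2 * (C * ENNReal.ofReal ((2 : ℝ) ^ k * |a|) * wInt 10) :=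
          le_mul_of_one_le_left zero_le (by norm_num)
      _ = _ := by ring
  · calc ∫⁻ x, ‖dil u k (x + a) - dil u k x‖ₑ
        ≤ ∫⁻ x, (C * wt 10 ((2 : ℝ) ^ k) (x + a) + C * wt 10 ((2 : ℝ) ^ k) x) :=
          lintegral_mono fun x => enorm_sub_le.trans
            (add_le_add (hu.enorm_dil_le k _) (hu.enorm_dil_le k _))
      _ = 2 * C * wInt 10 * 1 := by
          rw [lintegral_add_left (by fun_prop), lintegral_const_mul _ (by fun_prop),
            lintegral_const_mul _ (by fun_prop), e1, e2]
          ring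
      _ ≤ _ := mul_le_mul_right (by simpa using ENNReal.ofReal_le_ofReal h) _

lemma Bump.lintegral_dil_moment_le (hu : Bump C u) (j k : ℤ) :
    ∫⁻ x, ‖dil u j x‖ₑ * ENNReal.ofReal ((2 : ℝ) ^ k * |x|) ≤
      C * wInt 9 * ENNReal.ofReal ((2 : ℝ) ^ k / (2 : ℝ) ^ j) := by
  have e1 : ∫⁻ x, wt 9 ((2 : ℝ) ^ j) x = wInt 9 := by
    have := lintegral_wt (N := 9) (a := (2 : ℝ) ^ j) (by positivity) 0
    simpa only [zero_sub, wt_abs, Nat.cast_ofNat] using this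
  calc _ ≤ ∫⁻ x, C * ENNReal.ofReal ((2 : ℝ) ^ k / (2 : ℝ) ^ j) * wt 9 ((2 : ℝ) ^ j) x := by
        refine lintegral_mono fun x => (mul_le_mul_left (hu.enorm_dil_le j x) _).trans ?_
        rw [mul_assoc, mul_assoc]
        refine mul_le_mul_right ?_ _
        unfold wt
        rw [← ENNReal.ofReal_mul (by positivity), ← ENNReal.ofReal_mul (by positivity)]
        refine ENNReal.ofReal_le_ofReal ?_
        set a := (2 : ℝ) ^ j with ha
        have ha0 : 0 < a := by positivity
        rw [div_mul_div_comm, div_mul_eq_mul_div, div_le_div_iff₀ (by positivity) (by positivity)]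
        have : a * |x| ≤ 1 + a * |x| := by linarith
        calc a * ((2 : ℝ) ^ k * |x|) * (a * (1 + a * |x|) ^ 9)
            = (2 : ℝ) ^ k * a * (1 + a * |x|) ^ 9 * (a * |x|) := by ring
          _ ≤ (2 : ℝ) ^ k * a * (1 + a * |x|) ^ 9 * (1 + a * |x|) := by gcongr
          _ = _ := by ring
    _ = _ := by
        rw [lintegral_const_mul _ (by fun_prop), e1]; ring

lemma Bump.lintegral_dil_le (hu : Bump C u) (k : ℤ) : ∫⁻ x, ‖dil u k x‖ₑ ≤ C * wInt 10 := by
  have e1 : ∫⁻ x, wt 10 ((2 : ℝ) ^ k) x = wInt 10 := by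
    have := lintegral_wt (N := 10) (a := (2 : ℝ) ^ k) (by positivity) 0
    simpa only [zero_sub, wt_abs, Nat.cast_ofNat] using this
  refine (lintegral_mono fun x => hu.enorm_dil_le k x).trans (le_of_eq ?_)
  rw [lintegral_const_mul _ (by fun_prop), e1]

/-- Bounded integrable functions. -/
structure BddInt (h : ℝ → ℂ) : Prop where
  meas : Measurable h
  int : Integrable h
  bd : ∃ D : ℝ≥0, ∀ x, ‖h x‖ₑ ≤ D

lemma BddInt.sq_ne_top {h : ℝ → ℂ} (hh : BddInt h) : ∫⁻ x, ‖h x‖ₑ ^ 2 ≠ ∞ := by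
  obtain ⟨D, hD⟩ := hh.bd
  refine ne_top_of_le_ne_top (b := D * ∫⁻ x, ‖h x‖ₑ) (ENNReal.mul_ne_top ENNReal.coe_ne_top
    hh.int.2.ne) ?_
  rw [← lintegral_const_mul _ hh.meas.enorm]
  exact lintegral_mono fun x => by
    rw [pow_two]; exact mul_le_mul_left (hD x) _

lemma BddInt.mul_bdd {h F : ℝ → ℂ} (hh : BddInt h) (hF : Measurable F) {D : ℝ≥0}
    (hD : ∀ x, ‖F x‖ₑ ≤ D) : BddInt fun x => F x * h x := by
  refine ⟨hF.mul hh.meas, ?_, ?_⟩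
  · refine hh.int.bdd_mul (c := D) hF.aestronglyMeasurable (Eventually.of_forall fun t => ?_)
    have := hD t
    rwa [enorm_le_coe] at this
  · obtain ⟨D', hD'⟩ := hh.bd
    refine ⟨D * D', fun x => ?_⟩
    rw [enorm_mul, ENNReal.coe_mul]
    exact mul_le_mul' (hD x) (hD' x)

lemma BddInt.conv {h : ℝ → ℂ} (hh : BddInt h) (hu : Bump C u) (k : ℤ) :
    BddInt (conv h (dil u k)) := by
  refine ⟨measurable_conv hh.meas hu k, ?_, ?_⟩
  · exact (hh.int.convolution_integrand (ContinuousLinearMap.mul ℝ ℂ)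
      (hu.integrable_dil k)).integral_prod_left
  · refine ⟨(∫⁻ x, ‖h x‖ₑ).toNNReal * (C * (2 ^ k : ℝ).toNNReal), fun x => ?_⟩
    rw [ENNReal.coe_mul, ENNReal.coe_toNNReal hh.int.2.ne, ← lintegral_mul_const _ hh.meas.enorm]
    refine (enorm_integral_le_lintegral_enorm _).trans (lintegral_mono fun t => ?_)
    rw [enorm_mul]
    exact mul_le_mul_right (hu.enorm_dil_le_const k _) _

lemma integral_conv_mul {h F : ℝ → ℂ} (hh : BddInt h) (hu : Bump C u) (k : ℤ)
    (hF : Measurable F) {D : ℝ≥0} (hD : ∀ x, ‖F x‖ₑ ≤ D) :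
    ∫ x, conv h (dil u k) x * F x = ∫ y, h y * ∫ x, dil u k (x - y) * F x := by
  have hi := hh.int.convolution_integrand (ContinuousLinearMap.mul ℝ ℂ) (hu.integrable_dil k)
  have hi' : Integrable (Function.uncurry fun x y : ℝ => h y * dil u k (x - y) * F x)
      (volume.prod volume) := by
    refine hi.mul_bdd (c := D) (hF.comp measurable_fst).aestronglyMeasurable
      (Eventually.of_forall fun z => ?_)
    have := hD z.1
    rwa [enorm_le_coe] at this
  simp_rw [conv, ← integral_mul_const]
  rw [integral_integral_swap hi']
  refine integral_congr_ae (Eventually.of_forall fun y => ?_)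
  simp_rw [mul_assoc, integral_const_mul]

/-- Almost orthogonality of convolutions with mean-zero bumps at different scales. -/
lemma enorm_integral_conv_conv_le (hu : Bump C u) (hw : Bump C w) (hu0 : ∫ x, u x = 0)
    {h h' : ℝ → ℂ} (hh : BddInt h) (hh' : BddInt h') (j k : ℤ) :
    ‖∫ x, conv h (dil u j) x * (starRingEnd ℂ) (conv h' (dil w k) x)‖ₑ ≤
      (2 * C * wInt 10) * (C * wInt 9) * ENNReal.ofReal ((2 : ℝ) ^ k / (2 : ℝ) ^ j) *
      ((∫⁻ x, ‖h x‖ₑ ^ 2) ^ (1 / 2 : ℝ) * (∫⁻ x, ‖h' x‖ₑ ^ 2) ^ (1 / 2 : ℝ)) := by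
  obtain ⟨D, hD⟩ := (hh'.conv hw k).bd
  have hcm := (hh'.conv hw k).meas
  set F : ℝ → ℂ := fun x => (starRingEnd ℂ) (conv h' (dil w k) x) with hF
  have hFm : Measurable F := Complex.continuous_conj.measurable.comp hcm
  have hFD : ∀ x, ‖F x‖ₑ ≤ D := fun x => by
    simpa [hF, ← ofReal_norm] using hD x
  have hum := (hu.continuous_dil j).measurable
  have hwm := (hw.continuous_dil k).measurable
  rw [integral_conv_mul hh hu j hFm hFD]
  have hu0' : ∀ y, ∫ x, dil u j (x - y) = 0 := fun y => by
    rw [integral_sub_right_eq_self (dil u j) y]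
    unfold dil
    rw [integral_const_mul, Measure.integral_comp_mul_left u, hu0]; simp
  have hinner : ∀ y, ‖∫ x, dil u j (x - y) * F x‖ₑ ≤ ∫⁻ a, ‖dil u j a‖ₑ * ‖F (a + y) - F y‖ₑ := by
    intro y
    have hi1 : Integrable fun x => dil u j (x - y) * F x :=
      ((hu.integrable_dil j).comp_sub_right y).mul_bdd (c := D) hFm.aestronglyMeasurable
        (Eventually.of_forall fun t => by have := hFD t; rwa [enorm_le_coe] at this)
    have e : ∫ x, dil u j (x - y) * F x = ∫ x, dil u j (x - y) * (F x - F y) := by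
      simp_rw [mul_sub]
      rw [integral_sub hi1 (((hu.integrable_dil j).comp_sub_right y).mul_const _),
        integral_mul_const, hu0']
      simp
    rw [e]
    refine (enorm_integral_le_lintegral_enorm _).trans (le_of_eq ?_)
    rw [← lintegral_add_right_eq_self _ y]
    simp [enorm_mul]
  have hdiff : ∀ a, ∫⁻ y, ‖F (a + y) - F y‖ₑ ^ 2 ≤
      (2 * C * wInt 10 * ENNReal.ofReal ((2 : ℝ) ^ k * |a|)) ^ 2 * ∫⁻ x, ‖h' x‖ₑ ^ 2 := by
    intro a
    have h1 : ∀ y, ‖F (a + y) - F y‖ₑ ≤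
        ∫⁻ z, ‖h' z‖ₑ * ‖dil w k (y - z + a) - dil w k (y - z)‖ₑ := fun y => by
      have e : F (a + y) - F y = (starRingEnd ℂ)
          (∫ z, h' z * (dil w k (y - z + a) - dil w k (y - z))) := by
        simp only [hF, ← map_sub]
        congr 1
        unfold conv
        rw [← integral_sub (integrable_mul_shift hh'.int hw k _)
          (integrable_mul_shift hh'.int hw k _)]
        refine integral_congr_ae (Eventually.of_forall fun z => ?_)
        simp only [← mul_sub]
        congr 3; ring
      rw [e, ← ofReal_norm, RCLike.norm_conj, ofReal_norm]
      refine (enorm_integral_le_lintegral_enorm _).trans (le_of_eq ?_)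
      simp_rw [enorm_mul]
    refine (lintegral_mono fun y => pow_le_pow_left₀ zero_le (h1 y) 2).trans ?_
    refine (lintegral_conv_sq_le (m := fun x => ‖dil w k (x + a) - dil w k x‖ₑ) hh'.meas.enorm
      (by fun_prop)).trans ?_
    exact mul_le_mul_left (pow_le_pow_left₀ zero_le (hw.lintegral_dil_shift_le k a) 2) _
  generalize hK : 2 * C * wInt 10 = K at hdiff ⊢
  set b := (∫⁻ x, ‖h x‖ₑ ^ 2) ^ (1 / 2 : ℝ)
  set b' := (∫⁻ x, ‖h' x‖ₑ ^ 2) ^ (1 / 2 : ℝ) with hb'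
  calc _ ≤ ∫⁻ y, ‖h y‖ₑ * ∫⁻ a, ‖dil u j a‖ₑ * ‖F (a + y) - F y‖ₑ := by
        refine (enorm_integral_le_lintegral_enorm _).trans (lintegral_mono fun y => ?_)
        rw [enorm_mul]
        exact mul_le_mul_right (hinner y) _
    _ = ∫⁻ y, ∫⁻ a, ‖h y‖ₑ * (‖dil u j a‖ₑ * ‖F (a + y) - F y‖ₑ) := by
        refine lintegral_congr fun y => ?_
        rw [lintegral_const_mul _ (by fun_prop)]
    _ = ∫⁻ a, ∫⁻ y, ‖h y‖ₑ * (‖dil u j a‖ₑ * ‖F (a + y) - F y‖ₑ) := by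
        have := hh.meas
        rw [lintegral_lintegral_swap (by fun_prop)]
    _ ≤ ∫⁻ a, ‖dil u j a‖ₑ * ENNReal.ofReal ((2 : ℝ) ^ k * |a|) * (K * (b * b')) := by
        refine lintegral_mono fun a => ?_
        have := lintegral_mul_le_sqrt (g := fun y => ‖F (a + y) - F y‖ₑ) hh.meas.enorm
          (by fun_prop)
        have h2 := ENNReal.rpow_le_rpow (hdiff a) (show (0 : ℝ) ≤ 1 / 2 by norm_num)
        rw [ENNReal.mul_rpow_of_nonneg _ _ (by norm_num : (0 : ℝ) ≤ 1 / 2), ← hb',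
          ← ENNReal.rpow_natCast, ← ENNReal.rpow_mul] at h2
        norm_num at h2
        calc _ = ‖dil u j a‖ₑ * ∫⁻ y, ‖h y‖ₑ * ‖F (a + y) - F y‖ₑ := by
              have := hh.meas
              rw [← lintegral_const_mul _ (by fun_prop)]
              exact lintegral_congr fun y => by ring
          _ ≤ ‖dil u j a‖ₑ * (b * (K * ENNReal.ofReal ((2 : ℝ) ^ k * |a|) * b')) := by
              refine mul_le_mul_right (this.trans (mul_le_mul_right ?_ _)) _
              simpa using h2
          _ = _ := by ring
    _ ≤ (C * wInt 9 * ENNReal.ofReal ((2 : ℝ) ^ k / (2 : ℝ) ^ j)) * (K * (b * b')) := by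
        rw [lintegral_mul_const _ (by fun_prop)]
        exact mul_le_mul_left (hu.lintegral_dil_moment_le j k) _
    _ = _ := by ring

end

lemma enorm_star (z : ℂ) : ‖(starRingEnd ℂ) z‖ₑ = ‖z‖ₑ := by
  rw [← ofReal_norm, RCLike.norm_conj, ofReal_norm]

lemma BddInt.integrable_mul_conj {f g : ℝ → ℂ} (hf : BddInt f) (hg : BddInt g) :
    Integrable fun x => f x * (starRingEnd ℂ) (g x) := by
  obtain ⟨D, hD⟩ := hg.bd
  refine hf.int.mul_bdd (c := D) (Complex.continuous_conj.measurable.comp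
    hg.meas).aestronglyMeasurable (Eventually.of_forall fun t => ?_)
  have := hD t
  rw [enorm_le_coe] at this
  rw [RCLike.norm_conj]; exact this

lemma lintegral_enorm_sq {f : ℝ → ℂ} (hf : BddInt f) :
    ∫⁻ x, ‖f x‖ₑ ^ 2 = ‖∫ x, f x * (starRingEnd ℂ) (f x)‖ₑ := by
  have e : ∀ x, f x * (starRingEnd ℂ) (f x) = ((‖f x‖ ^ 2 : ℝ) : ℂ) := fun x => by
    rw [Complex.mul_conj, Complex.normSq_eq_norm_sq]
  have hi := hf.integrable_mul_conj hf
  simp_rw [e] at hi ⊢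
  have hi' : Integrable fun x => ‖f x‖ ^ 2 := by simpa using hi.norm
  rw [integral_complex_ofReal, ← ofReal_norm, Complex.norm_real, Real.norm_of_nonneg
    (integral_nonneg fun x => by positivity), ofReal_integral_eq_lintegral_ofReal hi'
    (Eventually.of_forall fun x => by positivity)]
  refine lintegral_congr fun x => ?_
  rw [ENNReal.ofReal_pow (norm_nonneg _), ofReal_norm]

lemma BddInt.sum {h : ℤ → ℝ → ℂ} (Λ : Finset ℤ) (hh : ∀ k, BddInt (h k)) :
    BddInt fun x => ∑ k ∈ Λ, h k x := by
  refine ⟨Finset.measurable_fun_sum Λ fun k _ => (hh k).meas,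
    integrable_finsetSum _ fun k _ => (hh k).int, ?_⟩
  choose D hD using fun k => (hh k).bd
  refine ⟨∑ k ∈ Λ, D k, fun x => (enorm_sum_le _ _).trans ?_⟩
  push_cast
  exact Finset.sum_le_sum fun k _ => hD k x

/-- Almost orthogonal synthesis: `‖∑ h_k ∗ u_k‖₂² ≲ ∑ ‖h_k‖₂²` for mean-zero `u`. -/
lemma lintegral_sum_conv_sq_le (C : ℝ≥0) : ∃ K : ℝ≥0, ∀ {u : ℝ → ℂ}, Bump C u → ∫ x, u x = 0 →
    ∀ (Λ : Finset ℤ) (h : ℤ → ℝ → ℂ), (∀ k, BddInt (h k)) →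
    ∫⁻ x, ‖∑ k ∈ Λ, conv (h k) (dil u k) x‖ₑ ^ 2 ≤ K * ∑ k ∈ Λ, ∫⁻ x, ‖h k x‖ₑ ^ 2 := by
  obtain ⟨D, hD⟩ := tsum_mn (θ := 1) one_pos
  have hw9 : wInt 9 ≠ ∞ := wInt_ne_top (by norm_num)
  have hw10 : wInt 10 ≠ ∞ := wInt_ne_top (by norm_num)
  set L : ℝ≥0∞ := (2 * C * wInt 10) * (C * wInt 9) with hL
  have hLt : L ≠ ∞ := by finiteness
  refine ⟨L.toNNReal * (2 * D), ?_⟩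
  intro u hu hu0 Λ h hh
  set b : ℤ → ℝ≥0∞ := fun k => (∫⁻ x, ‖h k x‖ₑ ^ 2) ^ (1 / 2 : ℝ) with hb
  have hb2 : ∀ k, ∫⁻ x, ‖h k x‖ₑ ^ 2 = b k ^ 2 := fun k => (sq_rpow_half _).symm
  have hconv : ∀ k, BddInt (conv (h k) (dil u k)) := fun k => (hh k).conv hu k
  set ω : ℤ → ℤ → ℝ≥0∞ := fun j k => ENNReal.ofReal (mn ((2 : ℝ) ^ k * ((2 : ℝ) ^ j)⁻¹)) with hω
  have hωs : ∀ j k, ω j k = ω k j := fun j k => by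
    simp only [hω, mn]
    rw [min_comm]; congr 2 <;> simp
  have hωd : ∀ j, ∑ k ∈ Λ, ω j k ≤ D := fun j => by
    simpa using hD Λ ((2 : ℝ) ^ j)⁻¹ (by positivity)
  have hpair0 : ∀ j k : ℤ, k ≤ j → ‖∫ x, conv (h j) (dil u j) x *
      (starRingEnd ℂ) (conv (h k) (dil u k) x)‖ₑ ≤ L * (ω j k * (b j * b k)) := fun j k hkj => by
    refine (enorm_integral_conv_conv_le hu hu hu0 (hh j) (hh k) j k).trans (le_of_eq ?_)
    have e : mn ((2 : ℝ) ^ k * ((2 : ℝ) ^ j)⁻¹) = (2 : ℝ) ^ k / (2 : ℝ) ^ j := by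
      have h1 : (2 : ℝ) ^ k / (2 : ℝ) ^ j ≤ 1 :=
        div_le_one_of_le₀ (zpow_le_zpow_right₀ (by norm_num) hkj) (by positivity)
      rw [mn, ← div_eq_mul_inv, min_eq_left]
      exact h1.trans ((one_le_inv₀ (by positivity)).2 h1)
    simp only [hω, e, hL, hb, mul_assoc]
  have hpair : ∀ j k : ℤ, ‖∫ x, conv (h j) (dil u j) x *
      (starRingEnd ℂ) (conv (h k) (dil u k) x)‖ₑ ≤ L * (ω j k * (b j * b k)) := fun j k => by
    rcases le_total k j with hkj | hkj
    · exact hpair0 j k hkj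
    · have e : ∫ x, conv (h j) (dil u j) x * (starRingEnd ℂ) (conv (h k) (dil u k) x) =
          (starRingEnd ℂ) (∫ x, conv (h k) (dil u k) x *
            (starRingEnd ℂ) (conv (h j) (dil u j) x)) := by
        rw [← integral_conj]
        refine integral_congr_ae (Eventually.of_forall fun x => ?_)
        simp [mul_comm]
      rw [e, enorm_star, hωs, mul_comm (b j)]
      exact hpair0 k j hkj
  calc ∫⁻ x, ‖∑ k ∈ Λ, conv (h k) (dil u k) x‖ₑ ^ 2
      = ‖∑ j ∈ Λ, ∑ k ∈ Λ, ∫ x, conv (h j) (dil u j) x *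
          (starRingEnd ℂ) (conv (h k) (dil u k) x)‖ₑ := by
        rw [lintegral_enorm_sq (BddInt.sum Λ hconv)]
        congr 1
        simp_rw [map_sum, Finset.sum_mul_sum]
        rw [integral_finsetSum _ fun j _ => integrable_finsetSum _ fun k _ =>
          (hconv j).integrable_mul_conj (hconv k)]
        refine Finset.sum_congr rfl fun j _ => ?_
        rw [integral_finsetSum _ fun k _ => (hconv j).integrable_mul_conj (hconv k)]
    _ ≤ ∑ j ∈ Λ, ∑ k ∈ Λ, L * (ω j k * b j ^ 2 + ω j k * b k ^ 2) := by
        refine (enorm_sum_le _ _).trans (Finset.sum_le_sum fun j _ => ?_)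
        refine (enorm_sum_le _ _).trans (Finset.sum_le_sum fun k _ => (hpair j k).trans ?_)
        rw [← mul_add]
        refine mul_le_mul_right (mul_le_mul_right ?_ _) _
        rcases le_total (b j) (b k) with hjk | hjk
        · exact (mul_le_mul_left hjk _).trans (by rw [← pow_two]; exact le_add_self)
        · exact (mul_le_mul_right hjk _).trans (by rw [← pow_two]; exact le_self_add)
    _ = L * (∑ j ∈ Λ, (∑ k ∈ Λ, ω j k) * b j ^ 2 + ∑ k ∈ Λ, (∑ j ∈ Λ, ω k j) * b k ^ 2) := by
        simp_rw [← Finset.mul_sum, Finset.sum_add_distrib, Finset.sum_mul]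
        congr 2
        rw [Finset.sum_comm]
        exact Finset.sum_congr rfl fun k _ => Finset.sum_congr rfl fun j _ => by rw [hωs]
    _ ≤ L * (∑ j ∈ Λ, D * b j ^ 2 + ∑ k ∈ Λ, D * b k ^ 2) := by
        refine mul_le_mul_right (add_le_add ?_ ?_) _ <;>
          exact Finset.sum_le_sum fun j _ => mul_le_mul_left (hωd j) _
    _ = _ := by
        rw [ENNReal.coe_mul, ENNReal.coe_toNNReal hLt, ← Finset.mul_sum]
        simp_rw [hb2]
        push_cast; ring

lemma Bump.conj_neg {C : ℝ≥0} {u : ℝ → ℂ} (hu : Bump C u) :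
    Bump C fun x => (starRingEnd ℂ) (u (-x)) where
  cont := Complex.continuous_conj.comp (hu.cont.comp continuous_neg)
  bd x := by rw [enorm_star, ← wt_abs]; exact hu.bd _
  lip a b h := by
    have e : |-a - -b| = |a - b| := by rw [← abs_neg]; congr 1; ring
    have := hu.lip (-a) (-b) (by rwa [e])
    rw [e, wt_abs] at this
    rwa [← map_sub, enorm_star]

/-- Littlewood–Paley square function bound on `L²`. -/
lemma sum_lintegral_conv_sq_le (C : ℝ≥0) : ∃ K : ℝ≥0, ∀ {u : ℝ → ℂ}, Bump C u → ∫ x, u x = 0 →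
    ∀ (Λ : Finset ℤ) (g : ℝ → ℂ), BddInt g →
    ∑ k ∈ Λ, ∫⁻ x, ‖conv g (dil u k) x‖ₑ ^ 2 ≤ K * ∫⁻ x, ‖g x‖ₑ ^ 2 := by
  obtain ⟨K, hK⟩ := lintegral_sum_conv_sq_le C
  refine ⟨K, ?_⟩
  intro u hu hu0 Λ g hg
  set u' : ℝ → ℂ := fun x => (starRingEnd ℂ) (u (-x)) with hu'
  have hu'0 : ∫ x, u' x = 0 := by
    rw [hu', integral_conj, integral_neg_eq_self (fun x => u x), hu0]; simp
  have hG : ∀ k, BddInt (conv g (dil u k)) := fun k => hg.conv hu k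
  have hGG : ∀ k, BddInt (conv (conv g (dil u k)) (dil u' k)) := fun k => (hG k).conv hu.conj_neg k
  have h2 := hK hu.conj_neg hu'0 Λ _ hG
  set S := ∑ k ∈ Λ, ∫⁻ x, ‖conv g (dil u k) x‖ₑ ^ 2 with hS
  have hSt : S ≠ ∞ := by
    rw [hS]; exact (ENNReal.sum_lt_top.2 fun k _ => (hG k).sq_ne_top.lt_top).ne
  have e1 : ∀ k, ∫ x, conv g (dil u k) x * (starRingEnd ℂ) (conv g (dil u k) x) =
      ∫ y, g y * (starRingEnd ℂ) (conv (conv g (dil u k)) (dil u' k) y) := fun k => by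
    obtain ⟨D, hD⟩ := (hG k).bd
    refine (integral_conv_mul hg hu k (F := fun x => (starRingEnd ℂ) (conv g (dil u k) x))
      (Complex.continuous_conj.measurable.comp (hG k).meas) (D := D)
      (fun x => by simpa [enorm_star] using hD x)).trans ?_
    refine integral_congr_ae (Eventually.of_forall fun y => ?_)
    beta_reduce
    congr 1
    conv_rhs => rw [conv, ← integral_conj]
    refine integral_congr_ae (Eventually.of_forall fun x => ?_)
    simp only [dil, hu', map_mul, map_zpow₀, Complex.conj_conj, Complex.conj_ofNat]
    rw [show -((2 : ℝ) ^ k * (y - x)) = (2 : ℝ) ^ k * (x - y) by ring]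
    ring
  have e2 : S = ENNReal.ofReal (‖∑ k ∈ Λ, ∫ x, conv g (dil u k) x *
      (starRingEnd ℂ) (conv g (dil u k) x)‖) := by
    have h3 : ∀ k, ∫ x, conv g (dil u k) x * (starRingEnd ℂ) (conv g (dil u k) x) =
        ((∫ x, ‖conv g (dil u k) x‖ ^ 2 : ℝ) : ℂ) := fun k => by
      rw [← integral_complex_ofReal]
      refine integral_congr_ae (Eventually.of_forall fun x => ?_)
      simp only [Complex.mul_conj, Complex.normSq_eq_norm_sq]
    have h4 : ∀ k, 0 ≤ ∫ x, ‖conv g (dil u k) x‖ ^ 2 := fun k => integral_nonneg fun x => by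
      positivity
    simp_rw [h3]
    rw [← Complex.ofReal_sum, Complex.norm_real, Real.norm_of_nonneg (Finset.sum_nonneg fun k _ =>
      h4 k), ENNReal.ofReal_sum_of_nonneg fun k _ => h4 k, hS]
    refine Finset.sum_congr rfl fun k _ => ?_
    rw [lintegral_enorm_sq (hG k), h3, ← ofReal_norm, Complex.norm_real, Real.norm_of_nonneg (h4 k)]
  have key : S ≤ (∫⁻ x, ‖g x‖ₑ ^ 2) ^ (1 / 2 : ℝ) * (K * S) ^ (1 / 2 : ℝ) := by
    calc S = ‖∫ y, g y * (starRingEnd ℂ)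
          (∑ k ∈ Λ, conv (conv g (dil u k)) (dil u' k) y)‖ₑ := by
          rw [e2, ofReal_norm]
          congr 1
          simp_rw [e1, map_sum, Finset.mul_sum]
          rw [integral_finsetSum _ fun k _ => hg.integrable_mul_conj (hGG k)]
      _ ≤ ∫⁻ y, ‖g y‖ₑ * ‖∑ k ∈ Λ, conv (conv g (dil u k)) (dil u' k) y‖ₑ := by
          refine (enorm_integral_le_lintegral_enorm _).trans (le_of_eq ?_)
          simp_rw [enorm_mul, enorm_star]
      _ ≤ _ := (lintegral_mul_le_sqrt hg.meas.enorm (BddInt.sum Λ hGG).meas.enorm).trans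
          (mul_le_mul_right (ENNReal.rpow_le_rpow h2 (by norm_num)) _)
  have key2 : S * S ≤ K * (∫⁻ x, ‖g x‖ₑ ^ 2) * S := by
    calc S * S = S ^ 2 := (pow_two _).symm
      _ ≤ _ := pow_le_pow_left₀ zero_le key 2
      _ = _ := by rw [mul_pow, sq_rpow_half, sq_rpow_half]; ring
  rcases eq_or_ne S 0 with h0 | h0
  · rw [h0]; exact zero_le
  · exact (ENNReal.mul_le_mul_iff_left h0 hSt).1 key2

lemma Nice.bddInt {f : ℝ → ℂ} (hf : Nice f) : BddInt f := ⟨hf.meas, hf.integrable, hf.bdd⟩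

/-- The scalar `L^∞ × L² → L²` bound. -/
lemma bddAt_top_two_two (C : ℝ≥0) : ∃ A : ℝ≥0, ∀ {u v w : ℝ → ℂ}, Bump C u → Bump C v →
    Bump C w → ∫ x, v x = 0 → ∫ x, w x = 0 →
    BddAt A u v w (fun a : Unit → ℝ≥0∞ => a ()) (fun a => a ()) (fun a => a ()) ∞ 2 2 := by
  obtain ⟨K, hK⟩ := lintegral_sum_conv_sq_le C
  obtain ⟨K', hK'⟩ := sum_lintegral_conv_sq_le C
  have hw10 : wInt 10 ≠ ∞ := wInt_ne_top (by norm_num)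
  refine ⟨K ^ (1 / 2 : ℝ) * K' ^ (1 / 2 : ℝ) * (C * (wInt 10).toNNReal), ?_⟩
  intro u v w hu hv hw hv0 hw0 Λ f g hf hg
  set F := f ()
  set G := g ()
  have hF : BddInt F := (hf ()).bddInt
  have hG : BddInt G := (hg ()).bddInt
  set m := essSup (fun x => ‖F x‖ₑ) volume with hm
  have hmt : m ≠ ∞ := by
    obtain ⟨D, hD⟩ := hF.bd
    exact ne_top_of_le_ne_top ENNReal.coe_ne_top (essSup_le_of_ae_le _ (Eventually.of_forall hD))
  have hconv : ∀ k x, ‖conv F (dil u k) x‖ₑ ≤ (C * wInt 10) * m := fun k x => by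
    have hd := (hu.continuous_dil k).measurable
    calc _ ≤ ∫⁻ t, ‖F t * dil u k (x - t)‖ₑ := enorm_integral_le_lintegral_enorm _
      _ ≤ ∫⁻ t, m * ‖dil u k (x - t)‖ₑ := by
          refine lintegral_mono_ae ?_
          filter_upwards [ENNReal.ae_le_essSup fun x => ‖F x‖ₑ] with t ht
          rw [enorm_mul]; exact mul_le_mul_left ht _
      _ = m * ∫⁻ t, ‖dil u k t‖ₑ := by
          rw [lintegral_const_mul _ (by fun_prop),
            lintegral_sub_left_eq_self (fun t => ‖dil u k t‖ₑ) x]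
      _ ≤ m * (C * wInt 10) := mul_le_mul_right (hu.lintegral_dil_le k) _
      _ = _ := mul_comm _ _
  have hGk : ∀ k, BddInt (conv G (dil v k)) := fun k => hG.conv hv k
  have hh : ∀ k, BddInt fun y => conv F (dil u k) y * conv G (dil v k) y := fun k => by
    obtain ⟨D, hD⟩ := (hF.conv hu k).bd
    exact (hGk k).mul_bdd (hF.conv hu k).meas hD
  have h1 := hK hw hw0 Λ _ hh
  have h2 := hK' hv hv0 Λ G hG
  have h3 : ∫⁻ x, ‖T u v w Λ F G x‖ₑ ^ 2 ≤
      K * K' * (C * wInt 10 * m) ^ 2 * ∫⁻ x, ‖G x‖ₑ ^ 2 := by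
    calc _ ≤ _ := h1
      _ ≤ K * ∑ k ∈ Λ, (C * wInt 10 * m) ^ 2 * ∫⁻ x, ‖conv G (dil v k) x‖ₑ ^ 2 := by
          refine mul_le_mul_right (Finset.sum_le_sum fun k _ => ?_) _
          have := (hGk k).meas
          rw [← lintegral_const_mul _ (by fun_prop)]
          refine lintegral_mono fun x => ?_
          rw [enorm_mul, mul_pow]
          exact mul_le_mul_left (pow_le_pow_left₀ zero_le (hconv k x) 2) _
      _ ≤ K * ((C * wInt 10 * m) ^ 2 * (K' * ∫⁻ x, ‖G x‖ₑ ^ 2)) := by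
          rw [← Finset.mul_sum]
          exact mul_le_mul_right (mul_le_mul_right h2 _) _
      _ = _ := by ring
  have eF : LqNorm volume ∞ (vn (fun a : Unit → ℝ≥0∞ => a ()) f) = m := by
    simp only [LqNorm, if_true]; rfl
  have e2 : ∀ h : ℝ → ℂ, LqNorm volume 2 (fun x => ‖h x‖ₑ) =
      (∫⁻ x, ‖h x‖ₑ ^ 2) ^ (1 / 2 : ℝ) := fun h => by simp [LqNorm]
  rw [eF]
  change LqNorm volume 2 (fun x => ‖T u v w Λ F G x‖ₑ) ≤ _ * _ * LqNorm volume 2 fun x => ‖G x‖ₑ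
  rw [e2, e2]
  refine (ENNReal.rpow_le_rpow h3 (by norm_num)).trans (le_of_eq ?_)
  have hn : (0 : ℝ) ≤ 1 / 2 := by norm_num
  rw [ENNReal.mul_rpow_of_nonneg _ _ hn, ENNReal.mul_rpow_of_nonneg _ _ hn,
    ENNReal.mul_rpow_of_nonneg _ _ hn, ← ENNReal.rpow_natCast (C * wInt 10 * m),
    ← ENNReal.rpow_mul, show ((2 : ℕ) : ℝ) * (1 / 2) = 1 by norm_num, ENNReal.rpow_one,
    ENNReal.coe_mul, ENNReal.coe_mul, ENNReal.coe_mul, ENNReal.coe_toNNReal hw10,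
    ENNReal.coe_rpow_of_nonneg _ hn, ENNReal.coe_rpow_of_nonneg _ hn]
  ring

/-- Bounds at a Hölder triple `(a₁, a₂, a)` transfer to the `ℓ^{a₁}`, `ℓ^{a₂}`, `ℓ^a` extensions
by applying them entrywise. -/
lemma BddAt.ell {ι : Type} {A : ℝ≥0} {u v w : ℝ → ℂ} {C : ℝ≥0} {t : ℝ}
    {N₁ N₂ NY : (ι → ℝ≥0∞) → ℝ≥0∞} {a₁ a₂ a : ℝ≥0∞} (hB : BddAt A u v w N₁ N₂ NY a₁ a₂ a)
    (H : Setting t C N₁ N₂ NY u v w)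
    (h1 : a₁ ≠ 0) (h2 : a₂ ≠ 0) (ha : a ≠ 0) (ha' : a ≠ ∞) (hHa : a⁻¹ = a₁⁻¹ + a₂⁻¹) (n : ℕ) :
    BddAt A u v w (ellComp a₁ n N₁) (ellComp a₂ n N₂) (ellComp a n NY) a₁ a₂ a := by
  intro Λ f g hf hg
  calc LqNorm volume a (vn (ellComp a n NY) fun i => T u v w Λ (f i) (g i))
      = ellN a n fun k => LqNorm volume a (vn NY fun i => T u v w Λ (f (k, i)) (g (k, i))) :=
        LqNorm_ellN ha ha' n (F := fun k => vn NY fun i => T u v w Λ (f (k, i)) (g (k, i)))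
          fun k => H.measurable Λ (fun i => hf (k, i)) fun i => hg (k, i)
    _ ≤ ellN a n fun k => A * (LqNorm volume a₁ (vn N₁ fun i => f (k, i)) *
          LqNorm volume a₂ (vn N₂ fun i => g (k, i))) :=
        ellN_mono fun k => (hB Λ _ _ (fun i => hf (k, i)) fun i => hg (k, i)).trans
          (mul_assoc _ _ _).le
    _ ≤ A * ((ellN a₁ n fun k => LqNorm volume a₁ (vn N₁ fun i => f (k, i))) *
          ellN a₂ n fun k => LqNorm volume a₂ (vn N₂ fun i => g (k, i))) := by
        rw [ellN_const_mul ha ENNReal.coe_ne_top]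
        exact mul_le_mul_right (ellN_holder h1 h2 ha ha' hHa n _ _) _
    _ ≤ A * (LqNorm volume a₁ (vn (ellComp a₁ n N₁) f) *
          LqNorm volume a₂ (vn (ellComp a₂ n N₂) g)) :=
        mul_le_mul_right (mul_le_mul'
          (ellN_LqNorm_le h1 n fun k => measurable_vn H.left.toLatNorm fun i => (hf (k, i)).meas)
          (ellN_LqNorm_le h2 n fun k =>
            measurable_vn H.right.toLatNorm fun i => (hg (k, i)).meas)) _
    _ = _ := (mul_assoc _ _ _).symm

lemma Setting.ell {ι : Type} {u v w : ℝ → ℂ} {C : ℝ≥0} {t : ℝ} (ht : 0 < t)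
    {N₁ N₂ NY : (ι → ℝ≥0∞) → ℝ≥0∞} (H : Setting t C N₁ N₂ NY u v w) {a₁ a₂ a : ℝ≥0∞}
    (h1 : 1 < a₁) (h2 : 1 < a₂) (ha' : a ≠ ∞) (hta : t ≤ a.toReal) (hHa : a⁻¹ = a₁⁻¹ + a₂⁻¹)
    (n : ℕ) : Setting t C (ellComp a₁ n N₁) (ellComp a₂ n N₂) (ellComp a n NY) u v w where
  left := H.left.ell h1 n
  right := H.right.ell h2 n
  out := H.out.ell ht ha' hta n
  holder := ellComp_holder H.holder (zero_lt_one.trans h1).ne' (zero_lt_one.trans h2).ne'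
    (by rintro rfl; simp at hta; linarith) ha' hHa n
  bump_left := H.bump_left
  bump_right := H.bump_right
  bump_out := H.bump_out

lemma schwartz_decay (f : SchwartzMap ℝ ℂ) (N : ℕ) : ∃ C : ℝ≥0, ∀ x,
    ‖f x‖ ≤ C / (1 + |x|) ^ N ∧ ‖deriv f x‖ ≤ C / (1 + |x|) ^ N := by
  set D : ℝ := 2 ^ N * (Finset.Iic (N, 1)).sup
    (fun m => SchwartzMap.seminorm ℝ m.1 m.2) f with hD
  have key : ∀ n ≤ 1, ∀ x, (1 + |x|) ^ N * ‖iteratedFDeriv ℝ n f x‖ ≤ D := fun n hn x =>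
    SchwartzMap.one_add_le_sup_seminorm_apply (𝕜 := ℝ) (m := (N, 1)) (k := N) (n := n) le_rfl hn
      f x
  refine ⟨D.toNNReal, fun x => ?_⟩
  have hx : 0 < (1 + |x|) ^ N := by positivity
  have h0 := key 0 (by norm_num) x
  have h1 := key 1 le_rfl x
  rw [norm_iteratedFDeriv_zero] at h0
  rw [norm_iteratedFDeriv_one, ← norm_deriv_eq_norm_fderiv] at h1
  rw [le_div_iff₀' hx, le_div_iff₀' hx]
  exact ⟨h0.trans (Real.le_coe_toNNReal D), h1.trans (Real.le_coe_toNNReal D)⟩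

lemma wt_one_eq (N : ℕ) (C : ℝ≥0) (x : ℝ) :
    (C : ℝ≥0∞) * wt N 1 x = ENNReal.ofReal (C / (1 + |x|) ^ N) := by
  unfold wt
  rw [← ENNReal.ofReal_coe_nnreal, ← ENNReal.ofReal_mul (by positivity), one_mul, mul_one_div]

lemma schwartz_nice (f : SchwartzMap ℝ ℂ) : Nice f := by
  obtain ⟨C, hC⟩ := schwartz_decay f 8
  refine ⟨f.continuous.measurable, C, fun x => ?_⟩
  rw [wt_one_eq, ← ofReal_norm]
  exact ENNReal.ofReal_le_ofReal (hC x).1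

lemma schwartz_bump (f : SchwartzMap ℝ ℂ) : ∃ C : ℝ≥0, Bump C f := by
  obtain ⟨C, hC⟩ := schwartz_decay f 10
  refine ⟨2 ^ 10 * C, f.continuous, fun x => ?_, fun a b hab => ?_⟩
  · rw [wt_one_eq, ← ofReal_norm]
    refine ENNReal.ofReal_le_ofReal ((hC x).1.trans ?_)
    push_cast
    gcongr
    have : (0 : ℝ) ≤ C := C.2
    linarith
  · have hseg : ∀ x ∈ Set.uIcc b a, ‖deriv f x‖ ≤ 2 ^ 10 * C / (1 + |a|) ^ 10 := by
      intro x hx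
      refine (hC x).2.trans ?_
      have h1 : |a - x| ≤ 1 := (Set.abs_sub_right_of_mem_uIcc hx).trans hab
      have h2 : |a| ≤ |a - x| + |x| := by simpa using abs_add_le (a - x) x
      have h3 : 1 + |a| ≤ 2 * (1 + |x|) := by linarith [abs_nonneg x]
      rw [div_le_div_iff₀ (by positivity) (by positivity)]
      calc (C : ℝ) * (1 + |a|) ^ 10 ≤ C * (2 * (1 + |x|)) ^ 10 := by gcongr
        _ = _ := by ring
    have := Convex.norm_image_sub_le_of_norm_deriv_le (𝕜 := ℝ)
      (fun x _ => f.differentiable x) hseg (convex_uIcc b a) Set.left_mem_uIcc Set.right_mem_uIcc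
    rw [mul_right_comm, wt_one_eq, ← ofReal_norm, ← ENNReal.ofReal_mul (by positivity)]
    refine ENNReal.ofReal_le_ofReal (this.trans (le_of_eq ?_))
    push_cast
    rw [Real.norm_eq_abs]

lemma psiOf_schwartz (φ : SchwartzMap ℝ ℂ) : ∃ ψ : SchwartzMap ℝ ℂ, psiOf φ = ψ := by
  refine ⟨(2 : ℂ) • SchwartzMap.compCLMOfContinuousLinearEquiv ℂ
    (ContinuousLinearEquiv.unitsEquivAut ℝ (Units.mk0 (2 : ℝ) two_ne_zero)) φ - φ, ?_⟩
  ext x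
  simp [psiOf, mul_comm]

lemma integral_psiOf (φ : SchwartzMap ℝ ℂ) : ∫ x, psiOf φ x = 0 := by
  have h1 : Integrable (fun x : ℝ => φ (2 * x)) := φ.integrable.comp_mul_left' two_ne_zero
  unfold psiOf
  rw [integral_sub (h1.const_mul 2) φ.integrable, integral_const_mul,
    Measure.integral_comp_mul_left (fun x => φ x)]
  simp

lemma Bump.mono {C D : ℝ≥0} {u : ℝ → ℂ} (hu : Bump C u) (h : C ≤ D) : Bump D u where
  cont := hu.cont
  bd x := (hu.bd x).trans (mul_le_mul_left (ENNReal.coe_le_coe.2 h) _)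
  lip a b hab := (hu.lip a b hab).trans
    (mul_le_mul_left (mul_le_mul_left (ENNReal.coe_le_coe.2 h) _) _)

lemma half_lt_toReal {a : ℝ≥0∞} (h : 1 / 2 < a) (h' : a < ∞) : 1 / 2 < a.toReal := by
  simpa using (ENNReal.toReal_lt_toReal (by finiteness) h'.ne).2 h

end Paraproduct

open Paraproduct
/-- Depth-two multiple vector-valued estimates for paraproducts:
`Π : L^p(ℓ^{r₁¹}(ℓ^{r₁²})) × L^q(ℓ^{r₂¹}(ℓ^{r₂²})) → L^s(ℓ^{r¹}(ℓ^{r²}))`. -/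
theorem paraproduct_depth_two_vector_valued
    (φ : SchwartzMap ℝ ℂ)
    (hφ₁ : ∀ ξ : ℝ, |ξ| ≤ 1 / 2 → ft1 (⇑φ) ξ = 1)
    (hφ₂ : ∀ ξ : ℝ, 1 ≤ |ξ| → ft1 (⇑φ) ξ = 0)
    (ra₁ ra₂ ra : ℝ≥0∞) (hra₁ : 1 < ra₁) (hra₂ : 1 < ra₂)
    (hra : 1 / 2 < ra) (hra' : ra < ∞) (hHa : ra⁻¹ = ra₁⁻¹ + ra₂⁻¹)
    (rb₁ rb₂ rb : ℝ≥0∞) (hrb₁ : 1 < rb₁) (hrb₂ : 1 < rb₂)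
    (hrb : 1 / 2 < rb) (hrb' : rb < ∞) (hHb : rb⁻¹ = rb₁⁻¹ + rb₂⁻¹)
    (p q s : ℝ≥0∞) (hp : 1 < p) (hq : 1 < q) (hs : 1 / 2 < s) (hs' : s < ∞)
    (hHs : s⁻¹ = p⁻¹ + q⁻¹) :
    ∃ C : ℝ≥0, ∀ (N M : ℕ) (Λ : Finset ℤ) (f g : ℕ → ℕ → SchwartzMap ℝ ℂ),
      LqNorm volume s (fun x => ellN ra N (fun k => ellN rb M
          (fun l => (‖para (⇑φ) Λ (⇑(f k l)) (⇑(g k l)) x‖₊ : ℝ≥0∞)))) ≤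
        (C : ℝ≥0∞) *
          LqNorm volume p (fun x => ellN ra₁ N (fun k => ellN rb₁ M
            (fun l => (‖f k l x‖₊ : ℝ≥0∞)))) *
          LqNorm volume q (fun x => ellN ra₂ N (fun k => ellN rb₂ M
            (fun l => (‖g k l x‖₊ : ℝ≥0∞)))) := by
  obtain ⟨ψ, hψ⟩ := psiOf_schwartz φ
  obtain ⟨C₁, hC₁⟩ := schwartz_bump φ
  obtain ⟨C₂, hC₂⟩ := schwartz_bump ψ
  have hu : Bump (max C₁ C₂) φ := hC₁.mono (le_max_left _ _)
  have hv : Bump (max C₁ C₂) (psiOf φ) := hψ ▸ hC₂.mono (le_max_right _ _)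
  set t : ℝ := min 1 (min ra.toReal rb.toReal) with ht_def
  have ht : 1 / 2 < t :=
    lt_min (by norm_num) (lt_min (half_lt_toReal hra hra') (half_lt_toReal hrb hrb'))
  have ht0 : 0 < t := by linarith
  have ht1 : t ≤ 1 := min_le_left _ _
  have hta : t ≤ ra.toReal := (min_le_right _ _).trans (min_le_left _ _)
  have htb : t ≤ rb.toReal := (min_le_right _ _).trans (min_le_right _ _)
  have hne : ∀ {a : ℝ≥0∞}, 1 < a → a ≠ 0 := fun h => (zero_lt_one.trans h).ne'
  have hra0 : ra ≠ 0 := ne_bot_of_gt hra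
  have hrb0 : rb ≠ 0 := ne_bot_of_gt hrb
  obtain ⟨A₀, hA₀⟩ := bddAt_top_two_two (max C₁ C₂)
  obtain ⟨A₁, hA₁⟩ := extrapolate ht ht1 (max C₁ C₂) A₀ (a₁ := ∞) (a₂ := 2) (a := 2)
    (by simp) (by norm_num) (by norm_num) (by norm_num) (by simp) hrb₁ hrb₂ hrb hrb' hHb
  obtain ⟨A₂, hA₂⟩ := extrapolate ht ht1 (max C₁ C₂) A₁ hrb₁ hrb₂ hrb0 hrb'.ne hHb
    hra₁ hra₂ hra hra' hHa
  obtain ⟨A₃, hA₃⟩ := extrapolate ht ht1 (max C₁ C₂) A₂ hra₁ hra₂ hra0 hra'.ne hHa hp hq hs hs' hHs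
  refine ⟨A₃, fun N M Λ f g => ?_⟩
  have H₁ : Setting t (max C₁ C₂) (fun a : Unit → ℝ≥0∞ => a ()) (fun a => a ()) (fun a => a ())
      φ (psiOf φ) (psiOf φ) :=
    ⟨unit_MinkNorm, unit_MinkNorm, unit_QNorm ht0 ht1, fun _ _ => le_rfl, hu, hv, hv⟩
  have B₁ := hA₁ H₁ (hA₀ hu hv hv (integral_psiOf φ) (integral_psiOf φ))
  have H₂ := H₁.ell ht0 hrb₁ hrb₂ hrb'.ne htb hHb M
  have B₂ := hA₂ H₂ (B₁.ell H₁ (hne hrb₁) (hne hrb₂) hrb0 hrb'.ne hHb M)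
  have H₃ := H₂.ell ht0 hra₁ hra₂ hra'.ne hta hHa N
  have B₃ := hA₃ H₃ (B₂.ell H₂ (hne hra₁) (hne hra₂) hra0 hra'.ne hHa N)
  exact B₃ Λ (fun i => f i.1 i.2.1) (fun i => g i.1 i.2.1) (fun _ => schwartz_nice _)
    fun _ => schwartz_nice _
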